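/- There exist constants ε₀, c₁ > 0, depending only on C₀ and c₀, with the following property. Let n ≥ 2, let μ be an even Borel probability measure on ℝⁿ with ψ₁ marginals with constants C₀, c₀, let 0 < ε < ε₀ and 0 < ζ < 1, and suppose that (1-ε)·(1-Φ(t)) ≤ ∫_{S^{n-1}} (1 - F^η(t)) dσ(η) ≤ (1+ε)·(1-Φ(t)) for all t ∈ [0,T], where 1 ≤ T ≤ ( c₁·n·ε² / (log n + log(1/ε) + log(1/ζ)) )^{1/6}. Then σ{ξ ∈ S^{n-1} : ∃ t ∈ [0,T] with |(1 - F^ξ(t))/(1 - Φ(t)) - 1| > 10ε} ≤ ζ. -/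

import Mathlib

open MeasureTheory Real
open scoped RealInnerProductSpace

/-- The standard Gaussian density `φ(t) = (2π)^{-1/2} e^{-t²/2}`. -/
noncomputable def gaussDensity (t : ℝ) : ℝ := Real.exp (-t ^ 2 / 2) / Real.sqrt (2 * Real.pi)

/-- The standard Gaussian distribution function `Φ(t) = ∫_{-∞}^t φ(s) ds`. -/
noncomputable def gaussCDF (t : ℝ) : ℝ := ∫ s in Set.Iic t, gaussDensity s

/-- The marginal distribution function `F^ξ(t) = μ{x : ⟨x, ξ⟩ < t}`. -/
noncomputable def marginalCDF {n : ℕ} (μ : Measure (EuclideanSpace ℝ (Fin n)))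
    (ξ : EuclideanSpace ℝ (Fin n)) (t : ℝ) : ℝ :=
  (μ {x | ⟪x, ξ⟫ < t}).toReal

/-- `σ` is the rotation-invariant probability measure on the unit sphere `S^{n-1}`,
viewed as a measure on the ambient space supported on the sphere. -/
structure IsUniformSphereMeasure {n : ℕ} (σ : Measure (EuclideanSpace ℝ (Fin n))) : Prop where
  prob : IsProbabilityMeasure σ
  sphere : σ (Metric.sphere (0 : EuclideanSpace ℝ (Fin n)) 1) = 1
  rotInv : ∀ O : EuclideanSpace ℝ (Fin n) ≃ₗᵢ[ℝ] EuclideanSpace ℝ (Fin n),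
    Measure.map O σ = σ

/-- `μ` has `ψ₁` marginals with constants `C₀, c₀`:
`μ{x : ⟨x, θ⟩ > s} ≤ C₀ exp(-c₀ s)` for all `s ≥ 0` and unit vectors `θ`. -/
def HasPsiOneMarginals {n : ℕ} (μ : Measure (EuclideanSpace ℝ (Fin n))) (C₀ c₀ : ℝ) : Prop :=
  ∀ θ : EuclideanSpace ℝ (Fin n), ‖θ‖ = 1 → ∀ s : ℝ, 0 ≤ s →
    (μ {x | s < ⟪x, θ⟫}).toReal ≤ C₀ * Real.exp (-c₀ * s)

/-- `μ` is an even measure. -/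
def Measure.IsEven {n : ℕ} (μ : Measure (EuclideanSpace ℝ (Fin n))) : Prop :=
  Measure.map (fun x => -x) μ = μ

/-- The `δ`-extension of a subset `A` of the unit sphere `S^{n-1}`. -/
def sphExt {n : ℕ} (A : Set (EuclideanSpace ℝ (Fin n))) (δ : ℝ) :
    Set (EuclideanSpace ℝ (Fin n)) :=
  {ξ | ‖ξ‖ = 1 ∧ ∃ η ∈ A, ‖ξ - η‖ ≤ δ}

namespace GaussMarginals

/-- The standard Gaussian tail `1 - Φ(t)`. -/
noncomputable def gaussTail (t : ℝ) : ℝ := ∫ s in Set.Ioi t, gaussDensity s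

lemma gaussDensity_eq_pdf (t : ℝ) :
    gaussDensity t = ProbabilityTheory.gaussianPDFReal 0 1 t := by
  simp only [gaussDensity, ProbabilityTheory.gaussianPDFReal, NNReal.coe_one, mul_one, sub_zero]
  rw [div_eq_mul_inv, mul_comm]

lemma gaussDensity_pos (t : ℝ) : 0 < gaussDensity t := by
  unfold gaussDensity; positivity

lemma continuous_gaussDensity : Continuous gaussDensity := by
  unfold gaussDensity; fun_prop

lemma integrable_gaussDensity : Integrable gaussDensity := by
  have : gaussDensity = ProbabilityTheory.gaussianPDFReal 0 1 := funext gaussDensity_eq_pdf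
  rw [this]; exact ProbabilityTheory.integrable_gaussianPDFReal 0 1

lemma integral_gaussDensity : ∫ t, gaussDensity t = 1 := by
  simp_rw [gaussDensity_eq_pdf]
  exact ProbabilityTheory.integral_gaussianPDFReal_eq_one 0 one_ne_zero

lemma gaussDensity_neg (t : ℝ) : gaussDensity (-t) = gaussDensity t := by
  simp [gaussDensity]

lemma sqrt_two_pi_bounds : 2.5 ≤ √(2 * π) ∧ √(2 * π) ≤ 2.51 := by
  have h1 := Real.pi_gt_d4
  have h2 := Real.pi_lt_d4
  constructor
  · apply Real.le_sqrt_of_sq_le; norm_num at *; linarith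
  · rw [Real.sqrt_le_left (by norm_num)]; norm_num at *; linarith

lemma gaussDensity_antitoneOn : AntitoneOn gaussDensity (Set.Ici 0) := by
  intro a ha b hb hab
  simp only [Set.mem_Ici] at ha hb
  unfold gaussDensity
  gcongr

lemma gaussDensity_le (t : ℝ) : gaussDensity t ≤ 2 / 5 := by
  have h := sqrt_two_pi_bounds.1
  unfold gaussDensity
  rw [div_le_iff₀ (by positivity)]
  have : rexp (-t ^ 2 / 2) ≤ 1 := Real.exp_le_one_iff.2 (by nlinarith [sq_nonneg t])
  linarith

lemma one_sub_gaussCDF (t : ℝ) : 1 - gaussCDF t = gaussTail t := by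
  unfold gaussCDF gaussTail
  rw [← integral_gaussDensity, ← intervalIntegral.integral_Iic_add_Ioi
    (integrable_gaussDensity.integrableOn) (integrable_gaussDensity.integrableOn) (b := t)]
  ring

lemma gaussTail_eq_measure (t : ℝ) :
    gaussTail t = (ProbabilityTheory.gaussianReal 0 1).real (Set.Ioi t) := by
  rw [Measure.real, ProbabilityTheory.gaussianReal_apply_eq_integral 0 one_ne_zero,
    ENNReal.toReal_ofReal]
  · unfold gaussTail; simp_rw [gaussDensity_eq_pdf]
  · exact integral_nonneg fun x => ProbabilityTheory.gaussianPDFReal_nonneg 0 1 x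

lemma gaussTail_sub (s t : ℝ) : gaussTail s - gaussTail t = ∫ x in s..t, gaussDensity x := by
  have hi : ∀ s : Set ℝ, IntegrableOn gaussDensity s := fun s => integrable_gaussDensity.integrableOn
  unfold gaussTail
  rw [intervalIntegral.integral_Ioi_sub_Ioi' (hi _) (hi _)]

lemma hasDerivAt_gaussTail (t : ℝ) : HasDerivAt gaussTail (-gaussDensity t) t := by
  have h : gaussTail = fun x => gaussTail 0 - ∫ y in (0:ℝ)..x, gaussDensity y := by
    funext x; rw [← gaussTail_sub]; ring
  rw [h]
  exact (intervalIntegral.integral_hasDerivAt_right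
    (continuous_gaussDensity.intervalIntegrable _ _)
    (continuous_gaussDensity.stronglyMeasurableAtFilter _ _)
    continuous_gaussDensity.continuousAt).const_sub _

lemma continuous_gaussTail : Continuous gaussTail :=
  continuous_iff_continuousAt.2 fun t => (hasDerivAt_gaussTail t).continuousAt

lemma gaussTail_strictAnti : StrictAnti gaussTail := by
  apply strictAnti_of_deriv_neg
  intro x
  rw [(hasDerivAt_gaussTail x).deriv]
  linarith [gaussDensity_pos x]

lemma gaussTail_anti : Antitone gaussTail := gaussTail_strictAnti.antitone

lemma gaussTail_pos (t : ℝ) : 0 < gaussTail t := by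
  have h : 0 ≤ gaussTail (t + 1) :=
    integral_nonneg fun x => (gaussDensity_pos x).le
  exact h.trans_lt (gaussTail_strictAnti (by linarith))

lemma gaussTail_neg (t : ℝ) : gaussTail (-t) = 1 - gaussTail t := by
  rw [← one_sub_gaussCDF (t := t), gaussCDF, gaussTail]
  have := integral_comp_neg_Iic t gaussDensity
  simp only [gaussDensity_neg] at this
  rw [← this]; ring

lemma gaussTail_zero : gaussTail 0 = 1 / 2 := by
  have := gaussTail_neg 0
  rw [neg_zero] at this; linarith

lemma gaussTail_lt_one (t : ℝ) : gaussTail t < 1 := by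
  have := gaussTail_pos (-t)
  rw [gaussTail_neg] at this; linarith

lemma gaussTail_le_half {t : ℝ} (ht : 0 ≤ t) : gaussTail t ≤ 1 / 2 := by
  rw [← gaussTail_zero]; exact gaussTail_anti ht

lemma gaussDensity_le_gaussTail {t : ℝ} (ht : 0 ≤ t) :
    gaussDensity t ≤ 3 * (1 + t) * gaussTail t := by
  set u := 1 / (1 + t) with hu
  have h1t : 0 < 1 + t := by linarith
  have hu0 : 0 < u := by positivity
  have hut : u * (1 + t) = 1 := by rw [hu]; field_simp
  have key : u * gaussDensity (t + u) ≤ gaussTail t := by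
    have h1 : ∫ x in t..(t + u), gaussDensity (t + u) ≤ ∫ x in t..(t + u), gaussDensity x := by
      apply intervalIntegral.integral_mono_on (by linarith) (by simp)
        (continuous_gaussDensity.intervalIntegrable _ _)
      intro x hx
      exact gaussDensity_antitoneOn (show 0 ≤ x by linarith [hx.1]) (show 0 ≤ t + u by linarith) hx.2
    rw [← gaussTail_sub, intervalIntegral.integral_const] at h1
    simp only [add_sub_cancel_left, smul_eq_mul] at h1
    linarith [gaussTail_pos (t + u)]
  have h2 : gaussDensity t ≤ 3 * gaussDensity (t + u) := by
    unfold gaussDensity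
    rw [← mul_div_assoc]
    gcongr
    have hexp : -t ^ 2 / 2 ≤ 1 + -(t + u) ^ 2 / 2 := by
      have : t * u + u ^ 2 / 2 ≤ 1 := by nlinarith
      nlinarith
    calc rexp (-t ^ 2 / 2) ≤ rexp (1 + -(t + u) ^ 2 / 2) := Real.exp_le_exp.2 hexp
      _ = rexp 1 * rexp (-(t + u) ^ 2 / 2) := Real.exp_add _ _
      _ ≤ 3 * rexp (-(t + u) ^ 2 / 2) := by
        gcongr; linarith [Real.exp_one_lt_d9]
  calc gaussDensity t ≤ 3 * gaussDensity (t + u) := h2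
    _ = 3 * (1 + t) * (u * gaussDensity (t + u)) := by
      have : 3 * (1 + t) * (u * gaussDensity (t + u)) = 3 * (u * (1 + t)) * gaussDensity (t + u) := by ring
      rw [this, hut]; ring
    _ ≤ _ := by gcongr

lemma gaussDensity_le_gaussTail_of_le {s t : ℝ} (hst : s ≤ t) (ht : 0 ≤ t) :
    gaussDensity s ≤ 3 * (1 + t) * gaussTail s := by
  rcases le_total 0 s with hs | hs
  · refine (gaussDensity_le_gaussTail hs).trans ?_
    have := gaussTail_pos s
    gcongr
  · have h1 := gaussDensity_le s
    have h2 : 1 / 2 ≤ gaussTail s := by rw [← gaussTail_zero]; exact gaussTail_anti hs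
    nlinarith

lemma gaussTail_le_exp_mul {s t : ℝ} (hst : s ≤ t) (ht : 0 ≤ t) :
    gaussTail s ≤ gaussTail t * rexp (3 * (1 + t) * (t - s)) := by
  set c := 3 * (1 + t)
  have hd : ∀ x, HasDerivAt (fun x => gaussTail x * rexp (c * x))
      ((-gaussDensity x) * rexp (c * x) + gaussTail x * (rexp (c * x) * (c * 1))) x := fun x =>
    (hasDerivAt_gaussTail x).mul (((hasDerivAt_id x).const_mul c).exp)
  have hm : MonotoneOn (fun x => gaussTail x * rexp (c * x)) (Set.Iic t) := by
    apply monotoneOn_of_deriv_nonneg (convex_Iic t)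
    · exact fun x _ => (hd x).continuousAt.continuousWithinAt
    · exact fun x _ => (hd x).differentiableAt.differentiableWithinAt
    · intro x hx
      rw [interior_Iic] at hx
      rw [(hd x).deriv]
      have := gaussDensity_le_gaussTail_of_le (le_of_lt hx) ht
      have h2 := Real.exp_pos (c * x)
      have : 0 ≤ (c * gaussTail x - gaussDensity x) * rexp (c * x) :=
        mul_nonneg (by linarith) h2.le
      linarith
  have h := hm (show s ∈ Set.Iic t from hst) (show t ∈ Set.Iic t from le_refl t) hst
  simp only at h
  have e : c * (t - s) = c * t - c * s := by ring
  rw [e, Real.exp_sub, ← mul_div_assoc, le_div_iff₀ (Real.exp_pos _)]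
  exact h

lemma le_gaussTail {t : ℝ} (ht : 0 ≤ t) : rexp (-t ^ 2) / 12 ≤ gaussTail t := by
  have h1 := gaussDensity_le_gaussTail ht
  have h2 : 1 + t ≤ 1.5 * rexp (t ^ 2 / 2) := by
    have := Real.add_one_le_exp (t ^ 2 / 2)
    nlinarith [sq_nonneg (t - 1)]
  have hs := sqrt_two_pi_bounds.2
  have h0 := gaussTail_pos t
  have h3 : rexp (-t ^ 2 / 2) ≤ gaussDensity t * 2.51 := by
    unfold gaussDensity
    rw [div_mul_eq_mul_div, le_div_iff₀ (by positivity)]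
    have := Real.exp_pos (-t ^ 2 / 2)
    nlinarith
  have h4 : rexp (-t ^ 2) = rexp (-t ^ 2 / 2) * rexp (-(t ^ 2 / 2)) := by
    rw [← Real.exp_add]; congr 1; ring
  have h5 : rexp (t ^ 2 / 2) * rexp (-(t ^ 2 / 2)) = 1 := by rw [← Real.exp_add]; simp
  have h6 := Real.exp_pos (-(t ^ 2 / 2))
  rw [h4]
  have h7 : rexp (-t ^ 2 / 2) ≤ 11.5 * gaussTail t * rexp (t ^ 2 / 2) := by nlinarith
  have := mul_le_mul_of_nonneg_right h7 h6.le
  rw [mul_assoc, h5] at this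
  linarith

lemma gaussTail_mul_le {K t : ℝ} (hK : 1 ≤ K) (ht : 0 ≤ t) :
    gaussTail (K * t) ≤ K * rexp (-(K ^ 2 - 1) * t ^ 2 / 2) * gaussTail t := by
  have hK0 : 0 < K := by linarith
  have h1 : gaussTail (K * t) = K * ∫ x in Set.Ioi t, gaussDensity (K * x) := by
    rw [MeasureTheory.integral_comp_mul_left_Ioi gaussDensity t hK0, gaussTail, smul_eq_mul]
    field_simp
  rw [h1, mul_assoc]
  gcongr
  rw [gaussTail, ← integral_const_mul]
  apply setIntegral_mono_on
  · exact ((integrable_gaussDensity.comp_mul_left' hK0.ne')).integrableOn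
  · exact (integrable_gaussDensity.const_mul _).integrableOn
  · exact measurableSet_Ioi
  · intro x hx
    have hx' : t < x := hx
    unfold gaussDensity
    rw [← mul_div_assoc, ← Real.exp_add]
    gcongr
    have : (K ^ 2 - 1) * t ^ 2 ≤ (K ^ 2 - 1) * x ^ 2 := by
      have : 0 ≤ K ^ 2 - 1 := by nlinarith
      gcongr
    nlinarith

lemma gaussTail_le_exp {t : ℝ} (ht : 0 ≤ t) : gaussTail t ≤ rexp (-t ^ 2 / 2) := by
  have h1 : gaussTail t = ∫ x in Set.Ioi 0, gaussDensity (x + t) := by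
    have h := (measurePreserving_add_right volume t).setIntegral_preimage_emb
      (measurableEmbedding_addRight t) gaussDensity (Set.Ioi t)
    rw [gaussTail, ← h]
    simp
  have h2 : ∫ x in Set.Ioi 0, gaussDensity (x + t) ≤
      ∫ x in Set.Ioi 0, rexp (-t ^ 2 / 2) * gaussDensity x := by
    apply setIntegral_mono_on
    · exact (integrable_gaussDensity.comp_add_right t).integrableOn
    · exact (integrable_gaussDensity.const_mul _).integrableOn
    · exact measurableSet_Ioi
    · intro x hx
      have hx' : 0 < x := hx
      unfold gaussDensity
      rw [← mul_div_assoc, ← Real.exp_add]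
      gcongr
      nlinarith
  rw [integral_const_mul] at h2
  have h3 : ∫ x in Set.Ioi 0, gaussDensity x = 1 / 2 := gaussTail_zero
  rw [h3] at h2
  have := Real.exp_pos (-t ^ 2 / 2)
  linarith

lemma convexOn_gaussTail : ConvexOn ℝ (Set.Ici 0) gaussTail := by
  apply MonotoneOn.convexOn_of_deriv (convex_Ici 0) continuous_gaussTail.continuousOn
  · exact fun x _ => (hasDerivAt_gaussTail x).differentiableAt.differentiableWithinAt
  · intro x hx y hy hxy
    rw [interior_Ici] at hx hy
    rw [(hasDerivAt_gaussTail x).deriv, (hasDerivAt_gaussTail y).deriv]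
    exact neg_le_neg (gaussDensity_antitoneOn (show 0 ≤ x from le_of_lt hx)
      (show 0 ≤ y from le_of_lt hy) hxy)

section Concentration

open ProbabilityTheory
open scoped ContDiff

variable {E : Type*} [NormedAddCommGroup E] [InnerProductSpace ℝ E] [FiniteDimensional ℝ E]
  [MeasurableSpace E] [BorelSpace E]

lemma exists_contDiff_lipschitz_approx {f : E → ℝ} (hf : LipschitzWith 1 f) {e : ℝ} (he : 0 < e) :
    ∃ g : E → ℝ, ContDiff ℝ 1 g ∧ LipschitzWith 1 g ∧ ∀ x, |g x - f x| ≤ e := by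
  set φ : ContDiffBump (0 : E) := ⟨e / 2, e, half_pos he, half_lt_self he⟩
  have hli : LocallyIntegrable f (volume : Measure E) := hf.continuous.locallyIntegrable
  have hi : ∀ a : E, Integrable (fun t => φ.normed volume t * f (a - t)) := by
    intro a
    have hc : Continuous (fun t => φ.normed volume t * f (a - t)) :=
      φ.continuous_normed.mul (hf.continuous.comp (by fun_prop))
    exact hc.integrable_of_hasCompactSupport (φ.hasCompactSupport_normed.mul_right)
  set g : E → ℝ := fun a => ∫ t, φ.normed volume t * f (a - t)
  have hg : g = (convolution (φ.normed volume) f (ContinuousLinearMap.lsmul ℝ ℝ) volume) := by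
    funext a; simp [g, convolution]
  refine ⟨g, ?_, ?_, ?_⟩
  · rw [hg]
    exact φ.hasCompactSupport_normed.contDiff_convolution_left _ φ.contDiff_normed hli
  · apply LipschitzWith.of_dist_le_mul
    intro a b
    rw [Real.dist_eq, ← integral_sub (hi a) (hi b), NNReal.coe_one, one_mul]
    have hn : ∫ t, φ.normed volume t * dist a b = dist a b := by
      rw [integral_mul_const, φ.integral_normed, one_mul]
    rw [← hn, ← Real.norm_eq_abs]
    apply norm_integral_le_of_norm_le (φ.integrable_normed.mul_const _)
    filter_upwards with t
    rw [← mul_sub, norm_mul, Real.norm_of_nonneg (φ.nonneg_normed t)]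
    gcongr
    · exact φ.nonneg_normed t
    have := hf.dist_le_mul (a - t) (b - t)
    simpa [Real.dist_eq, dist_eq_norm] using this
  · intro x
    have := φ.dist_normed_convolution_le (g := f) (x₀ := x) (ε := e) (μ := volume)
      hf.continuous.aestronglyMeasurable ?_
    · rw [← hg, Real.dist_eq] at this; exact this
    · intro y hy
      have h1 := hf.dist_le_mul y x
      rw [NNReal.coe_one, one_mul] at h1
      exact h1.trans (le_of_lt hy)

lemma map_dual_stdGaussian (L : StrongDual ℝ E) :
    (stdGaussian E).map L = gaussianReal 0 (‖L‖ ^ 2).toNNReal := by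
  rw [IsGaussian.map_eq_gaussianReal, integral_strongDual_stdGaussian, variance_dual_stdGaussian]

lemma lintegral_exp_dual_stdGaussian (L : StrongDual ℝ E) :
    ∫⁻ x, ENNReal.ofReal (rexp (L x)) ∂(stdGaussian E) = ENNReal.ofReal (rexp (‖L‖ ^ 2 / 2)) := by
  have h := mgf_gaussianReal (p := stdGaussian E) (X := L) (map_dual_stdGaussian L) 1
  have hi : Integrable (fun x => rexp (L x)) (stdGaussian E) := by
    have := integrable_exp_mul_gaussianReal (μ := 0) (v := (‖L‖ ^ 2).toNNReal) 1
    rw [← map_dual_stdGaussian L] at this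
    have := (integrable_map_measure (by fun_prop) (by fun_prop)).1 this
    simpa [Function.comp_def] using this
  rw [← ofReal_integral_eq_lintegral_ofReal hi (by filter_upwards with x; positivity)]
  congr 1
  have : mgf L (stdGaussian E) 1 = ∫ x, rexp (L x) ∂(stdGaussian E) := by simp [mgf]
  rw [← this, h]
  simp

lemma exp_intervalIntegral_le {D : ℝ → ℝ} (hD : Continuous D) :
    rexp (∫ θ in (0:ℝ)..(π / 2), D θ) ≤ (2 / π) * ∫ θ in (0:ℝ)..(π / 2), rexp (π / 2 * D θ) := by
  have hpi := Real.pi_pos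
  have h0 : (volume.restrict (Set.Ioc (0:ℝ) (π / 2))) Set.univ ≠ 0 := by
    simp [hpi]
  have : NeZero (volume.restrict (Set.Ioc (0:ℝ) (π / 2))) := ⟨fun h => by simp [h] at h0⟩
  have := convexOn_exp.map_average_le (μ := volume.restrict (Set.Ioc (0:ℝ) (π / 2)))
    (f := fun θ => π / 2 * D θ) continuous_exp.continuousOn isClosed_univ (by simp)
    ((by fun_prop : Continuous fun θ => π / 2 * D θ).integrableOn_Ioc)
    ((by fun_prop : Continuous (rexp ∘ fun θ => π / 2 * D θ)).integrableOn_Ioc)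
  rw [average_eq, average_eq] at this
  simp only [measureReal_restrict_apply_univ, Real.volume_real_Ioc_of_le (by positivity : (0:ℝ) ≤ π/2),
    sub_zero, smul_eq_mul, integral_const_mul] at this
  rw [intervalIntegral.integral_of_le (by positivity), intervalIntegral.integral_of_le (by positivity)]
  calc _ = rexp ((π / 2)⁻¹ * (π / 2 * ∫ (a : ℝ) in Set.Ioc 0 (π / 2), D a)) := by
        congr 1; field_simp
    _ ≤ _ := this
    _ = _ := by rw [inv_div]

omit [FiniteDimensional ℝ E] [MeasurableSpace E] [BorelSpace E] in
lemma hasDerivAt_comp_rotation {g : E → ℝ} (hg : ContDiff ℝ 1 g) (x y : E) (θ : ℝ) :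
    HasDerivAt (fun θ : ℝ => g (Real.cos θ • x + Real.sin θ • y))
      (fderiv ℝ g (Real.cos θ • x + Real.sin θ • y) (-Real.sin θ • x + Real.cos θ • y)) θ := by
  have hx : HasDerivAt (fun θ : ℝ => Real.cos θ • x) (-Real.sin θ • x) θ :=
    (Real.hasDerivAt_cos θ).smul_const x
  have hy : HasDerivAt (fun θ : ℝ => Real.sin θ • y) (Real.cos θ • y) θ :=
    (Real.hasDerivAt_sin θ).smul_const y
  have h1 : HasDerivAt (fun θ : ℝ => Real.cos θ • x + Real.sin θ • y)
      (-Real.sin θ • x + Real.cos θ • y) θ := hx.fun_add hy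
  exact HasFDerivAt.comp_hasDerivAt (l := g) θ
    ((hg.differentiable one_ne_zero) (Real.cos θ • x + Real.sin θ • y)).hasFDerivAt h1

omit [FiniteDimensional ℝ E] [MeasurableSpace E] [BorelSpace E] in
lemma continuous_fderiv_rotation {g : E → ℝ} (hg : ContDiff ℝ 1 g) :
    Continuous fun p : (E × E) × ℝ => fderiv ℝ g (Real.cos p.2 • p.1.1 + Real.sin p.2 • p.1.2)
      (-Real.sin p.2 • p.1.1 + Real.cos p.2 • p.1.2) := by
  have hfd : Continuous (fderiv ℝ g) := hg.continuous_fderiv one_ne_zero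
  apply Continuous.clm_apply
  · exact hfd.comp (by fun_prop)
  · fun_prop

omit [FiniteDimensional ℝ E] [MeasurableSpace E] [BorelSpace E] in
lemma sub_eq_integral_rotation {g : E → ℝ} (hg : ContDiff ℝ 1 g) (x y : E) :
    g y - g x = ∫ θ in (0:ℝ)..(π / 2), fderiv ℝ g (Real.cos θ • x + Real.sin θ • y)
      (-Real.sin θ • x + Real.cos θ • y) := by
  have h1 : Continuous fun θ : ℝ => (((x, y), θ) : (E × E) × ℝ) := by fun_prop
  have h2 := (continuous_fderiv_rotation hg).comp h1
  rw [intervalIntegral.integral_eq_sub_of_hasDerivAt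
    (fun θ _ => hasDerivAt_comp_rotation hg x y θ) (h2.intervalIntegrable _ _)]
  simp

lemma ofReal_exp_intervalIntegral_le {D : ℝ → ℝ} (hD : Continuous D) :
    ENNReal.ofReal (rexp (∫ θ in (0:ℝ)..(π / 2), D θ)) ≤
      ENNReal.ofReal (2 / π) * ∫⁻ θ in Set.Ioc (0:ℝ) (π / 2), ENNReal.ofReal (rexp (π / 2 * D θ)) := by
  have hpi := Real.pi_pos
  have hc : Continuous fun θ => rexp (π / 2 * D θ) := by fun_prop
  rw [← ofReal_integral_eq_lintegral_ofReal hc.integrableOn_Ioc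
      (by filter_upwards with x; positivity), ← ENNReal.ofReal_mul (by positivity),
      ← intervalIntegral.integral_of_le (by positivity)]
  exact ENNReal.ofReal_le_ofReal (exp_intervalIntegral_le hD)

lemma lintegral_exp_fderiv_rotation_le {g : E → ℝ} (hg : ContDiff ℝ 1 g) (hL : LipschitzWith 1 g)
    (c θ : ℝ) :
    ∫⁻ z, ENNReal.ofReal (rexp (c * fderiv ℝ g (Real.cos θ • z.1 + Real.sin θ • z.2)
      (-Real.sin θ • z.1 + Real.cos θ • z.2))) ∂((stdGaussian E).prod (stdGaussian E)) ≤
      ENNReal.ofReal (rexp (c ^ 2 / 2)) := by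
  have hcont : Continuous fun z : E × E => fderiv ℝ g z.1 z.2 :=
    ((hg.continuous_fderiv one_ne_zero).comp continuous_fst).clm_apply continuous_snd
  have hmF : Measurable fun z : E × E => ENNReal.ofReal (rexp (c * fderiv ℝ g z.1 z.2)) :=
    (Real.continuous_exp.comp (continuous_const.mul hcont)).measurable.ennreal_ofReal
  have hrot := IsGaussian.map_rotation_eq_self (μ := stdGaussian E) (by simp) θ
  have h1 := lintegral_map hmF (ContinuousLinearMap.rotation (E := E) θ).measurable
    (μ := (stdGaussian E).prod (stdGaussian E))
  rw [hrot] at h1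
  simp only [ContinuousLinearMap.rotation_apply] at h1
  rw [← h1, lintegral_prod _ hmF.aemeasurable]
  calc ∫⁻ x, ∫⁻ y, ENNReal.ofReal (rexp (c * fderiv ℝ g x y)) ∂(stdGaussian E) ∂(stdGaussian E)
      ≤ ∫⁻ x, ENNReal.ofReal (rexp (c ^ 2 / 2)) ∂(stdGaussian E) := by
        apply lintegral_mono
        intro x
        have := lintegral_exp_dual_stdGaussian (c • fderiv ℝ g x)
        simp only [smul_apply, smul_eq_mul] at this
        simp only
        rw [this]
        apply ENNReal.ofReal_le_ofReal (Real.exp_le_exp.2 _)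
        have hn : ‖fderiv ℝ g x‖ ≤ 1 := by
          simpa using norm_fderiv_le_of_lipschitz ℝ hL (x₀ := x)
        rw [norm_smul, mul_pow, Real.norm_eq_abs, sq_abs]
        have : ‖fderiv ℝ g x‖ ^ 2 ≤ 1 := by
          have := norm_nonneg (fderiv ℝ g x); nlinarith
        have h2 : 0 ≤ c ^ 2 := sq_nonneg _
        nlinarith
    _ = _ := by simp

lemma lintegral_exp_sub_le_of_contDiff {g : E → ℝ} (hg : ContDiff ℝ 1 g) (hL : LipschitzWith 1 g)
    (l : ℝ) :
    ∫⁻ z, ENNReal.ofReal (rexp (l * (g z.2 - g z.1))) ∂((stdGaussian E).prod (stdGaussian E)) ≤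
      ENNReal.ofReal (rexp (π ^ 2 * l ^ 2 / 8)) := by
  have hpi := Real.pi_pos
  obtain ⟨D, hD⟩ : ∃ D : E × E → ℝ → ℝ, ∀ z θ, D z θ =
    l * fderiv ℝ g (Real.cos θ • z.1 + Real.sin θ • z.2) (-Real.sin θ • z.1 + Real.cos θ • z.2) :=
    ⟨_, fun _ _ => rfl⟩
  obtain ⟨P, hP⟩ : ∃ P, P = stdGaussian E := ⟨_, rfl⟩
  have hPp : IsProbabilityMeasure P := hP ▸ inferInstance
  have hDc : Continuous (Function.uncurry D) := by
    have h1 := (continuous_const (y := l)).mul (continuous_fderiv_rotation hg)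
    have h2 : Function.uncurry D = fun p : (E × E) × ℝ => l *
        fderiv ℝ g (Real.cos p.2 • p.1.1 + Real.sin p.2 • p.1.2)
          (-Real.sin p.2 • p.1.1 + Real.cos p.2 • p.1.2) := funext fun p => hD p.1 p.2
    rw [h2]; exact h1
  have hDz : ∀ z, Continuous (D z) := by
    intro z
    have h1 : Continuous fun θ : ℝ => ((z, θ) : (E × E) × ℝ) := by fun_prop
    exact hDc.comp h1
  have hstep : ∀ z : E × E, ENNReal.ofReal (rexp (l * (g z.2 - g z.1))) ≤
      ENNReal.ofReal (2 / π) * ∫⁻ θ in Set.Ioc (0:ℝ) (π / 2), ENNReal.ofReal (rexp (π / 2 * D z θ)) := by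
    intro z
    have hftc : l * (g z.2 - g z.1) = ∫ θ in (0:ℝ)..(π / 2), D z θ := by
      simp_rw [hD]
      rw [sub_eq_integral_rotation hg, intervalIntegral.integral_const_mul]
    rw [hftc]; exact ofReal_exp_intervalIntegral_le (hDz z)
  have hmeas : Measurable (Function.uncurry fun (z : E × E) θ => ENNReal.ofReal (rexp (π / 2 * D z θ))) :=
    (Real.continuous_exp.comp ((continuous_const (y := π / 2)).mul hDc)).measurable.ennreal_ofReal
  have hθ : ∀ θ : ℝ, ∫⁻ z, ENNReal.ofReal (rexp (π / 2 * D z θ)) ∂(P.prod P) ≤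
      ENNReal.ofReal (rexp (π ^ 2 * l ^ 2 / 8)) := by
    intro θ
    have h := lintegral_exp_fderiv_rotation_le hg hL (π / 2 * l) θ
    have e : (π / 2 * l) ^ 2 / 2 = π ^ 2 * l ^ 2 / 8 := by ring
    rw [e] at h
    rw [hP]
    simpa only [hD, mul_assoc] using h
  rw [← hP]
  calc ∫⁻ z, ENNReal.ofReal (rexp (l * (g z.2 - g z.1))) ∂(P.prod P)
      ≤ ∫⁻ z, ENNReal.ofReal (2 / π) * ∫⁻ θ in Set.Ioc (0:ℝ) (π / 2),
        ENNReal.ofReal (rexp (π / 2 * D z θ)) ∂volume ∂(P.prod P) := lintegral_mono hstep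
    _ = ENNReal.ofReal (2 / π) * ∫⁻ θ in Set.Ioc (0:ℝ) (π / 2), ∫⁻ z,
        ENNReal.ofReal (rexp (π / 2 * D z θ)) ∂(P.prod P) ∂volume := by
        rw [lintegral_const_mul, lintegral_lintegral_swap hmeas.aemeasurable]
        exact Measurable.lintegral_prod_right hmeas
    _ ≤ ENNReal.ofReal (2 / π) * ∫⁻ θ in Set.Ioc (0:ℝ) (π / 2),
        ENNReal.ofReal (rexp (π ^ 2 * l ^ 2 / 8)) := by
        gcongr with θ; exact hθ θ
    _ = _ := by
        rw [setLIntegral_const, Real.volume_Ioc, sub_zero, mul_comm (ENNReal.ofReal (rexp _)),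
          ← mul_assoc, ← ENNReal.ofReal_mul (by positivity)]
        have : 2 / π * (π / 2) = 1 := by field_simp
        rw [this]; simp

/-- The Maurey–Pisier inequality. -/
lemma lintegral_exp_sub_le {f : E → ℝ} (hL : LipschitzWith 1 f) (l : ℝ) :
    ∫⁻ z, ENNReal.ofReal (rexp (l * (f z.2 - f z.1))) ∂((stdGaussian E).prod (stdGaussian E)) ≤
      ENNReal.ofReal (rexp (π ^ 2 * l ^ 2 / 8)) := by
  have key : ∀ e : ℝ, 0 < e →
      ∫⁻ z, ENNReal.ofReal (rexp (l * (f z.2 - f z.1))) ∂((stdGaussian E).prod (stdGaussian E)) ≤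
      ENNReal.ofReal (rexp (|l| * (2 * e)) * rexp (π ^ 2 * l ^ 2 / 8)) := by
    intro e he
    obtain ⟨g, hg, hgL, hgf⟩ := exists_contDiff_lipschitz_approx hL he
    calc _ ≤ ∫⁻ z, ENNReal.ofReal (rexp (|l| * (2 * e))) * ENNReal.ofReal (rexp (l * (g z.2 - g z.1)))
          ∂((stdGaussian E).prod (stdGaussian E)) := by
          apply lintegral_mono
          intro z
          simp only
          rw [← ENNReal.ofReal_mul (by positivity), ← Real.exp_add]
          apply ENNReal.ofReal_le_ofReal
          apply Real.exp_le_exp.2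
          have h1 := abs_le.1 (hgf z.1)
          have h2 := abs_le.1 (hgf z.2)
          have h3 : |(f z.2 - f z.1) - (g z.2 - g z.1)| ≤ 2 * e := abs_le.2 ⟨by linarith, by linarith⟩
          have h4 : l * ((f z.2 - f z.1) - (g z.2 - g z.1)) ≤ |l| * (2 * e) :=
            (le_abs_self _).trans (by rw [abs_mul]; gcongr)
          linarith
      _ ≤ _ := by
          rw [lintegral_const_mul' _ _ ENNReal.ofReal_ne_top, ENNReal.ofReal_mul (by positivity)]
          gcongr
          exact lintegral_exp_sub_le_of_contDiff hg hgL l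
  have ht : Filter.Tendsto (fun e : ℝ => ENNReal.ofReal (rexp (|l| * (2 * e)) * rexp (π ^ 2 * l ^ 2 / 8)))
      (nhdsWithin 0 (Set.Ioi 0)) (nhds (ENNReal.ofReal (rexp (|l| * (2 * 0)) * rexp (π ^ 2 * l ^ 2 / 8)))) := by
    apply ENNReal.tendsto_ofReal
    exact ((by fun_prop : Continuous fun e : ℝ => rexp (|l| * (2 * e)) * rexp (π ^ 2 * l ^ 2 / 8)).tendsto 0).mono_left
      nhdsWithin_le_nhds
  have := ge_of_tendsto ht (by filter_upwards [self_mem_nhdsWithin] with e he using key e he)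
  simpa using this

end Concentration

section Concentration

open ProbabilityTheory

variable {E : Type*} [NormedAddCommGroup E] [InnerProductSpace ℝ E] [FiniteDimensional ℝ E]
  [MeasurableSpace E] [BorelSpace E]

/-- Two sets at distance at least `s` cannot both have large Gaussian measure. -/
lemma stdGaussian_mul_le {A B : Set E} (hA : MeasurableSet A) (hB : MeasurableSet B) {s : ℝ}
    (hs : 0 ≤ s) (hAB : ∀ x ∈ A, ∀ y ∈ B, s ≤ dist x y) :
    (stdGaussian E).real A * (stdGaussian E).real B ≤ rexp (-s ^ 2 / 5) := by
  rcases A.eq_empty_or_nonempty with rfl | hne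
  · simp; positivity
  set l : ℝ := 4 * s / π ^ 2
  have hpi := Real.pi_pos
  have hpi2 : π ^ 2 < 10 := by nlinarith [Real.pi_lt_d4, Real.pi_gt_d4]
  have hl : 0 ≤ l := by positivity
  have h1 := lintegral_exp_sub_le (Metric.lipschitz_infDist_pt A) l
  have h2 : ENNReal.ofReal (rexp (l * s)) * ((stdGaussian E).prod (stdGaussian E)) (A ×ˢ B) ≤
      ∫⁻ z, ENNReal.ofReal (rexp (l * (Metric.infDist z.2 A - Metric.infDist z.1 A)))
        ∂((stdGaussian E).prod (stdGaussian E)) := by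
    rw [← setLIntegral_const]
    refine (setLIntegral_mono' (hA.prod hB) ?_).trans (setLIntegral_le_lintegral _ _)
    rintro ⟨x, y⟩ ⟨hx, hy⟩
    apply ENNReal.ofReal_le_ofReal
    apply Real.exp_le_exp.2
    gcongr
    have e1 : Metric.infDist x A = 0 := Metric.infDist_zero_of_mem hx
    have e2 : s ≤ Metric.infDist y A := by
      apply (Metric.le_infDist hne).2
      intro z hz; rw [dist_comm]; exact hAB z hz y hy
    simp only at *
    linarith
  have h3 := h2.trans h1
  rw [Measure.prod_prod] at h3
  have h4 := ENNReal.toReal_mono ENNReal.ofReal_ne_top h3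
  rw [ENNReal.toReal_mul, ENNReal.toReal_mul, ENNReal.toReal_ofReal (by positivity),
    ENNReal.toReal_ofReal (by positivity)] at h4
  have h5 : (stdGaussian E).real A * (stdGaussian E).real B ≤
      rexp (π ^ 2 * l ^ 2 / 8) / rexp (l * s) := by
    rw [le_div_iff₀ (by positivity), mul_comm]; exact h4
  refine h5.trans ?_
  rw [← Real.exp_sub]
  apply Real.exp_le_exp.2
  have : π ^ 2 * l ^ 2 / 8 - l * s = - (2 / π ^ 2) * s ^ 2 := by
    simp only [l]; field_simp; ring
  rw [this]
  have : 1 / 5 ≤ 2 / π ^ 2 := by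
    rw [div_le_div_iff₀ (by norm_num) (by positivity)]; linarith
  nlinarith [sq_nonneg s]

lemma integral_norm_sq_stdGaussian :
    ∫ x, ‖x‖ ^ 2 ∂(stdGaussian E) = Module.finrank ℝ E := by
  have b := stdOrthonormalBasis ℝ E
  have h1 : ∀ x : E, ‖x‖ ^ 2 = ∑ i, (innerSL ℝ (b i) x) ^ 2 := fun x => by
    simp only [innerSL_apply_apply]
    exact (b.sum_sq_inner_right x).symm
  have hv : ∀ i, ∫ x, (innerSL ℝ (b i) x) ^ 2 ∂(stdGaussian E) = 1 := by
    intro i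
    have := variance_dual_stdGaussian (innerSL ℝ (b i))
    rw [variance_of_integral_eq_zero (by fun_prop) (integral_strongDual_stdGaussian _)] at this
    rw [this]; simp
  have hi : ∀ i, Integrable (fun x => (innerSL ℝ (b i) x) ^ 2) (stdGaussian E) := by
    intro i
    by_contra h
    have := hv i
    rw [integral_undef h] at this
    norm_num at this
  simp_rw [h1]
  rw [integral_finsetSum _ (fun i _ => hi i)]
  simp_rw [hv]; simp

lemma integrable_norm_sq_stdGaussian :
    Integrable (fun x : E => ‖x‖ ^ 2) (stdGaussian E) := by
  have := (IsGaussian.memLp_two_id (μ := stdGaussian E)).norm.integrable_sq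
  simpa using this

lemma integrable_norm_stdGaussian : Integrable (fun x : E => ‖x‖) (stdGaussian E) :=
  (IsGaussian.integrable_id (μ := stdGaussian E)).norm

lemma sq_le_exp_add_exp_neg (d : ℝ) : d ^ 2 ≤ rexp d + rexp (-d) := by
  have h1 : |d / 2| ^ 2 ≤ Real.sinh |d / 2| ^ 2 := by
    gcongr; exact Real.self_le_sinh_iff.2 (abs_nonneg _)
  have h2 : Real.sinh |d / 2| ^ 2 = Real.sinh (d / 2) ^ 2 := by rw [← Real.abs_sinh, sq_abs]
  have h3 : 4 * Real.sinh (d / 2) ^ 2 = rexp d + rexp (-d) - 2 := by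
    rw [Real.sinh_eq]
    have e1 : rexp d = rexp (d / 2) ^ 2 := by rw [← Real.exp_nat_mul]; congr 1; push_cast; ring
    have e2 : rexp (-d) = rexp (-(d / 2)) ^ 2 := by rw [← Real.exp_nat_mul]; congr 1; push_cast; ring
    have e3 : rexp (d / 2) * rexp (-(d / 2)) = 1 := by rw [← Real.exp_add]; simp
    rw [e1, e2]; linear_combination (-2) * e3
  rw [sq_abs, h2] at h1
  nlinarith

lemma sq_integral_norm_stdGaussian :
    (Module.finrank ℝ E : ℝ) - 4 ≤ (∫ x, ‖x‖ ∂(stdGaussian E)) ^ 2 := by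
  set P := stdGaussian E
  have hb := fun l => lintegral_exp_sub_le (lipschitzWith_one_norm (E := E)) l
  have hle : ∫⁻ z, ENNReal.ofReal ((‖z.2‖ - ‖z.1‖) ^ 2) ∂(P.prod P) ≤ ENNReal.ofReal 8 := by
    calc _ ≤ ∫⁻ z, (ENNReal.ofReal (rexp (1 * (‖z.2‖ - ‖z.1‖))) +
            ENNReal.ofReal (rexp (-1 * (‖z.2‖ - ‖z.1‖)))) ∂(P.prod P) := by
          apply lintegral_mono
          intro z
          simp only
          rw [← ENNReal.ofReal_add (by positivity) (by positivity)]
          apply ENNReal.ofReal_le_ofReal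
          set d := ‖z.2‖ - ‖z.1‖
          have h := sq_le_exp_add_exp_neg d
          rwa [one_mul, neg_one_mul]
      _ ≤ ENNReal.ofReal (rexp (π ^ 2 * 1 ^ 2 / 8)) + ENNReal.ofReal (rexp (π ^ 2 * (-1) ^ 2 / 8)) := by
          rw [lintegral_add_left (by fun_prop)]
          exact add_le_add (hb 1) (hb (-1))
      _ ≤ ENNReal.ofReal 8 := by
          rw [← ENNReal.ofReal_add (by positivity) (by positivity)]
          apply ENNReal.ofReal_le_ofReal
          have hpi2 : π ^ 2 < 10 := by nlinarith [Real.pi_lt_d4, Real.pi_gt_d4]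
          have h1 : rexp (π ^ 2 * 1 ^ 2 / 8) ≤ 4 := by
            have h2 : rexp (5 / 4) ^ 4 ≤ 4 ^ 4 := by
              rw [← Real.exp_nat_mul]
              norm_num
              calc rexp 5 = rexp 1 ^ 5 := by rw [← Real.exp_nat_mul]; norm_num
                _ ≤ 2.7182818286 ^ 5 := by gcongr; exact Real.exp_one_lt_d9.le
                _ ≤ 256 := by norm_num
            have h3 : rexp (5 / 4) ≤ 4 := le_of_pow_le_pow_left₀ (by norm_num) (by norm_num) h2
            refine (Real.exp_le_exp.2 ?_).trans h3
            linarith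
          have h4 : rexp (π ^ 2 * (-1) ^ 2 / 8) ≤ 4 := by simpa using h1
          linarith
  have hi1 := integrable_norm_sq_stdGaussian (E := E)
  have hi2 := integrable_norm_stdGaussian (E := E)
  have hprod : Integrable (fun z : E × E => ‖z.1‖ * ‖z.2‖) (P.prod P) := hi2.mul_prod hi2
  have e0 : ∀ z : E × E, (‖z.2‖ - ‖z.1‖) ^ 2 = ‖z.2‖ ^ 2 + ‖z.1‖ ^ 2 - 2 * (‖z.1‖ * ‖z.2‖) :=
    fun z => by ring
  have hs1 : Integrable (fun z : E × E => ‖z.1‖ ^ 2) (P.prod P) := hi1.comp_fst P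
  have hs2 : Integrable (fun z : E × E => ‖z.2‖ ^ 2) (P.prod P) := hi1.comp_snd P
  have hint : Integrable (fun z : E × E => (‖z.2‖ - ‖z.1‖) ^ 2) (P.prod P) := by
    simp_rw [e0]
    exact (hs2.add hs1).sub (hprod.const_mul 2)
  have e1 : ∫ z, (‖z.2‖ - ‖z.1‖) ^ 2 ∂(P.prod P) =
      Module.finrank ℝ E + Module.finrank ℝ E - 2 * (∫ x, ‖x‖ ∂P) ^ 2 := by
    simp_rw [e0]
    rw [integral_sub (by exact hs2.add hs1) (hprod.const_mul 2), integral_add hs2 hs1, integral_const_mul,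
      integral_prod_mul (fun x : E => ‖x‖) (fun x : E => ‖x‖), integral_fun_fst (fun x : E => ‖x‖ ^ 2),
      integral_fun_snd (fun x : E => ‖x‖ ^ 2), integral_norm_sq_stdGaussian]
    simp; ring
  rw [← ofReal_integral_eq_lintegral_ofReal hint (by filter_upwards with z; positivity),
    ENNReal.ofReal_le_ofReal_iff (by norm_num), e1] at hle
  linarith

lemma stdGaussian_norm_center (hE : 0 < Module.finrank ℝ E) :
    1 / 2 ≤ (stdGaussian E).real {x | |‖x‖ - √(Module.finrank ℝ E)| ≤ 4} := by
  set P := stdGaussian E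
  set d : ℝ := (Module.finrank ℝ E : ℝ) with hd
  have hd1 : 0 < d := by rw [hd]; exact_mod_cast hE
  have hi1 := integrable_norm_sq_stdGaussian (E := E)
  have hi2 := integrable_norm_stdGaussian (E := E)
  have hm := sq_integral_norm_stdGaussian (E := E)
  set m := ∫ x, ‖x‖ ∂P with hmdef
  have hm0 : 0 ≤ m := integral_nonneg fun x => norm_nonneg x
  have hsd : √d ^ 2 = d := Real.sq_sqrt hd1.le
  have hsd0 : 0 < √d := Real.sqrt_pos.2 hd1
  have e0 : ∀ x : E, (‖x‖ - √d) ^ 2 = ‖x‖ ^ 2 - 2 * √d * ‖x‖ + √d ^ 2 := fun x => by ring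
  have hint : Integrable (fun x : E => (‖x‖ - √d) ^ 2) P := by
    simp_rw [e0]
    exact (hi1.sub (hi2.const_mul _)).add (integrable_const _)
  have e1 : ∫ x, (‖x‖ - √d) ^ 2 ∂P = 2 * d - 2 * √d * m := by
    simp_rw [e0]
    rw [integral_add (by exact hi1.sub (hi2.const_mul _)) (integrable_const _),
      integral_sub hi1 (hi2.const_mul _), integral_const_mul, integral_norm_sq_stdGaussian]
    simp [hsd]; ring
  have h8 : ∫ x, (‖x‖ - √d) ^ 2 ∂P ≤ 8 := by
    rw [e1]
    by_contra! h
    have h1 : √d * m < √d ^ 2 - 4 := by rw [hsd]; linarith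
    have h2 : d - 4 ≤ m ^ 2 := hm
    have h3 : 0 ≤ √d * m := by positivity
    have h4 : (√d * m) ^ 2 < (√d ^ 2 - 4) ^ 2 := by
      apply pow_lt_pow_left₀ h1 h3 (by norm_num)
    rw [mul_pow, hsd] at h4
    have h5 : 4 < d := by rw [hsd] at h1; linarith
    nlinarith
  have hmk := mul_meas_ge_le_integral_of_nonneg (μ := P) (f := fun x => (‖x‖ - √d) ^ 2)
    (by filter_upwards with x; positivity) hint 16
  have h2 : P.real {x | 16 ≤ (‖x‖ - √d) ^ 2} ≤ 1 / 2 := by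
    have : 16 * P.real {x | 16 ≤ (‖x‖ - √d) ^ 2} ≤ 8 := hmk.trans h8
    linarith
  have hms : MeasurableSet {x : E | |‖x‖ - √d| ≤ 4} :=
    measurableSet_le (by fun_prop) (by fun_prop)
  have hc := probReal_compl_eq_one_sub (μ := P) hms
  have hsub : P.real {x : E | |‖x‖ - √d| ≤ 4}ᶜ ≤ P.real {x | 16 ≤ (‖x‖ - √d) ^ 2} := by
    refine measureReal_mono ?_ (measure_ne_top _ _)
    intro x hx
    simp only [Set.mem_compl_iff, Set.mem_ofPred_eq, not_le] at hx ⊢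
    rw [← sq_abs]; nlinarith
  linarith

lemma stdGaussian_norm_tail (hE : 0 < Module.finrank ℝ E) {s : ℝ} (hs : 0 ≤ s) :
    (stdGaussian E).real {x | 4 + s ≤ |‖x‖ - √(Module.finrank ℝ E)|} ≤ 2 * rexp (-s ^ 2 / 5) := by
  set r := √(Module.finrank ℝ E : ℝ)
  have h := stdGaussian_mul_le (E := E) (A := {x | |‖x‖ - r| ≤ 4}) (B := {x | 4 + s ≤ |‖x‖ - r|})
    (measurableSet_le (by fun_prop) (by fun_prop)) (measurableSet_le (by fun_prop) (by fun_prop)) hs ?_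
  · have h1 := stdGaussian_norm_center hE
    have h2 : 0 ≤ (stdGaussian E).real {x | 4 + s ≤ |‖x‖ - r|} := measureReal_nonneg
    nlinarith
  · intro x hx y hy
    simp only [Set.mem_ofPred_eq] at hx hy
    have h1 : |‖y‖ - r| ≤ |‖x‖ - r| + |‖y‖ - ‖x‖| := by
      have := abs_add_le (‖x‖ - r) (‖y‖ - ‖x‖);
      have e : ‖x‖ - r + (‖y‖ - ‖x‖) = ‖y‖ - r := by ring
      rwa [e] at this
    have h2 := abs_norm_sub_norm_le y x
    rw [dist_comm, dist_eq_norm]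
    linarith

end Concentration

section ScaledGaussian

open ProbabilityTheory

/-- The Gaussian measure on `ℝⁿ` with covariance `n⁻¹ I`. -/
noncomputable def sGauss (n : ℕ) : Measure (EuclideanSpace ℝ (Fin n)) :=
  (stdGaussian (EuclideanSpace ℝ (Fin n))).map (fun x => (√n : ℝ)⁻¹ • x)

variable {n : ℕ}

lemma measurable_const_smul_eucl (c : ℝ) :
    Measurable (fun x : EuclideanSpace ℝ (Fin n) => c • x) := measurable_const_smul c

instance : IsProbabilityMeasure (sGauss n) :=
  Measure.isProbabilityMeasure_map (measurable_const_smul_eucl _).aemeasurable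

lemma sGauss_mul_le (hn : 0 < n) {A B : Set (EuclideanSpace ℝ (Fin n))} (hA : MeasurableSet A)
    (hB : MeasurableSet B) {s : ℝ} (hs : 0 ≤ s) (hAB : ∀ x ∈ A, ∀ y ∈ B, s ≤ dist x y) :
    (sGauss n).real A * (sGauss n).real B ≤ rexp (-(n * s ^ 2) / 5) := by
  have hm := measurable_const_smul_eucl (n := n) (√n : ℝ)⁻¹
  have hnn : (0 : ℝ) < √n := by positivity
  rw [measureReal_def, measureReal_def, sGauss, Measure.map_apply hm hA, Measure.map_apply hm hB]
  refine (stdGaussian_mul_le (hm hA) (hm hB) (s := √n * s) (by positivity) ?_).trans (le_of_eq ?_)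
  · intro x hx y hy
    have := hAB _ hx _ hy
    rw [dist_smul₀, norm_inv, Real.norm_of_nonneg hnn.le, inv_mul_eq_div, le_div_iff₀ hnn] at this
    linarith
  · rw [mul_pow, Real.sq_sqrt (by positivity)]

lemma sGauss_norm_tail (hn : 0 < n) {κ : ℝ} (hκ : 8 ≤ κ * √n) :
    (sGauss n).real {x | κ ≤ |‖x‖ - 1|} ≤ 2 * rexp (-(n * κ ^ 2) / 20) := by
  have hm := measurable_const_smul_eucl (n := n) (√n : ℝ)⁻¹
  have hnn : (0 : ℝ) < √n := by positivity
  have hsq : √(n : ℝ) ^ 2 = n := Real.sq_sqrt (by positivity)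
  have hset : MeasurableSet {x : EuclideanSpace ℝ (Fin n) | κ ≤ |‖x‖ - 1|} :=
    measurableSet_le measurable_const (by fun_prop)
  rw [measureReal_def, sGauss, Measure.map_apply hm hset, ← measureReal_def]
  have h1 := stdGaussian_norm_tail (E := EuclideanSpace ℝ (Fin n)) (by simpa using hn)
    (s := κ * √n / 2) (by linarith)
  refine (measureReal_mono ?_ (measure_ne_top _ _)).trans (h1.trans ?_)
  · intro x hx
    simp only [Set.mem_preimage, Set.mem_ofPred_eq, finrank_euclideanSpace, Fintype.card_fin,
      norm_smul, norm_inv, Real.norm_of_nonneg hnn.le] at hx ⊢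
    have e : ‖x‖ - √n = √n * ((√n)⁻¹ * ‖x‖ - 1) := by field_simp
    rw [e, abs_mul, abs_of_pos hnn]
    nlinarith
  · have e : -(κ * √n / 2) ^ 2 / 5 = -(n * κ ^ 2) / 20 := by
      rw [div_pow, mul_pow, hsq]; ring
    rw [e]

lemma map_inner_sGauss (x : EuclideanSpace ℝ (Fin n)) :
    (sGauss n).map (fun y => ⟪x, y⟫) = gaussianReal 0 (‖x‖ ^ 2 / n).toNNReal := by
  have hm := measurable_const_smul_eucl (n := n) (√n : ℝ)⁻¹
  rw [sGauss, Measure.map_map (by fun_prop) hm]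
  have : (fun y => ⟪x, y⟫) ∘ (fun y : EuclideanSpace ℝ (Fin n) => (√n : ℝ)⁻¹ • y) =
      (innerSL ℝ ((√n : ℝ)⁻¹ • x) : StrongDual ℝ (EuclideanSpace ℝ (Fin n))) := by
    funext y
    simp [real_inner_smul_right]
  rw [this, map_dual_stdGaussian, innerSL_apply_norm, norm_smul, mul_pow]
  congr 2
  rw [norm_inv, Real.norm_of_nonneg (by positivity), inv_pow, Real.sq_sqrt (by positivity)]
  ring

lemma map_inner_pair_sGauss {x z : EuclideanSpace ℝ (Fin n)} (h : ⟪x, z⟫ = 0) :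
    (sGauss n).map (fun y => (⟪x, y⟫, ⟪z, y⟫)) =
      (gaussianReal 0 (‖x‖ ^ 2 / n).toNNReal).prod (gaussianReal 0 (‖z‖ ^ 2 / n).toNNReal) := by
  have hm := measurable_const_smul_eucl (n := n) (√n : ℝ)⁻¹
  have hg : HasGaussianLaw (fun y : EuclideanSpace ℝ (Fin n) =>
      (⟪(√n : ℝ)⁻¹ • x, y⟫, ⟪(√n : ℝ)⁻¹ • z, y⟫)) (stdGaussian _) :=
    (IsGaussian.hasGaussianLaw_id (μ := stdGaussian (EuclideanSpace ℝ (Fin n)))).map_fun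
      ((innerSL ℝ ((√n : ℝ)⁻¹ • x)).prod (innerSL ℝ ((√n : ℝ)⁻¹ • z)))
  have hc : cov[fun y : EuclideanSpace ℝ (Fin n) => ⟪(√n : ℝ)⁻¹ • x, y⟫,
      fun y => ⟪(√n : ℝ)⁻¹ • z, y⟫; stdGaussian _] = 0 := by
    rw [← covarianceBilin_apply_eq_cov IsGaussian.memLp_two_id, covarianceBilin_stdGaussian]
    have h' : innerSL ℝ x z = 0 := h
    simp [h']
  have hi := hg.indepFun_of_covariance_eq_zero hc
  have hX : ∀ w : EuclideanSpace ℝ (Fin n), (fun y => ⟪(√n : ℝ)⁻¹ • w, y⟫) =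
      (fun y => ⟪w, y⟫) ∘ (fun y : EuclideanSpace ℝ (Fin n) => (√n : ℝ)⁻¹ • y) := by
    intro w; funext y; simp [real_inner_smul_left, real_inner_smul_right]
  rw [← map_inner_sGauss, ← map_inner_sGauss, sGauss, Measure.map_map (by fun_prop) hm,
    Measure.map_map (by fun_prop) hm, Measure.map_map (by fun_prop) hm, ← hX, ← hX,
    ← (indepFun_iff_map_prod_eq_prod_map_map (by fun_prop) (by fun_prop)).1 hi]
  congr 1
  funext y; simp [real_inner_smul_left, real_inner_smul_right]

end ScaledGaussian

section Sphere

variable {n : ℕ}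

lemma charFun_eq_of_rotInv {σ : Measure (EuclideanSpace ℝ (Fin n))}
    (hσ : ∀ O : EuclideanSpace ℝ (Fin n) ≃ₗᵢ[ℝ] EuclideanSpace ℝ (Fin n), Measure.map O σ = σ)
    {s t : EuclideanSpace ℝ (Fin n)} (hst : ‖s‖ = ‖t‖) : charFun σ s = charFun σ t := by
  obtain ⟨O, hO⟩ : ∃ O : EuclideanSpace ℝ (Fin n) ≃ₗᵢ[ℝ] EuclideanSpace ℝ (Fin n), O s = t :=
    ⟨_, Submodule.reflection_sub hst⟩
  conv_rhs => rw [← hσ O]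
  rw [charFun_apply, charFun_apply, integral_map O.continuous.aemeasurable
    (Measurable.aestronglyMeasurable (by fun_prop))]
  congr 1
  funext x
  rw [← hO, O.inner_map_map]

lemma charFun_eq_integral_charFun {σ ρ : Measure (EuclideanSpace ℝ (Fin n))}
    [IsProbabilityMeasure ρ]
    (hσ : ∀ O : EuclideanSpace ℝ (Fin n) ≃ₗᵢ[ℝ] EuclideanSpace ℝ (Fin n), Measure.map O σ = σ)
    (hρ : ∀ᵐ x ∂ρ, ‖x‖ = 1) (t : EuclideanSpace ℝ (Fin n)) :
    charFun σ t = ∫ u, charFun σ (‖t‖ • u) ∂ρ := by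
  have : (fun u => charFun σ (‖t‖ • u)) =ᵐ[ρ] fun _ => charFun σ t := by
    filter_upwards [hρ] with u hu
    apply charFun_eq_of_rotInv hσ
    rw [norm_smul, hu]; simp
  rw [integral_congr_ae this]; simp

lemma eq_of_rotInv {σ ρ : Measure (EuclideanSpace ℝ (Fin n))}
    [IsProbabilityMeasure σ] [IsProbabilityMeasure ρ]
    (hσ : ∀ O : EuclideanSpace ℝ (Fin n) ≃ₗᵢ[ℝ] EuclideanSpace ℝ (Fin n), Measure.map O σ = σ)
    (hρ : ∀ O : EuclideanSpace ℝ (Fin n) ≃ₗᵢ[ℝ] EuclideanSpace ℝ (Fin n), Measure.map O ρ = ρ)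
    (hσ1 : ∀ᵐ x ∂σ, ‖x‖ = 1) (hρ1 : ∀ᵐ x ∂ρ, ‖x‖ = 1) : σ = ρ := by
  apply Measure.ext_of_charFun
  funext t
  rw [charFun_eq_integral_charFun hσ hρ1, charFun_eq_integral_charFun hρ hσ1]
  simp_rw [charFun_apply]
  rw [integral_integral_swap]
  · congr 1; funext x; congr 1; funext y
    rw [real_inner_smul_right, real_inner_smul_right, real_inner_comm]
  · apply Integrable.of_bound (C := 1)
    · exact Measurable.aestronglyMeasurable (by unfold Function.uncurry; fun_prop)
    · refine Filter.Eventually.of_forall fun z => ?_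
      simp only [Function.uncurry]
      rw [Complex.norm_exp_ofReal_mul_I]

lemma sGauss_zero (hn : 0 < n) : (sGauss n) {0} = 0 := by
  have h := map_inner_sGauss (n := n) (EuclideanSpace.single ⟨0, hn⟩ 1)
  have h1 : (sGauss n) ((fun y => ⟪EuclideanSpace.single (⟨0, hn⟩ : Fin n) (1 : ℝ), y⟫) ⁻¹' {0})
      = 0 := by
    rw [← Measure.map_apply (by fun_prop) (measurableSet_singleton _), h]
    have : ((‖EuclideanSpace.single (⟨0, hn⟩ : Fin n) (1 : ℝ)‖ ^ 2 / n : ℝ)).toNNReal ≠ 0 := by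
      simp [hn.ne']
    have := ProbabilityTheory.nullSingletonClass_gaussianReal (μ := 0) this
    exact measure_singleton _
  refine measure_mono_null ?_ h1
  intro x hx
  simp at hx
  simp [hx]

lemma map_isometry_sGauss (O : EuclideanSpace ℝ (Fin n) ≃ₗᵢ[ℝ] EuclideanSpace ℝ (Fin n)) :
    (sGauss n).map O = sGauss n := by
  have hm := measurable_const_smul_eucl (n := n) (√n : ℝ)⁻¹
  conv_rhs => rw [sGauss, ← ProbabilityTheory.stdGaussian_map O]
  rw [sGauss, Measure.map_map O.continuous.measurable hm, Measure.map_map hm O.continuous.measurable]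
  congr 1
  funext x; simp

lemma measurable_normalize :
    Measurable (fun x : EuclideanSpace ℝ (Fin n) => ‖x‖⁻¹ • x) := by fun_prop

lemma uniformSphere_eq_map_sGauss (hn : 0 < n) {σ : Measure (EuclideanSpace ℝ (Fin n))}
    (hσ : IsUniformSphereMeasure σ) : σ = (sGauss n).map (fun x => ‖x‖⁻¹ • x) := by
  have hm := measurable_normalize (n := n)
  have := hσ.prob
  have : IsProbabilityMeasure ((sGauss n).map (fun x => ‖x‖⁻¹ • x)) :=
    Measure.isProbabilityMeasure_map hm.aemeasurable
  apply eq_of_rotInv hσ.rotInv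
  · intro O
    conv_rhs => rw [← map_isometry_sGauss O]
    rw [Measure.map_map O.continuous.measurable hm, Measure.map_map hm O.continuous.measurable]
    congr 1
    funext x; simp
  · have h := hσ.sphere
    rw [← prob_compl_eq_zero_iff (Metric.isClosed_sphere.measurableSet)] at h
    rw [ae_iff]
    convert h using 2
    ext x; simp
  · rw [ae_map_iff hm.aemeasurable (measurableSet_eq_fun (by fun_prop) (by fun_prop))]
    have h0 : ∀ᵐ x ∂(sGauss n), x ≠ 0 := by
      rw [ae_iff]; simpa using sGauss_zero hn
    filter_upwards [h0] with x hx
    rw [norm_smul, norm_inv, norm_norm, inv_mul_cancel₀ (norm_ne_zero_iff.2 hx)]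

end Sphere

section MarginalTail

open ProbabilityTheory

variable {n : ℕ}

/-- The marginal tail `μ{x : t ≤ ⟨x, Z⟩}` in the direction of an arbitrary vector `Z`. -/
noncomputable def marginalTail (μ : Measure (EuclideanSpace ℝ (Fin n)))
    (Z : EuclideanSpace ℝ (Fin n)) (t : ℝ) : ℝ := μ.real {x | t ≤ ⟪x, Z⟫}

variable {μ : Measure (EuclideanSpace ℝ (Fin n))}

lemma marginalTail_nonneg (Z : EuclideanSpace ℝ (Fin n)) (t : ℝ) : 0 ≤ marginalTail μ Z t :=
  measureReal_nonneg

lemma marginalTail_anti [IsFiniteMeasure μ] (Z : EuclideanSpace ℝ (Fin n)) {s t : ℝ}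
    (h : s ≤ t) : marginalTail μ Z t ≤ marginalTail μ Z s :=
  measureReal_mono (fun _ hx => h.trans hx) (measure_ne_top _ _)

lemma one_sub_marginalCDF [IsProbabilityMeasure μ] (Z : EuclideanSpace ℝ (Fin n)) (t : ℝ) :
    1 - marginalCDF μ Z t = marginalTail μ Z t := by
  have h : MeasurableSet {x : EuclideanSpace ℝ (Fin n) | ⟪x, Z⟫ < t} :=
    measurableSet_lt (by fun_prop) measurable_const
  rw [marginalCDF, ← measureReal_def, ← probReal_compl_eq_one_sub h, marginalTail]
  congr 1; ext x; simp

lemma marginalTail_le_one [IsProbabilityMeasure μ] (Z : EuclideanSpace ℝ (Fin n)) (t : ℝ) :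
    marginalTail μ Z t ≤ 1 := measureReal_le_one

lemma marginalTail_smul {c : ℝ} (hc : 0 < c) (Z : EuclideanSpace ℝ (Fin n)) (t : ℝ) :
    marginalTail μ (c⁻¹ • Z) t = marginalTail μ Z (t * c) := by
  unfold marginalTail
  congr 1; ext x
  simp only [Set.mem_ofPred_eq, real_inner_smul_right, inv_mul_eq_div]
  rw [le_div_iff₀ hc]

lemma measurable_marginalTail [IsFiniteMeasure μ] (t : ℝ) :
    Measurable (fun Z => marginalTail μ Z t) := by
  have hs : MeasurableSet {p : EuclideanSpace ℝ (Fin n) × EuclideanSpace ℝ (Fin n) |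
      t ≤ ⟪p.2, p.1⟫} := measurableSet_le measurable_const (by fun_prop)
  exact (measurable_measure_prodMk_left hs).ennreal_toReal

lemma integrable_marginalTail [IsFiniteMeasure μ] {ρ : Measure (EuclideanSpace ℝ (Fin n))}
    [IsFiniteMeasure ρ] (t : ℝ) : Integrable (fun Z => marginalTail μ Z t) ρ := by
  apply Integrable.of_bound (C := μ.real Set.univ) (measurable_marginalTail t).aestronglyMeasurable
  refine Filter.Eventually.of_forall fun Z => ?_
  rw [Real.norm_of_nonneg (marginalTail_nonneg _ _)]
  exact measureReal_mono (Set.subset_univ _) (measure_ne_top _ _)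

lemma measureReal_neg (hμ : Measure.IsEven μ) {A : Set (EuclideanSpace ℝ (Fin n))}
    (hA : MeasurableSet A) : μ.real {x | -x ∈ A} = μ.real A := by
  conv_rhs => rw [← hμ]
  rw [measureReal_def, measureReal_def, Measure.map_apply measurable_neg hA]
  rfl

lemma marginalTail_zero_le [IsProbabilityMeasure μ] (hμ : Measure.IsEven μ)
    (Z : EuclideanSpace ℝ (Fin n)) {t : ℝ} (ht : 0 < t) :
    marginalTail μ Z 0 ≤ 1 - marginalTail μ Z t := by
  have hm : MeasurableSet {x : EuclideanSpace ℝ (Fin n) | 0 ≤ ⟪x, Z⟫} :=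
    measurableSet_le measurable_const (by fun_prop)
  have hm2 : MeasurableSet {x : EuclideanSpace ℝ (Fin n) | t ≤ ⟪x, Z⟫} :=
    measurableSet_le measurable_const (by fun_prop)
  unfold marginalTail
  rw [← measureReal_neg hμ hm, ← probReal_compl_eq_one_sub hm2]
  apply measureReal_mono _ (measure_ne_top _ _)
  intro x hx
  simp only [Set.mem_ofPred_eq, inner_neg_left, Set.mem_compl_iff, not_le] at hx ⊢
  linarith

lemma marginalTail_restrict_le (hμ : Measure.IsEven μ) [IsFiniteMeasure μ]
    (Z : EuclideanSpace ℝ (Fin n)) {t : ℝ} (ht : 0 < t) :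
    marginalTail μ Z t ≤ μ.real Set.univ / 2 := by
  have hm2 : MeasurableSet {x : EuclideanSpace ℝ (Fin n) | t ≤ ⟪x, Z⟫} :=
    measurableSet_le measurable_const (by fun_prop)
  have h1 : μ.real {x | -x ∈ {x : EuclideanSpace ℝ (Fin n) | t ≤ ⟪x, Z⟫}} =
      marginalTail μ Z t := measureReal_neg hμ hm2
  have h2 : Disjoint {x : EuclideanSpace ℝ (Fin n) | t ≤ ⟪x, Z⟫}
      {x | -x ∈ {x : EuclideanSpace ℝ (Fin n) | t ≤ ⟪x, Z⟫}} := by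
    rw [Set.disjoint_left]
    intro x hx hx'
    simp only [Set.mem_ofPred_eq, inner_neg_left] at hx hx'
    linarith
  have h3 := measureReal_union (μ := μ) h2 (measurable_neg hm2)
  have h4 := measureReal_mono (μ := μ) (Set.subset_univ ({x : EuclideanSpace ℝ (Fin n) | t ≤ ⟪x, Z⟫} ∪
      {x | -x ∈ {x : EuclideanSpace ℝ (Fin n) | t ≤ ⟪x, Z⟫}})) (measure_ne_top _ _)
  rw [h3, h1] at h4
  unfold marginalTail at *
  linarith

lemma psiOne_tail_le [IsProbabilityMeasure μ] {C₀ c₀ : ℝ} (hC : 0 < C₀) (hc : 0 < c₀)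
    (hμ : HasPsiOneMarginals μ C₀ c₀) {δ s : ℝ} (hδ : 0 < δ) (hs : 0 ≤ s)
    {θ : EuclideanSpace ℝ (Fin n)} (hθ : ‖θ‖ ≤ δ) :
    μ.real {x | s < ⟪x, θ⟫} ≤ C₀ * rexp (-(c₀ * (s / δ))) := by
  rcases eq_or_ne θ 0 with rfl | h0
  · have : {x : EuclideanSpace ℝ (Fin n) | s < ⟪x, (0 : EuclideanSpace ℝ (Fin n))⟫} = ∅ := by
      ext x; simp [hs]
    rw [this]; simp; positivity
  have hp : 0 < ‖θ‖ := norm_pos_iff.2 h0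
  have h1 := hμ (‖θ‖⁻¹ • θ) (by rw [norm_smul]; simp [hp.ne']) (s / ‖θ‖) (by positivity)
  have h2 : {x : EuclideanSpace ℝ (Fin n) | s < ⟪x, θ⟫} = {x | s / ‖θ‖ < ⟪x, ‖θ‖⁻¹ • θ⟫} := by
    ext x
    simp only [Set.mem_ofPred_eq, real_inner_smul_right, inv_mul_eq_div]
    rw [div_lt_div_iff_of_pos_right hp]
  rw [h2, measureReal_def]
  refine h1.trans ?_
  gcongr
  rw [neg_mul, neg_le_neg_iff]
  gcongr

/-- A small perturbation of the direction costs little after a shift of the level. -/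
lemma marginalTail_add_le [IsProbabilityMeasure μ] {C₀ c₀ : ℝ} (hC : 0 < C₀) (hc : 0 < c₀)
    (hμ : HasPsiOneMarginals μ C₀ c₀) {δ s : ℝ} (hδ : 0 < δ) (hs : 0 < s)
    {Y Z : EuclideanSpace ℝ (Fin n)} (hYZ : dist Z Y ≤ δ) (t : ℝ) :
    marginalTail μ Z (t + s) ≤ marginalTail μ Y t + C₀ * rexp (-(c₀ * (s / δ))) := by
  have h := psiOne_tail_le hC hc hμ hδ hs.le (θ := Z - Y) (by rwa [← dist_eq_norm])
  have h2 : marginalTail μ Z (t + s) ≤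
      μ.real ({x | t ≤ ⟪x, Y⟫} ∪ {x | s < ⟪x, Z - Y⟫}) := by
    apply measureReal_mono _ (measure_ne_top _ _)
    intro x hx
    simp only [Set.mem_ofPred_eq, Set.mem_union, inner_sub_right] at hx ⊢
    by_contra! hcon
    linarith
  exact h2.trans ((measureReal_union_le _ _).trans (by unfold marginalTail; linarith))

/-- The tail of a centred Gaussian of standard deviation `r`. -/
noncomputable def scaledTail (r t : ℝ) : ℝ := if r = 0 then 0 else gaussTail (t / r)

lemma scaledTail_nonneg (r t : ℝ) : 0 ≤ scaledTail r t := by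
  unfold scaledTail; split_ifs
  · exact le_rfl
  · exact (gaussTail_pos _).le

lemma sGauss_real_le_inner (x : EuclideanSpace ℝ (Fin n)) {t : ℝ} (ht : 0 < t) (hn : 0 < n) :
    (sGauss n).real {Z | t ≤ ⟪x, Z⟫} = scaledTail (‖x‖ / √n) t := by
  have hnn : (0 : ℝ) < √n := by positivity
  unfold scaledTail
  split_ifs with h
  · have hx : x = 0 := by
      rw [div_eq_zero_iff] at h
      rcases h with h | h
      · exact norm_eq_zero.1 h
      · exact absurd h hnn.ne'
    subst hx
    have : {Z : EuclideanSpace ℝ (Fin n) | t ≤ ⟪(0 : EuclideanSpace ℝ (Fin n)), Z⟫} = ∅ := by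
      ext; simp [ht]
    rw [this]; simp
  · have hr : 0 < ‖x‖ / √n := lt_of_le_of_ne (by positivity) (Ne.symm h)
    set r := ‖x‖ / √n with hrdef
    have h1 := map_inner_sGauss (n := n) x
    have hv : ‖x‖ ^ 2 / n = r ^ 2 := by
      rw [hrdef, div_pow, Real.sq_sqrt (by positivity)]
    rw [hv] at h1
    have h2 : (sGauss n).real {Z | t ≤ ⟪x, Z⟫} = ((sGauss n).map (fun y => ⟪x, y⟫)).real (Set.Ici t) := by
      rw [measureReal_def, measureReal_def, Measure.map_apply (by fun_prop) measurableSet_Ici]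
      rfl
    rw [h2, h1]
    have h3 : gaussianReal 0 (r ^ 2).toNNReal = (gaussianReal 0 1).map (r * ·) := by
      rw [gaussianReal_map_const_mul]; simp
      congr 1
      ext; simp [sq_nonneg]
    rw [h3, measureReal_def, Measure.map_apply (by fun_prop) measurableSet_Ici,
      gaussTail_eq_measure, measureReal_def]
    congr 1
    have := nullSingletonClass_gaussianReal (μ := 0) (v := 1) one_ne_zero
    have e : (r * ·) ⁻¹' Set.Ici t = Set.Ici (t / r) := by
      ext y; simp [div_le_iff₀ hr, mul_comm]
    rw [e]
    exact (measure_congr Ioi_ae_eq_Ici).symm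

lemma integral_marginalTail_swap [IsFiniteMeasure μ] {ρ : Measure (EuclideanSpace ℝ (Fin n))}
    [IsFiniteMeasure ρ] (t : ℝ) :
    ∫ Z, marginalTail μ Z t ∂ρ = ∫ x, ρ.real {Z | t ≤ ⟪x, Z⟫} ∂μ := by
  have hs : MeasurableSet {p : EuclideanSpace ℝ (Fin n) × EuclideanSpace ℝ (Fin n) |
      t ≤ ⟪p.2, p.1⟫} := measurableSet_le measurable_const (by fun_prop)
  have h1 : ∀ Z, marginalTail μ Z t =
      ∫ x, Set.indicator {p : EuclideanSpace ℝ (Fin n) × EuclideanSpace ℝ (Fin n) |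
        t ≤ ⟪p.2, p.1⟫} (fun _ => (1 : ℝ)) (Z, x) ∂μ := by
    intro Z
    have hz : MeasurableSet {x : EuclideanSpace ℝ (Fin n) | t ≤ ⟪x, Z⟫} :=
      measurableSet_le measurable_const (by fun_prop)
    rw [marginalTail, ← integral_indicator_one hz]; rfl
  have h2 : ∀ x, ρ.real {Z | t ≤ ⟪x, Z⟫} =
      ∫ Z, Set.indicator {p : EuclideanSpace ℝ (Fin n) × EuclideanSpace ℝ (Fin n) |
        t ≤ ⟪p.2, p.1⟫} (fun _ => (1 : ℝ)) (Z, x) ∂ρ := by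
    intro x
    have hz : MeasurableSet {Z : EuclideanSpace ℝ (Fin n) | t ≤ ⟪x, Z⟫} :=
      measurableSet_le measurable_const (by fun_prop)
    rw [← integral_indicator_one hz]; rfl
  simp_rw [h1, h2]
  rw [integral_integral_swap]
  exact (integrable_const (1 : ℝ)).indicator hs

lemma integral_marginalTail_sGauss [IsFiniteMeasure μ] (hn : 0 < n) {t : ℝ} (ht : 0 < t) :
    ∫ Z, marginalTail μ Z t ∂(sGauss n) = ∫ x, scaledTail (‖x‖ / √n) t ∂μ := by
  rw [integral_marginalTail_swap]
  congr 1; funext x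
  exact sGauss_real_le_inner x ht hn

end MarginalTail

section CrudeRegime

variable {n : ℕ} {μ : Measure (EuclideanSpace ℝ (Fin n))}

lemma sGauss_real_le_of_dist (hn : 0 < n) {A B : Set (EuclideanSpace ℝ (Fin n))}
    (hA : MeasurableSet A) (hB : MeasurableSet B) {δ q : ℝ} (hδ : 0 ≤ δ)
    (hAB : ∀ x ∈ A, ∀ y ∈ B, δ ≤ dist x y) (hq : 0 < q) (hqA : q ≤ (sGauss n).real A) :
    (sGauss n).real B ≤ q⁻¹ * rexp (-(n * δ ^ 2) / 5) := by
  have h := sGauss_mul_le hn hA hB hδ hAB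
  rw [inv_mul_eq_div, le_div_iff₀ hq]
  have h2 : (sGauss n).real B * q ≤ (sGauss n).real B * (sGauss n).real A := by gcongr
  linarith

lemma measurableSet_marginalTail_le [IsFiniteMeasure μ] (t c : ℝ) :
    MeasurableSet {Z | marginalTail μ Z t ≤ c} :=
  measurableSet_le (measurable_marginalTail t) measurable_const

lemma measurableSet_lt_marginalTail [IsFiniteMeasure μ] (t c : ℝ) :
    MeasurableSet {Z | c < marginalTail μ Z t} :=
  measurableSet_lt measurable_const (measurable_marginalTail t)

lemma measurableSet_marginalTail_lt [IsFiniteMeasure μ] (t c : ℝ) :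
    MeasurableSet {Z | marginalTail μ Z t < c} :=
  measurableSet_lt (measurable_marginalTail t) measurable_const

/-- Markov's inequality for the marginal tail, complementary form. -/
lemma markov_marginalTail [IsFiniteMeasure μ] (t : ℝ) {k : ℝ} (hk : 0 < k)
    (ha : 0 < ∫ Z, marginalTail μ Z t ∂(sGauss n)) :
    1 - 1 / k ≤ (sGauss n).real {Z | marginalTail μ Z t ≤ k * ∫ Z, marginalTail μ Z t ∂(sGauss n)} := by
  set a := ∫ Z, marginalTail μ Z t ∂(sGauss n) with ha_def
  have h1 := mul_meas_ge_le_integral_of_nonneg (μ := sGauss n)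
    (Filter.Eventually.of_forall fun Z => marginalTail_nonneg (μ := μ) Z t)
    (integrable_marginalTail t) (k * a)
  have h2 : (sGauss n).real {Z | marginalTail μ Z t ≤ k * a}ᶜ ≤
      (sGauss n).real {Z | k * a ≤ marginalTail μ Z t} := by
    apply measureReal_mono _ (measure_ne_top _ _)
    intro Z hZ
    simp only [Set.mem_compl_iff, Set.mem_ofPred_eq, not_le] at hZ ⊢
    exact hZ.le
  rw [probReal_compl_eq_one_sub (measurableSet_marginalTail_le _ _)] at h2
  have h3 : (sGauss n).real {Z | k * a ≤ marginalTail μ Z t} ≤ 1 / k := by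
    rw [le_div_iff₀ hk]
    have : (sGauss n).real {Z | k * a ≤ marginalTail μ Z t} * k * a ≤ 1 * a := by
      rw [← ha_def] at h1; linarith
    exact le_of_mul_le_mul_right this ha
  linarith

lemma crude_upper [IsProbabilityMeasure μ] (hn : 0 < n) {ε δ b s s' : ℝ} (hε : 0 < ε)
    (hε1 : ε ≤ 1 / 10) (hδ : 0 ≤ δ)
    (hstep : ∀ Y Z, dist Z Y ≤ δ → marginalTail μ Z s ≤ marginalTail μ Y s' + b)
    (ha0 : 0 < ∫ Z, marginalTail μ Z s' ∂(sGauss n))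
    (ha : ∫ Z, marginalTail μ Z s' ∂(sGauss n) ≤ (1 + 2 * ε) * gaussTail s')
    (hs : gaussTail s' ≤ (1 + ε) * gaussTail s) (hb : b ≤ ε * gaussTail s) :
    (sGauss n).real {Z | (1 + 8 * ε) * gaussTail s < marginalTail μ Z s} ≤
      2 / ε * rexp (-(n * δ ^ 2) / 5) := by
  have hq := markov_marginalTail (μ := μ) s' (k := 1 + ε) (by linarith) ha0
  have hq2 : ε / 2 ≤ 1 - 1 / (1 + ε) := by
    rw [one_sub_div (by positivity), div_le_div_iff₀ (by positivity) (by positivity)]; nlinarith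
  have h := sGauss_real_le_of_dist hn (measurableSet_marginalTail_le _ _)
    (measurableSet_lt_marginalTail (μ := μ) s ((1 + 8 * ε) * gaussTail s)) hδ ?_
    (show 0 < ε / 2 by positivity) (hq2.trans hq)
  · rwa [inv_div] at h
  intro Y hY Z hZ
  simp only [Set.mem_ofPred_eq] at hY hZ
  by_contra! hd
  have h1 := hstep Y Z (by rw [dist_comm]; exact hd.le)
  have hP := gaussTail_pos s
  have h2 : (1 + ε) * ∫ Z, marginalTail μ Z s' ∂(sGauss n) ≤
      (1 + ε) * ((1 + 2 * ε) * ((1 + ε) * gaussTail s)) := by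
    gcongr
    exact ha.trans (by gcongr)
  have h3 : (1 + ε) * ((1 + 2 * ε) * ((1 + ε) * gaussTail s)) ≤ (1 + 7 * ε) * gaussTail s := by
    have : (1 + ε) * (1 + 2 * ε) * (1 + ε) ≤ 1 + 7 * ε := by nlinarith [sq_nonneg ε]
    nlinarith
  linarith

lemma marginalTail_far_le [IsProbabilityMeasure μ] (hn : 0 < n) {ε δ b h s : ℝ} (hε : 0 < ε)
    (hε1 : ε ≤ 1 / 10) (hδ : 0 ≤ δ) (hh : 0 < h)
    (hstep : ∀ j : ℕ, ∀ Y Z, dist Z Y ≤ j * δ →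
      marginalTail μ Z s ≤ marginalTail μ Y (s - j * h) + b)
    (ha : ∀ t, 0 < t → t ≤ s → |∫ Z, marginalTail μ Z t ∂(sGauss n) - gaussTail t| ≤
      2 * ε * gaussTail t)
    (hb : b ≤ ε * gaussTail s) (j : ℕ) :
    (sGauss n).real {Z | 3 * gaussTail (s - j * h) < marginalTail μ Z s} ≤
      2 * rexp (-(n * δ ^ 2) / 5 * j ^ 2) := by
  rcases le_or_gt (s - j * h) 0 with h0 | h0
  · have : {Z | 3 * gaussTail (s - j * h) < marginalTail μ Z s} = ∅ := by
      ext Z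
      simp only [Set.mem_ofPred_eq, Set.mem_empty_iff_false, iff_false, not_lt]
      have h1 := gaussTail_anti h0
      rw [gaussTail_zero] at h1
      have := marginalTail_le_one (μ := μ) Z s
      linarith
    rw [this]; simp; positivity
  · have hle : s - j * h ≤ s := by have : 0 ≤ j * h := by positivity
                                   linarith
    have ha' := abs_le.1 (ha _ h0 hle)
    have hP := gaussTail_pos (s - j * h)
    have hq := markov_marginalTail (μ := μ) (s - j * h) (k := 2) (by norm_num) (by nlinarith)
    have h := sGauss_real_le_of_dist hn (measurableSet_marginalTail_le _ _)
      (measurableSet_lt_marginalTail (μ := μ) s (3 * gaussTail (s - j * h)))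
      (show 0 ≤ j * δ by positivity) ?_
      (show (0 : ℝ) < 1 / 2 by positivity) (le_trans (by norm_num) hq)
    · refine h.trans (le_of_eq ?_)
      rw [one_div, inv_inv]; congr 2; ring
    intro Y hY Z hZ
    simp only [Set.mem_ofPred_eq] at hY hZ
    by_contra! hd
    have h1 := hstep j Y Z (by rw [dist_comm]; exact hd.le)
    have h2 := gaussTail_anti hle
    nlinarith

lemma le_layer_sum (u : ℝ) (M : ℕ → ℝ) (hM : ∀ j, 0 ≤ M j) (N : ℕ) :
    u ≤ M 1 + ∑ j ∈ Finset.range N, (if M (j + 1) < u then M (j + 2) else 0) ∨ M (N + 1) < u := by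
  induction N with
  | zero => simpa using le_or_gt u (M 1)
  | succ N ih =>
    have hs : 0 ≤ ∑ j ∈ Finset.range N, (if M (j + 1) < u then M (j + 2) else 0) :=
      Finset.sum_nonneg fun j _ => by split_ifs; exacts [hM _, le_rfl]
    rw [Finset.sum_range_succ]
    rcases ih with h | h
    · left
      have : 0 ≤ (if M (N + 1) < u then M (N + 2) else 0) := by split_ifs; exacts [hM _, le_rfl]
      linarith
    · rw [if_pos h]
      rcases le_or_gt u (M (N + 2)) with h2 | h2
      · left; linarith [hM 1]
      · right; exact h2

lemma marginalTail_mass_lower [IsProbabilityMeasure μ] (hn : 0 < n) {ε δ b h s : ℝ} (hε : 0 < ε)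
    (hε1 : ε ≤ 1 / 10) (hδ : 0 ≤ δ) (hh : 0 < h) (hs : 0 < s)
    (hstep : ∀ j : ℕ, ∀ Y Z, dist Z Y ≤ j * δ →
      marginalTail μ Z s ≤ marginalTail μ Y (s - j * h) + b)
    (ha : ∀ t, 0 < t → t ≤ s → |∫ Z, marginalTail μ Z t ∂(sGauss n) - gaussTail t| ≤
      2 * ε * gaussTail t)
    (hb : b ≤ ε * gaussTail s) (hx : 3 * (1 + s) * h ≤ 1 / 10)
    (hy : rexp (-(n * δ ^ 2) / 5) ≤ ε / 400) :
    ε / 10 ≤ (sGauss n).real {Z | (1 - ε) * ∫ Z, marginalTail μ Z s ∂(sGauss n) <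
      marginalTail μ Z s} := by
  obtain ⟨a, ha_def⟩ : ∃ a, a = ∫ Z, marginalTail μ Z s ∂(sGauss n) := ⟨_, rfl⟩
  obtain ⟨P, hPdef⟩ : ∃ P, P = gaussTail s := ⟨_, rfl⟩
  have hP : 0 < P := hPdef ▸ gaussTail_pos s
  have ha' := abs_le.1 (ha s hs le_rfl)
  rw [← ha_def, ← hPdef] at ha'
  rw [← ha_def]
  set B := {Z | (1 - ε) * a < marginalTail μ Z s} with hB
  have hBm : MeasurableSet B := measurableSet_lt_marginalTail _ _
  obtain ⟨x, hxdef⟩ : ∃ x, x = 3 * (1 + s) * h := ⟨_, rfl⟩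
  have hx0 : 0 < x := by rw [hxdef]; positivity
  obtain ⟨N, hN⟩ := exists_nat_gt (s / h)
  have hMle : ∀ j : ℕ, gaussTail (s - j * h) ≤ P * rexp (j * x) := by
    intro j
    have := gaussTail_le_exp_mul (show s - j * h ≤ s by
      have : 0 ≤ j * h := by positivity
      linarith) hs.le
    rw [hPdef]
    refine this.trans (le_of_eq ?_)
    congr 2; rw [hxdef]; ring
  -- pointwise layer bound
  have hpt : ∀ Z, B.indicator (fun Z => marginalTail μ Z s) Z ≤
      3 * gaussTail (s - (1 : ℕ) * h) * B.indicator (fun _ => (1 : ℝ)) Z +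
      ∑ j ∈ Finset.range N, 3 * gaussTail (s - (j + 2 : ℕ) * h) *
        ({Z | 3 * gaussTail (s - (j + 1 : ℕ) * h) < marginalTail μ Z s}.indicator
          (fun _ => (1 : ℝ)) Z) := by
    intro Z
    have hsum : ∀ j ∈ Finset.range N, 0 ≤ 3 * gaussTail (s - (j + 2 : ℕ) * h) *
        ({Z | 3 * gaussTail (s - (j + 1 : ℕ) * h) < marginalTail μ Z s}.indicator
          (fun _ => (1 : ℝ)) Z) := by
      intro j _
      have := gaussTail_pos (s - (j + 2 : ℕ) * h)
      have h2 : 0 ≤ ({Z | 3 * gaussTail (s - (j + 1 : ℕ) * h) < marginalTail μ Z s}.indicator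
          (fun _ => (1 : ℝ)) Z) := Set.indicator_nonneg (fun _ _ => zero_le_one) _
      positivity
    by_cases hZ : Z ∈ B
    · rw [Set.indicator_of_mem hZ, Set.indicator_of_mem hZ, mul_one]
      rcases le_layer_sum (marginalTail μ Z s) (fun j => 3 * gaussTail (s - j * h))
        (fun j => by have := gaussTail_pos (s - j * h); positivity) N with h1 | h1
      · refine h1.trans (le_of_eq ?_)
        congr 1
        apply Finset.sum_congr rfl
        intro j _
        by_cases hj : 3 * gaussTail (s - (j + 1 : ℕ) * h) < marginalTail μ Z s
        · rw [if_pos hj, Set.indicator_apply, if_pos (by exact hj), mul_one]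
        · rw [if_neg hj, Set.indicator_apply, if_neg (by exact hj), mul_zero]
      · exfalso
        have h2 : s - (N + 1 : ℕ) * h ≤ 0 := by
          rw [div_lt_iff₀ hh] at hN; push_cast; linarith
        have h3 := gaussTail_anti h2
        rw [gaussTail_zero] at h3
        have := marginalTail_le_one (μ := μ) Z s
        linarith
    · rw [Set.indicator_of_notMem hZ, Set.indicator_of_notMem hZ, mul_zero, zero_add]
      exact Finset.sum_nonneg hsum
  have hEm : ∀ j : ℕ, MeasurableSet {Z | 3 * gaussTail (s - (j + 1 : ℕ) * h) < marginalTail μ Z s} :=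
    fun j => measurableSet_lt_marginalTail _ _
  have hint : ∫ Z, B.indicator (fun Z => marginalTail μ Z s) Z ∂(sGauss n) ≤
      3 * gaussTail (s - (1 : ℕ) * h) * (sGauss n).real B +
      ∑ j ∈ Finset.range N, 3 * gaussTail (s - (j + 2 : ℕ) * h) *
        (sGauss n).real {Z | 3 * gaussTail (s - (j + 1 : ℕ) * h) < marginalTail μ Z s} := by
    have hi1 : ∀ j ∈ Finset.range N, Integrable (fun Z => 3 * gaussTail (s - (j + 2 : ℕ) * h) *
        ({Z | 3 * gaussTail (s - (j + 1 : ℕ) * h) < marginalTail μ Z s}.indicator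
          (fun _ => (1 : ℝ)) Z)) (sGauss n) :=
      fun j _ => ((integrable_const (1 : ℝ)).indicator (hEm j)).const_mul _
    have hi2 : Integrable (fun Z => 3 * gaussTail (s - (1 : ℕ) * h) *
        B.indicator (fun _ => (1 : ℝ)) Z) (sGauss n) :=
      ((integrable_const (1 : ℝ)).indicator hBm).const_mul _
    refine (integral_mono ((integrable_marginalTail s).indicator hBm)
      (hi2.add (integrable_finsetSum _ hi1)) hpt).trans (le_of_eq ?_)
    rw [integral_add' hi2 (integrable_finsetSum _ hi1), integral_finsetSum _ hi1,
      integral_const_mul]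
    congr 1
    · congr 1; exact integral_indicator_one hBm
    · apply Finset.sum_congr rfl
      intro j _
      rw [integral_const_mul]
      congr 1; exact integral_indicator_one (hEm j)
  have ha0 : 0 ≤ (1 - ε) * a := mul_nonneg (by linarith) (by nlinarith)
  have hlow : ε * a ≤ ∫ Z, B.indicator (fun Z => marginalTail μ Z s) Z ∂(sGauss n) := by
    have h1 : ∫ Z, marginalTail μ Z s - (1 - ε) * a ∂(sGauss n) ≤
        ∫ Z, B.indicator (fun Z => marginalTail μ Z s) Z ∂(sGauss n) := by
      apply integral_mono ((integrable_marginalTail s).sub (integrable_const _))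
        ((integrable_marginalTail s).indicator hBm)
      intro Z
      change marginalTail μ Z s - (1 - ε) * a ≤ B.indicator (fun Z => marginalTail μ Z s) Z
      by_cases hZ : Z ∈ B
      · rw [Set.indicator_of_mem hZ]
        linarith
      · rw [Set.indicator_of_notMem hZ]
        simp only [hB, Set.mem_ofPred_eq, not_lt] at hZ
        linarith
    rw [integral_sub (integrable_marginalTail s) (integrable_const _), ← ha_def] at h1
    simp at h1
    linarith
  have hterm : ∀ j ∈ Finset.range N, 3 * gaussTail (s - (j + 2 : ℕ) * h) *
        (sGauss n).real {Z | 3 * gaussTail (s - (j + 1 : ℕ) * h) < marginalTail μ Z s} ≤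
        6 * P * (ε / 200) * (1 / 2) ^ j := by
    intro j _
    have h1 := marginalTail_far_le hn hε hε1 hδ hh hstep ha hb (j + 1)
    have h2 := hMle (j + 2)
    obtain ⟨y, hydef⟩ : ∃ y, y = (n * δ ^ 2) / 5 := ⟨_, rfl⟩
    have hy' : rexp (-y) ≤ ε / 400 := by rw [hydef, ← neg_div]; exact hy
    have hy0 : 0 ≤ y := by rw [hydef]; positivity
    have he : -(n * δ ^ 2) / 5 = -y := by rw [hydef, neg_div]
    rw [he] at h1
    have h3 : rexp ((j + 2 : ℕ) * x) * rexp (-y * (j + 1 : ℕ) ^ 2) ≤ (rexp (-y) * 2) ^ (j + 1) := by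
      have e2 : rexp (2 * x) ≤ 2 := by
        have : 2 * x ≤ Real.log 2 := by have := Real.log_two_gt_d9; linarith
        calc rexp (2 * x) ≤ rexp (Real.log 2) := Real.exp_le_exp.2 this
          _ = 2 := Real.exp_log (by norm_num)
      calc rexp ((j + 2 : ℕ) * x) * rexp (-y * (j + 1 : ℕ) ^ 2)
          ≤ rexp ((j + 1 : ℕ) * (2 * x)) * rexp ((j + 1 : ℕ) * (-y)) := by
            have hj : (0 : ℝ) ≤ j := Nat.cast_nonneg j
            apply mul_le_mul _ _ (Real.exp_pos _).le (Real.exp_pos _).le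
            · apply Real.exp_le_exp.2; push_cast; nlinarith [mul_nonneg hj hx0.le]
            · apply Real.exp_le_exp.2; push_cast
              nlinarith [mul_nonneg hj hy0, mul_nonneg hj (mul_nonneg hj hy0)]
        _ = (rexp (2 * x) * rexp (-y)) ^ (j + 1) := by
            rw [Real.exp_nat_mul, Real.exp_nat_mul, mul_pow]
        _ ≤ _ := by
            rw [mul_comm]; gcongr
    have h4 : (rexp (-y) * 2) ^ (j + 1) ≤ (ε / 200) * (1 / 2) ^ j := by
      rw [pow_succ, mul_comm]
      have := Real.exp_pos (-y)
      gcongr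
      · linarith
      · linarith
    calc 3 * gaussTail (s - (j + 2 : ℕ) * h) *
        (sGauss n).real {Z | 3 * gaussTail (s - (j + 1 : ℕ) * h) < marginalTail μ Z s}
        ≤ 3 * (P * rexp ((j + 2 : ℕ) * x)) * (2 * rexp (-y * (j + 1 : ℕ) ^ 2)) := by gcongr
      _ = 6 * P * (rexp ((j + 2 : ℕ) * x) * rexp (-y * (j + 1 : ℕ) ^ 2)) := by ring
      _ ≤ 6 * P * ((ε / 200) * (1 / 2) ^ j) := mul_le_mul_of_nonneg_left (h3.trans h4) (by positivity)
      _ = _ := by ring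
  have hsum : ∑ j ∈ Finset.range N, 3 * gaussTail (s - (j + 2 : ℕ) * h) *
        (sGauss n).real {Z | 3 * gaussTail (s - (j + 1 : ℕ) * h) < marginalTail μ Z s} ≤
        6 * P * (ε / 200) * 2 := by
    refine (Finset.sum_le_sum hterm).trans ?_
    rw [← Finset.mul_sum]
    gcongr
    exact sum_geometric_two_le N
  have hM1 : gaussTail (s - (1 : ℕ) * h) ≤ P * 2 := by
    refine (hMle 1).trans ?_
    gcongr
    have : ((1 : ℕ) : ℝ) * x ≤ Real.log 2 := by
      have := Real.log_two_gt_d9; push_cast; linarith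
    calc rexp ((1 : ℕ) * x) ≤ rexp (Real.log 2) := Real.exp_le_exp.2 this
      _ = 2 := Real.exp_log (by norm_num)
  have hg0 : 0 ≤ (sGauss n).real B := measureReal_nonneg
  have hfin : ε * a ≤ 3 * (P * 2) * (sGauss n).real B + 6 * P * (ε / 200) * 2 := by
    refine hlow.trans (hint.trans (add_le_add ?_ hsum))
    gcongr
  have h8 : ε * ((1 - 2 * ε) * P) ≤ ε * a := by gcongr; linarith
  have h9 : P * (ε / 10 * 6) ≤ P * (6 * (sGauss n).real B) := by
    have : ε * ε * P ≤ ε * (1/10) * P := by gcongr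
    nlinarith
  have := le_of_mul_le_mul_left h9 hP
  linarith

lemma crude_lower [IsProbabilityMeasure μ] (hn : 0 < n) {ε δ b h s : ℝ} (hε : 0 < ε)
    (hε1 : ε ≤ 1 / 10) (hδ : 0 ≤ δ) (hh : 0 < h) (hs : 0 < s)
    (hstep : ∀ j : ℕ, ∀ Y Z, dist Z Y ≤ j * δ →
      marginalTail μ Z s ≤ marginalTail μ Y (s - j * h) + b)
    (ha : ∀ t, 0 < t → t ≤ s → |∫ Z, marginalTail μ Z t ∂(sGauss n) - gaussTail t| ≤
      2 * ε * gaussTail t)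
    (hb : b ≤ ε * gaussTail s) (hx : 3 * (1 + s) * h ≤ ε)
    (hy : rexp (-(n * δ ^ 2) / 5) ≤ ε / 400) :
    (sGauss n).real {Z | marginalTail μ Z (s - h) < (1 - 8 * ε) * gaussTail (s - h)} ≤
      10 / ε * rexp (-(n * δ ^ 2) / 5) := by
  have hq := marginalTail_mass_lower hn hε hε1 hδ hh hs hstep ha hb (hx.trans hε1) hy
  have h := sGauss_real_le_of_dist hn (measurableSet_lt_marginalTail _ _)
    (measurableSet_marginalTail_lt (μ := μ) (s - h) ((1 - 8 * ε) * gaussTail (s - h))) hδ ?_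
    (show 0 < ε / 10 by positivity) hq
  · rwa [inv_div] at h
  intro Y hY Z hZ
  simp only [Set.mem_ofPred_eq] at hY hZ
  by_contra! hd
  have h1 := hstep 1 Z Y (by simpa using hd.le)
  have hP := gaussTail_pos s
  have ha' := abs_le.1 (ha s hs le_rfl)
  have h2 := gaussTail_le_exp_mul (show s - h ≤ s by linarith) hs.le
  have h3 : rexp (3 * (1 + s) * (s - (s - h))) ≤ 1 + 2 * ε := by
    have : rexp (3 * (1 + s) * (s - (s - h))) ≤ rexp ε := by
      apply Real.exp_le_exp.2; linarith
    have h4 := Real.abs_exp_sub_one_le (x := ε) (by rw [abs_of_pos hε]; linarith)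
    rw [abs_of_pos hε] at h4
    have := (abs_le.1 h4).2
    linarith
  have h5 : gaussTail (s - h) ≤ gaussTail s * (1 + 2 * ε) := h2.trans (by gcongr)
  push_cast at h1
  rw [one_mul] at h1
  have h6 : (1 - ε) * ((1 - 2 * ε) * gaussTail s) ≤
      (1 - ε) * ∫ Z, marginalTail μ Z s ∂(sGauss n) := by
    apply mul_le_mul_of_nonneg_left _ (by linarith); linarith
  rcases le_or_gt (1 - 8 * ε) 0 with h8 | h8
  · have := marginalTail_nonneg (μ := μ) Z (s - h)
    have := mul_nonpos_of_nonpos_of_nonneg h8 (gaussTail_pos (s - h)).le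
    linarith
  have h7 : (1 - 8 * ε) * gaussTail (s - h) ≤ (1 - 8 * ε) * (gaussTail s * (1 + 2 * ε)) := by
    gcongr
  have h10 : (1 - 8 * ε) * (gaussTail s * (1 + 2 * ε)) ≤ (1 - ε) * ((1 - 2 * ε) * gaussTail s) -
      ε * gaussTail s := by
    have : (1 - 8 * ε) * (1 + 2 * ε) ≤ (1 - ε) * (1 - 2 * ε) - ε := by nlinarith
    nlinarith
  linarith

end CrudeRegime

lemma cosh_le_one_add_sq {z : ℝ} (hz : |z| ≤ 4 / 3) : cosh z ≤ 1 + z ^ 2 := by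
  have h1 := Real.cosh_le_exp_half_sq z
  have hz2 : z ^ 2 ≤ 16 / 9 := by
    have := abs_le.1 hz
    nlinarith
  have h2 := Real.abs_exp_sub_one_sub_id_le (x := z ^ 2 / 2) (by
    rw [abs_of_nonneg (by positivity)]; linarith)
  have h3 := (abs_le.1 h2).2
  nlinarith [sq_nonneg z]

lemma inv_sqrt_one_sub_sq_le {τ : ℝ} (hτ : |τ| ≤ 1 / 2) : (√(1 - τ ^ 2))⁻¹ ≤ 1 + τ ^ 2 := by
  have ht : τ ^ 2 ≤ 1 / 4 := by
    have := abs_le.1 hτ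
    nlinarith
  have hv : 0 < 1 - τ ^ 2 := by linarith
  rw [inv_le_comm₀ (sqrt_pos.2 hv) (by positivity)]
  apply Real.le_sqrt_of_sq_le
  rw [inv_pow, inv_le_iff_one_le_mul₀ (by positivity)]
  nlinarith [sq_nonneg τ, mul_nonneg (sq_nonneg τ) (sq_nonneg τ)]

lemma pow_eight_mul_exp_le {y : ℝ} (hy : 0 ≤ y) : y ^ 8 * rexp (-(y / 4)) ≤ 3 * 10 ^ 9 := by
  have h := Real.pow_div_factorial_le_exp (y / 4) (by positivity) 8
  rw [Real.exp_neg, ← div_eq_mul_inv, div_le_iff₀ (Real.exp_pos _)]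
  have h2 : (Nat.factorial 8 : ℝ) = 40320 := by norm_num [Nat.factorial]
  rw [h2, div_le_iff₀ (by norm_num)] at h
  have : (y / 4) ^ 8 = y ^ 8 / 65536 := by rw [div_pow]; norm_num
  rw [this] at h
  nlinarith [Real.exp_pos (y / 4)]

lemma gaussDensity_mul_pdf {τ : ℝ} {v : NNReal} (hv : (v : ℝ) = 1 - τ ^ 2) (hv0 : (0 : ℝ) < v)
    (A B : ℝ) : gaussDensity A * ProbabilityTheory.gaussianPDFReal (τ * A) v B =
      (2 * π)⁻¹ * (√(1 - τ ^ 2))⁻¹ *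
        rexp (-(A ^ 2 + B ^ 2 - 2 * (τ * A * B)) / (2 * (1 - τ ^ 2))) := by
  rw [gaussDensity, ProbabilityTheory.gaussianPDFReal, hv]
  rw [hv] at hv0
  rw [Real.sqrt_mul (show 0 ≤ 2 * π by positivity) (1 - τ ^ 2), div_eq_mul_inv, mul_inv]
  have h1 : rexp (-(A ^ 2 + B ^ 2 - 2 * (τ * A * B)) / (2 * (1 - τ ^ 2))) =
      rexp (-A ^ 2 / 2) * rexp (-(B - τ * A) ^ 2 / (2 * (1 - τ ^ 2))) := by
    rw [← Real.exp_add]; congr 1; field_simp; ring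
  have h2 : (2 * π)⁻¹ = (√(2 * π))⁻¹ * (√(2 * π))⁻¹ := by
    rw [← mul_inv, Real.mul_self_sqrt (by positivity)]
  rw [h1, h2]; ring

lemma gaussDensity_mul_gaussDensity (A B : ℝ) : gaussDensity A * gaussDensity B =
    (2 * π)⁻¹ * rexp (-(A ^ 2 + B ^ 2) / 2) := by
  have h2 : (2 * π)⁻¹ = (√(2 * π))⁻¹ * (√(2 * π))⁻¹ := by
    rw [← mul_inv, Real.mul_self_sqrt (by positivity)]
  rw [h2, gaussDensity, gaussDensity,
    show -(A ^ 2 + B ^ 2) / 2 = -A ^ 2 / 2 + -B ^ 2 / 2 by ring, Real.exp_add]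
  ring

lemma mehler_kernel_le {τ : ℝ} (hτ : |τ| ≤ 1 / 2) {v : NNReal} (hv : (v : ℝ) = 1 - τ ^ 2)
    (A B : ℝ) :
    gaussDensity A * ((ProbabilityTheory.gaussianPDFReal (τ * A) v B +
        ProbabilityTheory.gaussianPDFReal (τ * A) v (-B)) / 2) ≤
      gaussDensity A * gaussDensity B * (1 + 3 * τ ^ 2 * ((1 + A ^ 2) * (1 + B ^ 2))) +
        3 * 10 ^ 9 * τ ^ 8 * (rexp (-(1 / 8) * A ^ 2) * rexp (-(1 / 8) * B ^ 2)) := by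
  have ht : τ ^ 2 ≤ 1 / 4 := by
    have := abs_le.1 hτ
    nlinarith
  have hv1 : 0 < 1 - τ ^ 2 := by linarith
  have hv0 : (0 : ℝ) < v := by rw [hv]; exact hv1
  have hpi : (2 * π)⁻¹ ≤ 1 / 2 := by
    rw [inv_le_comm₀ (by positivity) (by norm_num)]; linarith [Real.pi_gt_three]
  have hpi0 : 0 < (2 * π)⁻¹ := by positivity
  have hs := inv_sqrt_one_sub_sq_le hτ
  have hs0 : 0 < (√(1 - τ ^ 2))⁻¹ := by positivity
  have hr0 : 0 ≤ 3 * 10 ^ 9 * τ ^ 8 * (rexp (-(1 / 8) * A ^ 2) * rexp (-(1 / 8) * B ^ 2)) := by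
    positivity
  have hsplit : gaussDensity A * ((ProbabilityTheory.gaussianPDFReal (τ * A) v B +
        ProbabilityTheory.gaussianPDFReal (τ * A) v (-B)) / 2) =
      (gaussDensity A * ProbabilityTheory.gaussianPDFReal (τ * A) v B +
        gaussDensity A * ProbabilityTheory.gaussianPDFReal (τ * A) v (-B)) / 2 := by ring
  rw [hsplit, gaussDensity_mul_pdf hv hv0, gaussDensity_mul_pdf hv hv0]
  rcases le_or_gt |τ * A * B| 1 with hc | hc
  · obtain ⟨z, hz⟩ : ∃ z, z = τ * A * B / (1 - τ ^ 2) := ⟨_, rfl⟩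
    have hz1 : |z| ≤ 4 / 3 := by
      rw [hz, abs_div, abs_of_pos hv1, div_le_iff₀ hv1]; linarith
    have hz2 : z ^ 2 ≤ 16 / 9 * (τ ^ 2 * (A ^ 2 * B ^ 2)) := by
      rw [hz, div_pow, div_le_iff₀ (by positivity)]
      have : 9 / 16 ≤ (1 - τ ^ 2) ^ 2 := by nlinarith
      have h0 : 0 ≤ τ ^ 2 * (A ^ 2 * B ^ 2) := by positivity
      nlinarith [mul_le_mul_of_nonneg_left this h0]
    have e1 : rexp (-(A ^ 2 + B ^ 2 - 2 * (τ * A * B)) / (2 * (1 - τ ^ 2))) =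
        rexp (-(A ^ 2 + B ^ 2) / (2 * (1 - τ ^ 2))) * rexp z := by
      rw [← Real.exp_add, hz]; congr 1; field_simp; ring
    have e2 : rexp (-(A ^ 2 + (-B) ^ 2 - 2 * (τ * A * -B)) / (2 * (1 - τ ^ 2))) =
        rexp (-(A ^ 2 + B ^ 2) / (2 * (1 - τ ^ 2))) * rexp (-z) := by
      rw [← Real.exp_add, hz]; congr 1; field_simp; ring
    have e3 : rexp (-(A ^ 2 + B ^ 2) / (2 * (1 - τ ^ 2))) ≤ rexp (-(A ^ 2 + B ^ 2) / 2) := by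
      rw [Real.exp_le_exp, neg_div, neg_div, neg_le_neg_iff]
      apply div_le_div_of_nonneg_left (by positivity) (by positivity)
      nlinarith [sq_nonneg τ]
    have hcosh := cosh_le_one_add_sq hz1
    have hkey : (√(1 - τ ^ 2))⁻¹ * cosh z ≤ 1 + 3 * τ ^ 2 * ((1 + A ^ 2) * (1 + B ^ 2)) := by
      calc (√(1 - τ ^ 2))⁻¹ * cosh z ≤ (1 + τ ^ 2) *
            (1 + 16 / 9 * (τ ^ 2 * (A ^ 2 * B ^ 2))) :=
          mul_le_mul hs (by linarith) (Real.cosh_pos z).le (by positivity)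
        _ ≤ _ := by
          have h0 : 0 ≤ τ ^ 2 * (A ^ 2 * B ^ 2) := by positivity
          have h1 : τ ^ 2 * (τ ^ 2 * (A ^ 2 * B ^ 2)) ≤ 1 / 4 * (τ ^ 2 * (A ^ 2 * B ^ 2)) :=
            mul_le_mul_of_nonneg_right ht h0
          have h2 : 0 ≤ τ ^ 2 * A ^ 2 := by positivity
          have h3 : 0 ≤ τ ^ 2 * B ^ 2 := by positivity
          nlinarith [sq_nonneg τ]
    rw [e1, e2, gaussDensity_mul_gaussDensity]
    have : ((2 * π)⁻¹ * (√(1 - τ ^ 2))⁻¹ * (rexp (-(A ^ 2 + B ^ 2) / (2 * (1 - τ ^ 2))) * rexp z)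
        + (2 * π)⁻¹ * (√(1 - τ ^ 2))⁻¹ *
          (rexp (-(A ^ 2 + B ^ 2) / (2 * (1 - τ ^ 2))) * rexp (-z))) / 2 =
        (2 * π)⁻¹ * rexp (-(A ^ 2 + B ^ 2) / (2 * (1 - τ ^ 2))) *
          ((√(1 - τ ^ 2))⁻¹ * cosh z) := by
      rw [Real.cosh_eq]; ring
    rw [this]
    refine le_add_of_le_of_nonneg (mul_le_mul ?_ hkey ?_ (by positivity)) hr0
    · exact mul_le_mul_of_nonneg_left e3 hpi0.le
    · exact mul_nonneg hs0.le (Real.cosh_pos z).le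
  · have hb : ∀ u : ℝ, |u| = |τ * A * B| →
        (2 * π)⁻¹ * (√(1 - τ ^ 2))⁻¹ * rexp (-(A ^ 2 + B ^ 2 - 2 * u) / (2 * (1 - τ ^ 2))) ≤
        3 * 10 ^ 9 * τ ^ 8 * (rexp (-(1 / 8) * A ^ 2) * rexp (-(1 / 8) * B ^ 2)) := by
      intro u hu
      have h2 : |A * B| * 2 ≤ A ^ 2 + B ^ 2 := by
        rw [abs_mul]; nlinarith [sq_nonneg (|A| - |B|), sq_abs A, sq_abs B]
      have hu1 : u ≤ |A * B| / 2 := by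
        refine (le_abs_self u).trans ?_
        rw [hu, mul_assoc, abs_mul]
        nlinarith [abs_nonneg (A * B)]
      have h3 : -(A ^ 2 + B ^ 2 - 2 * u) / (2 * (1 - τ ^ 2)) ≤
          -(|A * B| / 4) + (-(1 / 8) * A ^ 2 + -(1 / 8) * B ^ 2) := by
        rw [div_le_iff₀ (by positivity)]
        have h4 : 0 ≤ |A * B| / 4 + (1 / 8 * A ^ 2 + 1 / 8 * B ^ 2) := by positivity
        nlinarith [mul_nonneg (sq_nonneg τ) h4]
      have h5 : 1 ≤ τ ^ 8 * |A * B| ^ 8 := by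
        have : τ ^ 8 = |τ| ^ 8 := by
          rw [show (8 : ℕ) = 2 * 4 from rfl, pow_mul, pow_mul, sq_abs]
        rw [this, ← mul_pow, ← abs_mul, ← mul_assoc]
        exact one_le_pow₀ hc.le
      have h6 := pow_eight_mul_exp_le (abs_nonneg (A * B))
      have h7 : rexp (-(|A * B| / 4)) ≤ 3 * 10 ^ 9 * τ ^ 8 := by
        calc rexp (-(|A * B| / 4)) = 1 * rexp (-(|A * B| / 4)) := by ring
          _ ≤ τ ^ 8 * |A * B| ^ 8 * rexp (-(|A * B| / 4)) := by gcongr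
          _ = τ ^ 8 * (|A * B| ^ 8 * rexp (-(|A * B| / 4))) := by ring
          _ ≤ τ ^ 8 * (3 * 10 ^ 9) := by gcongr
          _ = _ := by ring
      have h8 : (2 * π)⁻¹ * (√(1 - τ ^ 2))⁻¹ ≤ 1 := by nlinarith
      calc _ ≤ 1 * rexp (-(|A * B| / 4) + (-(1 / 8) * A ^ 2 + -(1 / 8) * B ^ 2)) := by
            apply mul_le_mul h8 (Real.exp_le_exp.2 h3) (Real.exp_pos _).le zero_le_one
        _ = rexp (-(|A * B| / 4)) * (rexp (-(1 / 8) * A ^ 2) * rexp (-(1 / 8) * B ^ 2)) := by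
            rw [one_mul, Real.exp_add, Real.exp_add]
        _ ≤ _ := by gcongr
    have b1 := hb _ rfl
    have b2 := hb (τ * A * -B) (by rw [mul_neg, abs_neg])
    have hn : (-B) ^ 2 = B ^ 2 := by ring
    rw [hn]
    have h0 : 0 ≤ gaussDensity A * gaussDensity B *
        (1 + 3 * τ ^ 2 * ((1 + A ^ 2) * (1 + B ^ 2))) := by
      have := gaussDensity_pos A
      have := gaussDensity_pos B
      positivity
    linarith

/-- The weight `(1 + A²) φ(A)`. -/
noncomputable def gaussWeight (A : ℝ) : ℝ := (1 + A ^ 2) * gaussDensity A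

lemma gaussWeight_nonneg (A : ℝ) : 0 ≤ gaussWeight A :=
  mul_nonneg (by positivity) (gaussDensity_pos A).le

lemma continuous_gaussWeight : Continuous gaussWeight :=
  (by fun_prop : Continuous fun A : ℝ => 1 + A ^ 2).mul continuous_gaussDensity

lemma gaussWeight_le_one (A : ℝ) : gaussWeight A ≤ 1 := by
  have h := Real.add_one_le_exp (A ^ 2 / 2)
  have hs := sqrt_two_pi_bounds
  rw [gaussWeight, gaussDensity, neg_div, Real.exp_neg, ← mul_div_assoc, div_le_one (by linarith),
    ← div_eq_mul_inv, div_le_iff₀ (Real.exp_pos _)]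
  nlinarith [Real.exp_pos (A ^ 2 / 2)]

lemma integrable_gaussWeight : Integrable gaussWeight := by
  have h2 : Integrable fun x : ℝ => x ^ (2 : ℝ) * rexp (-(1 / 2) * x ^ 2) :=
    integrable_rpow_mul_exp_neg_mul_sq (by norm_num) (by norm_num)
  have h3 : Integrable fun x : ℝ => x ^ 2 * gaussDensity x := by
    refine (h2.div_const √(2 * π)).congr (Filter.Eventually.of_forall fun x => ?_)
    simp only [gaussDensity]
    rw [show -(1 / 2) * x ^ 2 = -x ^ 2 / 2 by ring, Real.rpow_two]; ring
  refine (integrable_gaussDensity.add h3).congr (Filter.Eventually.of_forall fun x => ?_)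
  simp only [gaussWeight, Pi.add_apply]; ring

lemma integral_exp_eighth : ∫ x : ℝ, rexp (-(1 / 8) * x ^ 2) = √(π / (1 / 8)) :=
  integral_gaussian (1 / 8)

lemma integral_affine_gaussian {f : ℝ → ℝ} (hf : Measurable f) (hfe : ∀ s, f (-s) = f s)
    {m : ℝ} (hm : ∀ s, 0 ≤ f s ∧ f s ≤ m)
    {τ : ℝ} (hτ : |τ| ≤ 1 / 2) {v : NNReal} (hv : (v : ℝ) = 1 - τ ^ 2) (A : ℝ) :
    ∫ V, f (τ * A + √(1 - τ ^ 2) * V) ∂(ProbabilityTheory.gaussianReal 0 1) =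
      ∫ B, f B * ((ProbabilityTheory.gaussianPDFReal (τ * A) v B +
        ProbabilityTheory.gaussianPDFReal (τ * A) v (-B)) / 2) := by
  have ht : τ ^ 2 ≤ 1 / 4 := by
    have := abs_le.1 hτ
    nlinarith
  have hv0 : v ≠ 0 := by
    intro h; rw [h] at hv; norm_num at hv; linarith
  have hmap : (ProbabilityTheory.gaussianReal 0 1).map (fun V => τ * A + √(1 - τ ^ 2) * V) =
      ProbabilityTheory.gaussianReal (τ * A) v := by
    have : (fun V => τ * A + √(1 - τ ^ 2) * V) =
      (fun x => τ * A + x) ∘ (fun V => √(1 - τ ^ 2) * V) := rfl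
    rw [this, ← Measure.map_map (by fun_prop) (by fun_prop),
      ProbabilityTheory.gaussianReal_map_const_mul, ProbabilityTheory.gaussianReal_map_const_add]
    congr 1
    · ring
    · ext
      rw [hv]; simp only [NNReal.coe_mul, NNReal.coe_mk, NNReal.coe_one, mul_one]
      exact Real.sq_sqrt (by linarith)
  have h1 : ∫ V, f (τ * A + √(1 - τ ^ 2) * V) ∂(ProbabilityTheory.gaussianReal 0 1) =
      ∫ B, f B ∂(ProbabilityTheory.gaussianReal (τ * A) v) := by
    rw [← hmap, integral_map (by fun_prop) hf.aestronglyMeasurable]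
  rw [h1, ProbabilityTheory.integral_gaussianReal_eq_integral_smul hv0]
  simp only [smul_eq_mul]
  have hi : Integrable fun B => f B * ProbabilityTheory.gaussianPDFReal (τ * A) v B :=
    (ProbabilityTheory.integrable_gaussianPDFReal (τ * A) v).bdd_mul hf.aestronglyMeasurable
      (c := m) (Filter.Eventually.of_forall fun s => by
        rw [Real.norm_eq_abs, abs_of_nonneg (hm s).1]; exact (hm s).2)
  have hi2 : Integrable fun B => f B * ProbabilityTheory.gaussianPDFReal (τ * A) v (-B) := by
    have := hi.comp_neg
    simpa only [hfe] using this
  have h2 : ∫ B, f B * ProbabilityTheory.gaussianPDFReal (τ * A) v (-B) =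
      ∫ B, f B * ProbabilityTheory.gaussianPDFReal (τ * A) v B := by
    rw [← integral_neg_eq_self (fun B => f B * ProbabilityTheory.gaussianPDFReal (τ * A) v B)]
    simp only [hfe]
  have h3 : (fun B => f B * ((ProbabilityTheory.gaussianPDFReal (τ * A) v B +
        ProbabilityTheory.gaussianPDFReal (τ * A) v (-B)) / 2)) = fun B =>
      (1 / 2) * (f B * ProbabilityTheory.gaussianPDFReal (τ * A) v B) +
      (1 / 2) * (f B * ProbabilityTheory.gaussianPDFReal (τ * A) v (-B)) := by
    ext B; ring
  rw [h3, integral_add (hi.const_mul _) (hi2.const_mul _), integral_const_mul, integral_const_mul,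
    h2]
  have h4 : (fun x => ProbabilityTheory.gaussianPDFReal (τ * A) v x * f x) =
    fun x => f x * ProbabilityTheory.gaussianPDFReal (τ * A) v x := by ext; ring
  rw [h4]; ring

/-- Positive-correlation estimate for an even function of two correlated Gaussians. -/
lemma gauss_correlation_le {f f' : ℝ → ℝ} (hf : Measurable f) (hf' : Measurable f')
    (hfe : ∀ s, f' (-s) = f' s) {m : ℝ} (hm : ∀ s, 0 ≤ f s ∧ f s ≤ m)
    (hm' : ∀ s, 0 ≤ f' s ∧ f' s ≤ m) {τ : ℝ} (hτ : |τ| ≤ 1) :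
    ∫ p, f p.1 * f' (τ * p.1 + √(1 - τ ^ 2) * p.2)
        ∂((ProbabilityTheory.gaussianReal 0 1).prod (ProbabilityTheory.gaussianReal 0 1)) ≤
      (∫ A, f A * gaussDensity A) * (∫ A, f' A * gaussDensity A) +
      3 * τ ^ 2 * ((∫ A, f A * gaussWeight A) * (∫ A, f' A * gaussWeight A)) +
      10 ^ 11 * m ^ 2 * τ ^ 8 := by
  have hm0 : 0 ≤ m := (hm 0).1.trans (hm 0).2
  have i1 : ∀ {g : ℝ → ℝ}, Integrable g → Integrable fun A => f A * g A := fun hg =>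
    hg.bdd_mul hf.aestronglyMeasurable (c := m) (Filter.Eventually.of_forall fun s => by
        rw [Real.norm_eq_abs, abs_of_nonneg (hm s).1]; exact (hm s).2)
  have i2 : ∀ {g : ℝ → ℝ}, Integrable g → Integrable fun A => f' A * g A := fun hg =>
    hg.bdd_mul hf'.aestronglyMeasurable (c := m) (Filter.Eventually.of_forall fun s => by
        rw [Real.norm_eq_abs, abs_of_nonneg (hm' s).1]; exact (hm' s).2)
  have p1 : ∀ {g : ℝ → ℝ}, (∀ s, 0 ≤ g s) → 0 ≤ ∫ A, f A * g A := fun hg =>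
    integral_nonneg fun s => mul_nonneg (hm s).1 (hg s)
  have p2 : ∀ {g : ℝ → ℝ}, (∀ s, 0 ≤ g s) → 0 ≤ ∫ A, f' A * g A := fun hg =>
    integral_nonneg fun s => mul_nonneg (hm' s).1 (hg s)
  have hmeas : Measurable fun p : ℝ × ℝ => f p.1 * f' (τ * p.1 + √(1 - τ ^ 2) * p.2) :=
    (hf.comp measurable_fst).mul (hf'.comp (by fun_prop))
  have hbd : ∀ p : ℝ × ℝ, ‖f p.1 * f' (τ * p.1 + √(1 - τ ^ 2) * p.2)‖ ≤ m ^ 2 := by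
    intro p
    rw [Real.norm_eq_abs, abs_of_nonneg (mul_nonneg (hm _).1 (hm' _).1), pow_two m]
    exact mul_le_mul (hm _).2 (hm' _).2 (hm' _).1 hm0
  have hint : Integrable (fun p : ℝ × ℝ => f p.1 * f' (τ * p.1 + √(1 - τ ^ 2) * p.2))
      ((ProbabilityTheory.gaussianReal 0 1).prod (ProbabilityTheory.gaussianReal 0 1)) :=
    Integrable.of_bound hmeas.aestronglyMeasurable (m ^ 2) (Filter.Eventually.of_forall hbd)
  rcases le_or_gt |τ| (1 / 2) with hc | hc
  · have ht : τ ^ 2 ≤ 1 / 4 := by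
      have := abs_le.1 hc
      nlinarith
    obtain ⟨v, hv⟩ : ∃ v : NNReal, (v : ℝ) = 1 - τ ^ 2 := ⟨⟨1 - τ ^ 2, by linarith⟩, rfl⟩
    rw [integral_prod _ hint, ProbabilityTheory.integral_gaussianReal_eq_integral_smul one_ne_zero]
    simp only [smul_eq_mul, ← gaussDensity_eq_pdf]
    simp_rw [integral_const_mul, integral_affine_gaussian hf' hfe hm' hc hv]
    have hE : Integrable fun x : ℝ => rexp (-(1 / 8) * x ^ 2) :=
      integrable_exp_neg_mul_sq (by norm_num)
    have hinner : ∀ A, gaussDensity A * (f A * ∫ B, f' B *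
        ((ProbabilityTheory.gaussianPDFReal (τ * A) v B +
        ProbabilityTheory.gaussianPDFReal (τ * A) v (-B)) / 2)) ≤
        f A * gaussDensity A * (∫ B, f' B * gaussDensity B) +
        3 * τ ^ 2 * (f A * gaussWeight A * (∫ B, f' B * gaussWeight B)) +
        3 * 10 ^ 9 * τ ^ 8 * (f A * rexp (-(1 / 8) * A ^ 2) *
          ∫ B, f' B * rexp (-(1 / 8) * B ^ 2)) := by
      intro A
      rw [← mul_assoc, mul_comm (gaussDensity A), mul_assoc]
      have : ∫ B, gaussDensity A * (f' B *
          ((ProbabilityTheory.gaussianPDFReal (τ * A) v B +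
          ProbabilityTheory.gaussianPDFReal (τ * A) v (-B)) / 2)) ≤
          ∫ B, ((gaussDensity A * (f' B * gaussDensity B) +
            3 * τ ^ 2 * gaussWeight A * (f' B * gaussWeight B)) +
            3 * 10 ^ 9 * τ ^ 8 * rexp (-(1 / 8) * A ^ 2) * (f' B * rexp (-(1 / 8) * B ^ 2))) := by
        apply integral_mono_of_nonneg
        · refine Filter.Eventually.of_forall fun B => ?_
          have q1 := ProbabilityTheory.gaussianPDFReal_nonneg (τ * A) v B
          have q2 := ProbabilityTheory.gaussianPDFReal_nonneg (τ * A) v (-B)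
          have q3 := (gaussDensity_pos A).le
          have q4 := (hm' B).1
          change 0 ≤ gaussDensity A * (f' B * _)
          positivity
        · exact (((i2 integrable_gaussDensity).const_mul _).add
            ((i2 integrable_gaussWeight).const_mul _)).add ((i2 hE).const_mul _)
        · refine Filter.Eventually.of_forall fun B => ?_
          have := mul_le_mul_of_nonneg_left (mehler_kernel_le hc hv A B) (hm' B).1
          simp only [gaussWeight]
          nlinarith [this]
      have hA : Integrable fun B => gaussDensity A * (f' B * gaussDensity B) +
            3 * τ ^ 2 * gaussWeight A * (f' B * gaussWeight B) :=
        ((i2 integrable_gaussDensity).const_mul _).add ((i2 integrable_gaussWeight).const_mul _)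
      rw [integral_add hA ((i2 hE).const_mul _),
        integral_add ((i2 integrable_gaussDensity).const_mul _)
            ((i2 integrable_gaussWeight).const_mul _), integral_const_mul, integral_const_mul,
            integral_const_mul, integral_const_mul] at this
      refine (mul_le_mul_of_nonneg_left this (hm A).1).trans (le_of_eq ?_)
      ring
    have hJ : (∫ A, f A * rexp (-(1 / 8) * A ^ 2)) * (∫ B, f' B * rexp (-(1 / 8) * B ^ 2)) ≤
        m ^ 2 * 26 := by
      have j1 : ∫ A, f A * rexp (-(1 / 8) * A ^ 2) ≤ m * √(π / (1 / 8)) := by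
        rw [← integral_exp_eighth, ← integral_const_mul]
        exact integral_mono (i1 hE) (hE.const_mul _) fun A =>
          mul_le_mul_of_nonneg_right (hm A).2 (Real.exp_pos _).le
      have j2 : ∫ A, f' A * rexp (-(1 / 8) * A ^ 2) ≤ m * √(π / (1 / 8)) := by
        rw [← integral_exp_eighth, ← integral_const_mul]
        exact integral_mono (i2 hE) (hE.const_mul _) fun A =>
          mul_le_mul_of_nonneg_right (hm' A).2 (Real.exp_pos _).le
      calc _ ≤ (m * √(π / (1 / 8))) * (m * √(π / (1 / 8))) :=
            mul_le_mul j1 j2 (p2 fun s => (Real.exp_pos _).le) (by positivity)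
        _ = m ^ 2 * (√(π / (1 / 8)) * √(π / (1 / 8))) := by ring
        _ = m ^ 2 * (π / (1 / 8)) := by rw [Real.mul_self_sqrt (by positivity)]
        _ ≤ m ^ 2 * 26 := by
          gcongr
          linarith [Real.pi_lt_d2]
    have hmono := integral_mono_of_nonneg (μ := volume) (Filter.Eventually.of_forall fun A => by
        have q3 := (gaussDensity_pos A).le
        have q4 := (hm A).1
        have q5 : 0 ≤ ∫ B, f' B *
          ((ProbabilityTheory.gaussianPDFReal (τ * A) v B +
          ProbabilityTheory.gaussianPDFReal (τ * A) v (-B)) / 2) := p2 fun s => by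
            have q1 := ProbabilityTheory.gaussianPDFReal_nonneg (τ * A) v s
            have q2 := ProbabilityTheory.gaussianPDFReal_nonneg (τ * A) v (-s)
            positivity
        exact mul_nonneg q3 (mul_nonneg q4 q5))
      ((((i1 integrable_gaussDensity).mul_const (∫ B, f' B * gaussDensity B)).add
        (((i1 integrable_gaussWeight).mul_const (∫ B, f' B * gaussWeight B)).const_mul
          (3 * τ ^ 2))).add
        (((i1 hE).mul_const (∫ B, f' B * rexp (-(1 / 8) * B ^ 2))).const_mul (3 * 10 ^ 9 * τ ^ 8)))
      (Filter.Eventually.of_forall hinner)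
    refine hmono.trans ?_
    rw [integral_add' (((i1 integrable_gaussDensity).mul_const _).add
        (((i1 integrable_gaussWeight).mul_const _).const_mul _))
        (((i1 hE).mul_const _).const_mul _),
      integral_add' ((i1 integrable_gaussDensity).mul_const _)
        (((i1 integrable_gaussWeight).mul_const _).const_mul _),
      integral_const_mul, integral_const_mul, integral_mul_const, integral_mul_const,
      integral_mul_const]
    have h8 : 0 ≤ τ ^ 8 := by positivity
    have h9 := mul_le_mul_of_nonneg_left hJ h8
    have h10 : 0 ≤ m ^ 2 * τ ^ 8 := by positivity
    linarith
  · have h1 : ∫ p, f p.1 * f' (τ * p.1 + √(1 - τ ^ 2) * p.2)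
        ∂((ProbabilityTheory.gaussianReal 0 1).prod (ProbabilityTheory.gaussianReal 0 1)) ≤
        m ^ 2 := by
      have := norm_integral_le_of_norm_le_const (μ := (ProbabilityTheory.gaussianReal 0 1).prod
        (ProbabilityTheory.gaussianReal 0 1)) (Filter.Eventually.of_forall hbd)
      rw [probReal_univ, mul_one] at this
      exact (le_abs_self _).trans this
    have h2 : 1 / 256 ≤ τ ^ 8 := by
      have : τ ^ 8 = |τ| ^ 8 := by
        rw [show (8 : ℕ) = 2 * 4 from rfl, pow_mul, pow_mul, sq_abs]
      rw [this]
      calc (1 : ℝ) / 256 = (1 / 2) ^ 8 := by norm_num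
        _ ≤ _ := by gcongr
    have q1 := mul_nonneg (p1 fun s => (gaussDensity_pos s).le) (p2 fun s => (gaussDensity_pos s).le)
    have q2 := mul_nonneg (p1 gaussWeight_nonneg) (p2 gaussWeight_nonneg)
    have q3 : 0 ≤ 3 * τ ^ 2 * ((∫ A, f A * gaussWeight A) * (∫ A, f' A * gaussWeight A)) := by
      positivity
    have q4 := mul_le_mul_of_nonneg_left h2 (sq_nonneg m)
    nlinarith

variable {n : ℕ}

lemma gaussianReal_zero_sq (r : ℝ) {v : NNReal} (hv : (v : ℝ) = r ^ 2) :
    ProbabilityTheory.gaussianReal 0 v =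
      (ProbabilityTheory.gaussianReal 0 1).map (fun A => r * A) := by
  rw [ProbabilityTheory.gaussianReal_map_const_mul]
  congr 1
  · ring
  · ext
    rw [hv]; simp

/-- The weighted one-dimensional mean `∫ g(r_x A) (1 + A²) φ(A) dA` with `r_x = ‖x‖/√n`. -/
noncomputable def radialWeight (g : ℝ → ℝ) (x : EuclideanSpace ℝ (Fin n)) : ℝ :=
  ∫ A, g (‖x‖ / √n * A) * gaussWeight A

lemma integral_inner_sGauss {g : ℝ → ℝ} (hg : Measurable g) (x : EuclideanSpace ℝ (Fin n)) :
    ∫ Y, g ⟪x, Y⟫ ∂(sGauss n) = ∫ A, g (‖x‖ / √n * A) * gaussDensity A := by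
  have h1 : ∫ Y, g ⟪x, Y⟫ ∂(sGauss n) =
      ∫ s, g s ∂((sGauss n).map (fun Y => ⟪x, Y⟫)) := by
    rw [integral_map (by fun_prop) hg.aestronglyMeasurable]
  have h2 : (((‖x‖ ^ 2 / n).toNNReal : NNReal) : ℝ) = (‖x‖ / √n) ^ 2 := by
    rw [Real.coe_toNNReal _ (by positivity), div_pow, Real.sq_sqrt (by positivity)]
  rw [h1, map_inner_sGauss, gaussianReal_zero_sq _ h2,
    integral_map (by fun_prop) hg.aestronglyMeasurable,
    ProbabilityTheory.integral_gaussianReal_eq_integral_smul one_ne_zero]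
  simp only [smul_eq_mul, ← gaussDensity_eq_pdf]
  congr 1; ext A; ring

lemma integral_inner_mul_inner_le {g : ℝ → ℝ} (hg : Measurable g) (hge : ∀ s, g (-s) = g s)
    {m : ℝ} (hm : ∀ s, 0 ≤ g s ∧ g s ≤ m) {x x' : EuclideanSpace ℝ (Fin n)} (hx : x ≠ 0)
    (hx' : x' ≠ 0) {τ : ℝ} (hτ : τ = ⟪x, x'⟫ / (‖x‖ * ‖x'‖)) :
    ∫ Y, g ⟪x, Y⟫ * g ⟪x', Y⟫ ∂(sGauss n) ≤
      (∫ Y, g ⟪x, Y⟫ ∂(sGauss n)) * (∫ Y, g ⟪x', Y⟫ ∂(sGauss n)) +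
        3 * τ ^ 2 * (radialWeight g x * radialWeight g x') + 10 ^ 11 * m ^ 2 * τ ^ 8 := by
  have hx0 : 0 < ‖x‖ := norm_pos_iff.2 hx
  have hx0' : 0 < ‖x'‖ := norm_pos_iff.2 hx'
  have hτ1 : |τ| ≤ 1 := hτ ▸ abs_real_inner_div_norm_mul_norm_le_one x x'
  have hτ2 : τ ^ 2 ≤ 1 := by
    have := abs_le.1 hτ1
    nlinarith
  obtain ⟨c, hc⟩ : ∃ c, c = ⟪x, x'⟫ / ‖x‖ ^ 2 := ⟨_, rfl⟩
  obtain ⟨w, hw⟩ : ∃ w, w = x' - c • x := ⟨_, rfl⟩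
  have hxw : ⟪x, w⟫ = 0 := by
    rw [hw, inner_sub_right, inner_smul_right, real_inner_self_eq_norm_sq, hc]
    field_simp; ring
  have hwn : ‖w‖ ^ 2 = ‖x'‖ ^ 2 * (1 - τ ^ 2) := by
    rw [hw, norm_sub_sq_real, inner_smul_right, norm_smul, mul_pow, Real.norm_eq_abs, sq_abs,
      real_inner_comm, hc, hτ]
    field_simp; ring
  obtain ⟨r, hr⟩ : ∃ r, r = ‖x‖ / √n := ⟨_, rfl⟩
  obtain ⟨r', hr'⟩ : ∃ r', r' = ‖x'‖ / √n := ⟨_, rfl⟩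
  obtain ⟨s, hs⟩ : ∃ s, s = √(1 - τ ^ 2) := ⟨_, rfl⟩
  have hcr : c * r = r' * τ := by
    rw [hc, hr, hr', hτ]; field_simp
  have hlaw : (sGauss n).map (fun y => ((⟪x, y⟫ : ℝ), (⟪w, y⟫ : ℝ))) =
      ((ProbabilityTheory.gaussianReal 0 1).prod (ProbabilityTheory.gaussianReal 0 1)).map
        (Prod.map (fun A => r * A) (fun V => r' * s * V)) := by
    have v1 : (((‖x‖ ^ 2 / n).toNNReal : NNReal) : ℝ) = r ^ 2 := by
      rw [Real.coe_toNNReal _ (by positivity), hr, div_pow, Real.sq_sqrt (by positivity)]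
    have v2 : (((‖w‖ ^ 2 / n).toNNReal : NNReal) : ℝ) = (r' * s) ^ 2 := by
      rw [Real.coe_toNNReal _ (by positivity), hwn, hr', mul_pow, div_pow, hs,
        Real.sq_sqrt (by positivity), Real.sq_sqrt (by linarith)]
      ring
    rw [map_inner_pair_sGauss hxw, gaussianReal_zero_sq _ v1, gaussianReal_zero_sq _ v2,
      Measure.map_prod_map _ _ (by fun_prop) (by fun_prop)]
  have hG : Measurable fun p : ℝ × ℝ => g p.1 * g (c * p.1 + p.2) :=
    (hg.comp measurable_fst).mul (hg.comp (by fun_prop))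
  have hE : ∫ Y, g ⟪x, Y⟫ * g ⟪x', Y⟫ ∂(sGauss n) =
      ∫ p, g (r * p.1) * g (r' * (τ * p.1 + √(1 - τ ^ 2) * p.2))
        ∂((ProbabilityTheory.gaussianReal 0 1).prod (ProbabilityTheory.gaussianReal 0 1)) := by
    have e1 : ∫ Y, g ⟪x, Y⟫ * g ⟪x', Y⟫ ∂(sGauss n) =
        ∫ p, g p.1 * g (c * p.1 + p.2)
          ∂((sGauss n).map (fun y => ((⟪x, y⟫ : ℝ), (⟪w, y⟫ : ℝ)))) := by
      rw [integral_map (by fun_prop) hG.aestronglyMeasurable]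
      congr 1; ext Y
      have : ⟪x', Y⟫ = c * ⟪x, Y⟫ + ⟪w, Y⟫ := by
        rw [hw, inner_sub_left, real_inner_smul_left]; ring
      rw [this]
    rw [e1, hlaw, integral_map (by fun_prop) hG.aestronglyMeasurable]
    congr 1; ext p
    simp only [Prod.map_fst, Prod.map_snd]
    congr 2
    rw [← mul_assoc, hcr, hs]; ring
  rw [hE, integral_inner_sGauss hg, integral_inner_sGauss hg]
  have := gauss_correlation_le (f := fun A => g (r * A)) (f' := fun A => g (r' * A))
    (hg.comp (by fun_prop)) (hg.comp (by fun_prop))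
    (fun s => by rw [mul_neg, hge]) (fun s => hm _) (fun s => hm _) hτ1
  simpa only [radialWeight, ← hr, ← hr'] using this

/-- Second moment of a parametric integral as a double integral. -/
lemma integral_sq_integral {α β : Type*} [MeasurableSpace α] [MeasurableSpace β]
    (ν : Measure α) [IsFiniteMeasure ν] (ρ : Measure β) [IsFiniteMeasure ρ] {c : α → ℝ}
    (hc : Integrable c ν) {H : α → β → ℝ} (hH : Measurable (Function.uncurry H)) {m : ℝ}
    (hm : ∀ x y, |H x y| ≤ m) :
    ∫ y, (∫ x, c x * H x y ∂ν) ^ 2 ∂ρ =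
      ∫ p, c p.1 * c p.2 * (∫ y, H p.1 y * H p.2 y ∂ρ) ∂(ν.prod ν) := by
  have h1 : ∀ y, (∫ x, c x * H x y ∂ν) ^ 2 =
      ∫ p, (c p.1 * H p.1 y) * (c p.2 * H p.2 y) ∂(ν.prod ν) := by
    intro y
    rw [sq]
    exact (integral_prod_mul (fun x => c x * H x y) (fun x => c x * H x y)).symm
  simp_rw [h1]
  have hm' : ∀ x y, 0 ≤ m := fun x y => (abs_nonneg _).trans (hm x y)
  rw [integral_integral_swap]
  · congr 1; ext p
    rw [← integral_const_mul]
    congr 1; ext y; ring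
  · have h2 : Integrable (fun q : β × (α × α) => c q.2.1 * c q.2.2) (ρ.prod (ν.prod ν)) :=
      (hc.mul_prod hc).comp_snd ρ
    have h3 : Measurable fun q : β × (α × α) => H q.2.1 q.1 * H q.2.2 q.1 :=
      (hH.comp ((measurable_fst.comp measurable_snd).prodMk measurable_fst)).mul
        (hH.comp ((measurable_snd.comp measurable_snd).prodMk measurable_fst))
    refine (h2.bdd_mul h3.aestronglyMeasurable (c := m * m)
      (Filter.Eventually.of_forall fun q => ?_)).congr (Filter.Eventually.of_forall fun q => ?_)
    · rw [Real.norm_eq_abs, abs_mul]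
      exact mul_le_mul (hm _ _) (hm _ _) (abs_nonneg _) (hm' q.2.1 q.1)
    · simp only [Function.uncurry]; ring

/-- The test function `g(⟨x, Y⟩)`, centred over the Gaussian vector `Y`. -/
noncomputable def centred (g : ℝ → ℝ) (x Y : EuclideanSpace ℝ (Fin n)) : ℝ :=
  g ⟪x, Y⟫ - ∫ Y, g ⟪x, Y⟫ ∂(sGauss n)

section
variable {g : ℝ → ℝ} {m : ℝ}

lemma measurable_inner_comp (hg : Measurable g) :
    Measurable fun p : EuclideanSpace ℝ (Fin n) × EuclideanSpace ℝ (Fin n) => g ⟪p.1, p.2⟫ :=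
  hg.comp (by fun_prop)

lemma measurable_integral_inner (hg : Measurable g) :
    Measurable fun x : EuclideanSpace ℝ (Fin n) => ∫ Y, g ⟪x, Y⟫ ∂(sGauss n) :=
  ((measurable_inner_comp hg).stronglyMeasurable.integral_prod_right).measurable

lemma measurable_centred (hg : Measurable g) :
    Measurable (Function.uncurry (centred (n := n) g)) :=
  (measurable_inner_comp hg).sub ((measurable_integral_inner hg).comp measurable_fst)

lemma integrable_inner_sGauss (hg : Measurable g) (hm : ∀ s, 0 ≤ g s ∧ g s ≤ m)
    (x : EuclideanSpace ℝ (Fin n)) : Integrable (fun Y => g ⟪x, Y⟫) (sGauss n) :=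
  Integrable.of_bound (hg.comp (by fun_prop)).aestronglyMeasurable m
    (Filter.Eventually.of_forall fun Y => by
      rw [Real.norm_eq_abs, abs_of_nonneg (hm _).1]; exact (hm _).2)

lemma integral_inner_bounds (hg : Measurable g) (hm : ∀ s, 0 ≤ g s ∧ g s ≤ m)
    (x : EuclideanSpace ℝ (Fin n)) :
    0 ≤ ∫ Y, g ⟪x, Y⟫ ∂(sGauss n) ∧ ∫ Y, g ⟪x, Y⟫ ∂(sGauss n) ≤ m := by
  refine ⟨integral_nonneg fun Y => (hm _).1, ?_⟩
  have := integral_mono (integrable_inner_sGauss hg hm x) (integrable_const m) fun Y => (hm _).2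
  simpa using this

lemma abs_centred_le (hg : Measurable g) (hm : ∀ s, 0 ≤ g s ∧ g s ≤ m)
    (x Y : EuclideanSpace ℝ (Fin n)) : |centred g x Y| ≤ m := by
  have h1 := integral_inner_bounds hg hm x
  have h2 := hm ⟪x, Y⟫
  rw [centred, abs_le]
  constructor <;> linarith

lemma integral_centred_mul (hg : Measurable g) (hm : ∀ s, 0 ≤ g s ∧ g s ≤ m)
    (x x' : EuclideanSpace ℝ (Fin n)) :
    ∫ Y, centred g x Y * centred g x' Y ∂(sGauss n) =
      ∫ Y, g ⟪x, Y⟫ * g ⟪x', Y⟫ ∂(sGauss n) -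
        (∫ Y, g ⟪x, Y⟫ ∂(sGauss n)) * (∫ Y, g ⟪x', Y⟫ ∂(sGauss n)) := by
  have i1 := integrable_inner_sGauss hg hm x
  have i2 := integrable_inner_sGauss hg hm x'
  have i3 : Integrable (fun Y => g ⟪x, Y⟫ * g ⟪x', Y⟫) (sGauss n) :=
    i2.bdd_mul i1.aestronglyMeasurable (c := m) (Filter.Eventually.of_forall fun Y => by
      rw [Real.norm_eq_abs, abs_of_nonneg (hm _).1]; exact (hm _).2)
  obtain ⟨a, ha⟩ : ∃ a, a = ∫ Y, g ⟪x, Y⟫ ∂(sGauss n) := ⟨_, rfl⟩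
  obtain ⟨b, hb⟩ : ∃ b, b = ∫ Y, g ⟪x', Y⟫ ∂(sGauss n) := ⟨_, rfl⟩
  have e : (fun Y => centred g x Y * centred g x' Y) = fun Y =>
      ((g ⟪x, Y⟫ * g ⟪x', Y⟫ - b * g ⟪x, Y⟫) - a * g ⟪x', Y⟫) + a * b := by
    ext Y; simp only [centred, ← ha, ← hb]; ring
  have j1 : Integrable (fun Y => g ⟪x, Y⟫ * g ⟪x', Y⟫ - b * g ⟪x, Y⟫) (sGauss n) :=
    i3.sub (i1.const_mul b)
  have j2 : Integrable (fun Y => (g ⟪x, Y⟫ * g ⟪x', Y⟫ - b * g ⟪x, Y⟫) - a * g ⟪x', Y⟫)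
    (sGauss n) := j1.sub (i2.const_mul a)
  rw [e, integral_add j2 (integrable_const _), integral_sub j1 (i2.const_mul a),
    integral_sub i3 (i1.const_mul b), integral_const_mul, integral_const_mul, ← ha, ← hb]
  simp; ring

lemma radialWeight_nonneg (hm : ∀ s, 0 ≤ g s ∧ g s ≤ m) (x : EuclideanSpace ℝ (Fin n)) :
    0 ≤ radialWeight g x :=
  integral_nonneg fun A => mul_nonneg (hm _).1 (gaussWeight_nonneg A)

lemma integrable_mul_gaussWeight (hg : Measurable g) (hm : ∀ s, 0 ≤ g s ∧ g s ≤ m) (r : ℝ) :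
    Integrable fun A => g (r * A) * gaussWeight A :=
  integrable_gaussWeight.bdd_mul (hg.comp (by fun_prop)).aestronglyMeasurable (c := m)
    (Filter.Eventually.of_forall fun Y => by
      rw [Real.norm_eq_abs, abs_of_nonneg (hm _).1]; exact (hm _).2)

lemma radialWeight_le (hg : Measurable g) (hm : ∀ s, 0 ≤ g s ∧ g s ≤ m)
    (x : EuclideanSpace ℝ (Fin n)) : radialWeight g x ≤ m * ∫ A, gaussWeight A := by
  rw [radialWeight, ← integral_const_mul]
  exact integral_mono (integrable_mul_gaussWeight hg hm _) (integrable_gaussWeight.const_mul m)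
    fun A => mul_le_mul_of_nonneg_right (hm _).2 (gaussWeight_nonneg A)

lemma measurable_radialWeight (hg : Measurable g) :
    Measurable (radialWeight (n := n) g) := by
  have : Measurable fun p : EuclideanSpace ℝ (Fin n) × ℝ =>
      g (‖p.1‖ / √n * p.2) * gaussWeight p.2 :=
    (hg.comp (by fun_prop)).mul (continuous_gaussWeight.measurable.comp measurable_snd)
  exact (this.stronglyMeasurable.integral_prod_right).measurable

lemma integrable_mul_radialWeight (hg : Measurable g) (hm : ∀ s, 0 ≤ g s ∧ g s ≤ m)
    {ν : Measure (EuclideanSpace ℝ (Fin n))} {c : EuclideanSpace ℝ (Fin n) → ℝ}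
    (hc : Integrable c ν) : Integrable (fun x => c x * radialWeight g x) ν := by
  refine (hc.bdd_mul (measurable_radialWeight hg).aestronglyMeasurable
    (c := m * ∫ A, gaussWeight A) (Filter.Eventually.of_forall fun Y => ?_)).congr
    (Filter.Eventually.of_forall fun x => mul_comm _ _)
  rw [Real.norm_eq_abs, abs_of_nonneg (radialWeight_nonneg hm _)]
  exact radialWeight_le hg hm _

lemma integrable_inner_pow {ν : Measure (EuclideanSpace ℝ (Fin n))} (k : ℕ)
    (hint : Integrable (fun x => ‖x‖ ^ k) ν) {θ : EuclideanSpace ℝ (Fin n)} (hθ : ‖θ‖ ≤ 1) :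
    Integrable (fun x => ⟪x, θ⟫ ^ k) ν := by
  refine hint.mono' (by fun_prop) (Filter.Eventually.of_forall fun x => ?_)
  rw [norm_pow, Real.norm_eq_abs]
  gcongr
  refine (abs_real_inner_le_norm x θ).trans ?_
  nlinarith [norm_nonneg x]

lemma integral_centred_mul_le (hg : Measurable g) (hge : ∀ s, g (-s) = g s)
    (hm : ∀ s, 0 ≤ g s ∧ g s ≤ m) {ν : Measure (EuclideanSpace ℝ (Fin n))} [IsFiniteMeasure ν]
    {ρ C W W' N : ℝ} (hρ : 0 < ρ) (hνρ : ∀ᵐ x ∂ν, ρ ≤ ‖x‖ ^ 2) (k : ℕ)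
    (hint : ∀ j : ℕ, Integrable (fun x => ‖x‖ ^ j) ν)
    (hC : ∀ θ, ‖θ‖ = 1 → ∫ x, ⟪x, θ⟫ ^ (2 * k + 8) ∂ν ≤ C)
    (hW : ∀ θ, ‖θ‖ = 1 → ∫ x, ⟪x, θ⟫ ^ (2 * k + 2) * radialWeight g x ∂ν ≤ W)
    (hW' : ∫ x, ‖x‖ ^ (2 * k) * radialWeight g x ∂ν ≤ W')
    (hN : ∫ x, ‖x‖ ^ (2 * k) ∂ν ≤ N) (hW0 : 0 ≤ W) (hC0 : 0 ≤ C) :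
    ∫ p, ⟪p.1, p.2⟫ ^ (2 * k) * (∫ Y, centred g p.1 Y * centred g p.2 Y ∂(sGauss n))
        ∂(ν.prod ν) ≤
      3 / ρ * W * W' + 10 ^ 11 * m ^ 2 * C * N / ρ ^ 4 := by
  have hm0 : 0 ≤ m := (hm 0).1.trans (hm 0).2
  obtain ⟨B, hB⟩ : ∃ B : EuclideanSpace ℝ (Fin n) × EuclideanSpace ℝ (Fin n) → ℝ,
      B = fun p => ‖p.2‖ ^ (2 * k) * radialWeight g p.2 * (3 / ρ) *
        (⟪p.1, ‖p.2‖⁻¹ • p.2⟫ ^ (2 * k + 2) * radialWeight g p.1) +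
        ‖p.2‖ ^ (2 * k) * (10 ^ 11 * m ^ 2 / ρ ^ 4) * ⟪p.1, ‖p.2‖⁻¹ • p.2⟫ ^ (2 * k + 8) :=
    ⟨_, rfl⟩
  have hGm := measurable_radialWeight (n := n) hg
  have hinn : Measurable fun p : EuclideanSpace ℝ (Fin n) × EuclideanSpace ℝ (Fin n) =>
      (⟪p.1, ‖p.2‖⁻¹ • p.2⟫ : ℝ) := by
    have h1 : Measurable fun p : EuclideanSpace ℝ (Fin n) × EuclideanSpace ℝ (Fin n) =>
        ‖p.2‖⁻¹ • p.2 := measurable_normalize.comp measurable_snd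
    exact measurable_fst.inner h1
  have hnorm1 : ∀ y : EuclideanSpace ℝ (Fin n), ‖‖y‖⁻¹ • y‖ ≤ 1 := by
    intro y
    rw [norm_smul, norm_inv, norm_norm]
    exact inv_mul_le_one
  have hinn_le : ∀ p : EuclideanSpace ℝ (Fin n) × EuclideanSpace ℝ (Fin n),
      |(⟪p.1, ‖p.2‖⁻¹ • p.2⟫ : ℝ)| ≤ ‖p.1‖ := by
    intro p
    refine (abs_real_inner_le_norm _ _).trans ?_
    nlinarith [norm_nonneg p.1, hnorm1 p.2]
  have hBint : Integrable B (ν.prod ν) := by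
    rw [hB]
    have hpow : ∀ (a b : ℕ), Integrable (fun p : EuclideanSpace ℝ (Fin n) ×
        EuclideanSpace ℝ (Fin n) => ⟪p.1, ‖p.2‖⁻¹ • p.2⟫ ^ b * ‖p.2‖ ^ a) (ν.prod ν) := by
      intro a b
      refine ((hint b).mul_prod (hint a)).mono' ?_ (Filter.Eventually.of_forall fun p => ?_)
      · exact ((hinn.pow_const b).mul (by fun_prop)).aestronglyMeasurable
      · rw [norm_mul, norm_pow, norm_pow, norm_norm, Real.norm_eq_abs]
        gcongr
        exact hinn_le p
    have hGb : ∀ x, ‖radialWeight (n := n) g x‖ ≤ m * ∫ A, gaussWeight A := fun x => by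
      rw [Real.norm_eq_abs, abs_of_nonneg (radialWeight_nonneg hm _)]
      exact radialWeight_le hg hm _
    refine Integrable.add ?_ ?_
    · have h1 := (hpow (2 * k) (2 * k + 2)).bdd_mul
        (hGm.comp measurable_fst).aestronglyMeasurable
        (Filter.Eventually.of_forall fun p => hGb p.1)
      have h2 := h1.bdd_mul (hGm.comp measurable_snd).aestronglyMeasurable
        (Filter.Eventually.of_forall fun p => hGb p.2)
      refine (h2.const_mul (3 / ρ)).congr (Filter.Eventually.of_forall fun p => ?_)
      simp only [Function.comp]; ring
    · refine ((hpow (2 * k) (2 * k + 8)).const_mul (10 ^ 11 * m ^ 2 / ρ ^ 4)).congr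
        (Filter.Eventually.of_forall fun p => ?_)
      simp only; ring
  have hcov : Integrable (fun p : EuclideanSpace ℝ (Fin n) × EuclideanSpace ℝ (Fin n) =>
      ⟪p.1, p.2⟫ ^ (2 * k) * (∫ Y, centred g p.1 Y * centred g p.2 Y ∂(sGauss n)))
      (ν.prod ν) := by
    have hmeas : Measurable fun p : EuclideanSpace ℝ (Fin n) × EuclideanSpace ℝ (Fin n) =>
        ∫ Y, centred g p.1 Y * centred g p.2 Y ∂(sGauss n) := by
      have hH := measurable_centred (n := n) hg
      have h3 : Measurable fun q : (EuclideanSpace ℝ (Fin n) × EuclideanSpace ℝ (Fin n)) ×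
          EuclideanSpace ℝ (Fin n) => centred g q.1.1 q.2 * centred g q.1.2 q.2 :=
        (hH.comp ((measurable_fst.comp measurable_fst).prodMk measurable_snd)).mul
          (hH.comp ((measurable_snd.comp measurable_fst).prodMk measurable_snd))
      exact (h3.stronglyMeasurable.integral_prod_right).measurable
    refine (((hint (2 * k)).mul_prod (hint (2 * k))).mul_const (m * m)).mono'
      ((Measurable.mul (by fun_prop) hmeas).aestronglyMeasurable)
      (Filter.Eventually.of_forall fun p => ?_)
    rw [norm_mul, norm_pow, Real.norm_eq_abs]
    have h1 : |(⟪p.1, p.2⟫ : ℝ)| ^ (2 * k) ≤ ‖p.1‖ ^ (2 * k) * ‖p.2‖ ^ (2 * k) := by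
      rw [← mul_pow]; gcongr; exact abs_real_inner_le_norm _ _
    have h2 : ‖∫ Y, centred g p.1 Y * centred g p.2 Y ∂(sGauss n)‖ ≤ m * m := by
      have := norm_integral_le_of_norm_le_const (μ := sGauss n) (C := m * m)
        (f := fun Y => centred g p.1 Y * centred g p.2 Y)
        (Filter.Eventually.of_forall fun Y => by
          rw [Real.norm_eq_abs, abs_mul]
          exact mul_le_mul (abs_centred_le hg hm _ _) (abs_centred_le hg hm _ _)
            (abs_nonneg _) hm0)
      simpa using this
    gcongr
  have hae1 : ∀ᵐ p ∂(ν.prod ν), ρ ≤ ‖p.1‖ ^ 2 :=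
    Measure.quasiMeasurePreserving_fst.ae hνρ
  have hae2 : ∀ᵐ p ∂(ν.prod ν), ρ ≤ ‖p.2‖ ^ 2 :=
    Measure.quasiMeasurePreserving_snd.ae hνρ
  have hle : ∫ p, ⟪p.1, p.2⟫ ^ (2 * k) *
      (∫ Y, centred g p.1 Y * centred g p.2 Y ∂(sGauss n)) ∂(ν.prod ν) ≤
      ∫ p, B p ∂(ν.prod ν) := by
    refine integral_mono_ae hcov hBint ?_
    filter_upwards [hae1, hae2] with p h1 h2
    have hp1 : p.1 ≠ 0 := fun h => by rw [h] at h1; norm_num at h1; linarith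
    have hp2 : p.2 ≠ 0 := fun h => by rw [h] at h2; norm_num at h2; linarith
    have hn1 : 0 < ‖p.1‖ := norm_pos_iff.2 hp1
    have hn2 : 0 < ‖p.2‖ := norm_pos_iff.2 hp2
    obtain ⟨y, hy⟩ : ∃ y : ℝ, y = ⟪p.1, ‖p.2‖⁻¹ • p.2⟫ := ⟨_, rfl⟩
    have hpy : (⟪p.1, p.2⟫ : ℝ) = ‖p.2‖ * y := by
      rw [hy, real_inner_smul_right]; field_simp
    have hτy : (⟪p.1, p.2⟫ : ℝ) / (‖p.1‖ * ‖p.2‖) = y / ‖p.1‖ := by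
      rw [hpy]; field_simp
    have hc := integral_inner_mul_inner_le hg hge hm hp1 hp2 hτy.symm
    have ht2 : (y / ‖p.1‖) ^ 2 ≤ y ^ 2 / ρ := by
      rw [div_pow]; gcongr
    have ht8 : (y / ‖p.1‖) ^ 8 ≤ y ^ 8 / ρ ^ 4 := by
      rw [div_pow, show ‖p.1‖ ^ 8 = (‖p.1‖ ^ 2) ^ 4 by ring]; gcongr
    have hG1 := radialWeight_nonneg hm p.1
    have hG2 := radialWeight_nonneg hm p.2
    rw [hB]
    simp only [← hy]
    rw [integral_centred_mul hg hm, hpy]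
    have h3 : ∫ Y, g ⟪p.1, Y⟫ * g ⟪p.2, Y⟫ ∂(sGauss n) -
        (∫ Y, g ⟪p.1, Y⟫ ∂(sGauss n)) * (∫ Y, g ⟪p.2, Y⟫ ∂(sGauss n)) ≤
        3 * (y ^ 2 / ρ) * (radialWeight g p.1 * radialWeight g p.2) +
          10 ^ 11 * m ^ 2 * (y ^ 8 / ρ ^ 4) := by
      have q1 := mul_le_mul_of_nonneg_right ht2 (mul_nonneg hG1 hG2)
      have q2 := mul_le_mul_of_nonneg_left ht8 (sq_nonneg m)
      linarith
    have hev : 0 ≤ (‖p.2‖ * y) ^ (2 * k) := by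
      rw [pow_mul]; positivity
    refine (mul_le_mul_of_nonneg_left h3 hev).trans (le_of_eq ?_)
    rw [mul_pow, pow_add y (2 * k) 2, pow_add y (2 * k) 8]
    ring
  refine hle.trans ?_
  rw [integral_prod_symm _ hBint]
  have hinner : ∀ᵐ x' ∂ν, ∫ x, B (x, x') ∂ν ≤
      3 / ρ * W * (‖x'‖ ^ (2 * k) * radialWeight g x') +
        10 ^ 11 * m ^ 2 * C / ρ ^ 4 * ‖x'‖ ^ (2 * k) := by
    filter_upwards [hνρ] with x' hx'
    have hx0 : x' ≠ 0 := fun h => by rw [h] at hx'; norm_num at hx'; linarith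
    have hu : ‖‖x'‖⁻¹ • x'‖ = 1 := by
      rw [norm_smul, norm_inv, norm_norm, inv_mul_cancel₀ (norm_ne_zero_iff.2 hx0)]
    have i1 := integrable_inner_pow (2 * k + 2) (hint _) hu.le
    have i2 := integrable_inner_pow (2 * k + 8) (hint _) hu.le
    simp only [hB]
    rw [integral_add ((integrable_mul_radialWeight hg hm i1).const_mul _) (i2.const_mul _),
      integral_const_mul, integral_const_mul]
    have hG := radialWeight_nonneg hm x'
    have a1 : 0 ≤ ‖x'‖ ^ (2 * k) * radialWeight g x' * (3 / ρ) := by positivity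
    have a2 : 0 ≤ ‖x'‖ ^ (2 * k) * (10 ^ 11 * m ^ 2 / ρ ^ 4) := by positivity
    refine (add_le_add (mul_le_mul_of_nonneg_left (hW _ hu) a1)
      (mul_le_mul_of_nonneg_left (hC _ hu) a2)).trans (le_of_eq ?_)
    ring
  have i3 := integrable_mul_radialWeight hg hm (hint (2 * k))
  refine (integral_mono_ae hBint.integral_prod_right
    ((i3.const_mul _).add ((hint (2 * k)).const_mul _)) hinner).trans ?_
  rw [integral_add' (i3.const_mul _) ((hint (2 * k)).const_mul _), integral_const_mul,
    integral_const_mul]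
  have b1 : 0 ≤ 3 / ρ * W := by positivity
  have b2 : 0 ≤ 10 ^ 11 * m ^ 2 * C / ρ ^ 4 := by positivity
  refine (add_le_add (mul_le_mul_of_nonneg_left hW' b1)
    (mul_le_mul_of_nonneg_left hN b2)).trans (le_of_eq ?_)
  ring

end

variable {n : ℕ}

/-- Half the indicator of `{|s| ≥ t}`. -/
noncomputable def evenTail (t s : ℝ) : ℝ := if t ≤ |s| then 1 / 2 else 0

lemma measurable_evenTail (t : ℝ) : Measurable (evenTail t) :=
  Measurable.ite (measurableSet_le measurable_const (by fun_prop)) measurable_const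
    measurable_const

lemma evenTail_neg (t s : ℝ) : evenTail t (-s) = evenTail t s := by simp [evenTail]

lemma evenTail_bounds (t s : ℝ) : 0 ≤ evenTail t s ∧ evenTail t s ≤ 1 / 2 := by
  unfold evenTail; split_ifs <;> norm_num

/-- The resolvent-type even weight `1 / (h² + (|s| - t)²)`. -/
noncomputable def levelWeight (h t s : ℝ) : ℝ := (h ^ 2 + (|s| - t) ^ 2)⁻¹

lemma measurable_levelWeight (h t : ℝ) : Measurable (levelWeight h t) := by
  unfold levelWeight; fun_prop

lemma levelWeight_neg (h t s : ℝ) : levelWeight h t (-s) = levelWeight h t s := by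
  simp [levelWeight]

lemma levelWeight_bounds {h : ℝ} (hh : 0 < h) (t s : ℝ) :
    0 ≤ levelWeight h t s ∧ levelWeight h t s ≤ (h ^ 2)⁻¹ := by
  unfold levelWeight
  refine ⟨by positivity, ?_⟩
  gcongr
  nlinarith [sq_nonneg (|s| - t)]

variable {ν : Measure (EuclideanSpace ℝ (Fin n))}

lemma marginalTail_eq_evenTail [IsFiniteMeasure ν] (hν : Measure.IsEven ν)
    (Z : EuclideanSpace ℝ (Fin n)) {t : ℝ} (ht : 0 < t) :
    marginalTail ν Z t = ∫ x, evenTail t ⟪x, Z⟫ ∂ν := by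
  have hm2 : MeasurableSet {x : EuclideanSpace ℝ (Fin n) | t ≤ ⟪x, Z⟫} :=
    measurableSet_le measurable_const (by fun_prop)
  have h1 : ν.real {x | -x ∈ {x : EuclideanSpace ℝ (Fin n) | t ≤ ⟪x, Z⟫}} =
      marginalTail ν Z t := measureReal_neg hν hm2
  have h2 : Disjoint {x : EuclideanSpace ℝ (Fin n) | t ≤ ⟪x, Z⟫}
      {x | -x ∈ {x : EuclideanSpace ℝ (Fin n) | t ≤ ⟪x, Z⟫}} := by
    rw [Set.disjoint_left]
    intro x hx hx'
    simp only [Set.mem_ofPred_eq, inner_neg_left] at hx hx'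
    linarith
  have h3 := measureReal_union (μ := ν) h2 (measurable_neg hm2)
  have h4 : (fun x => evenTail t ⟪x, Z⟫) = Set.indicator
      ({x : EuclideanSpace ℝ (Fin n) | t ≤ ⟪x, Z⟫} ∪
        {x | -x ∈ {x : EuclideanSpace ℝ (Fin n) | t ≤ ⟪x, Z⟫}}) (fun _ => (1 / 2 : ℝ)) := by
    ext x
    simp only [evenTail, Set.indicator_apply, Set.mem_union, Set.mem_ofPred_eq, inner_neg_left,
      le_abs]
  rw [h4, integral_indicator_const _ (show MeasurableSet
    ({x : EuclideanSpace ℝ (Fin n) | t ≤ ⟪x, Z⟫} ∪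
      {x | -x ∈ {x : EuclideanSpace ℝ (Fin n) | t ≤ ⟪x, Z⟫}}) from
    hm2.union (measurable_neg hm2)), h3, h1, smul_eq_mul]
  change _ = (marginalTail ν Z t + _) * _
  ring

section step
variable [IsFiniteMeasure ν] (hint : ∀ j : ℕ, Integrable (fun x => ‖x‖ ^ j) ν)
include hint

omit [IsFiniteMeasure ν] in
lemma integrable_inner_pow_two (w : EuclideanSpace ℝ (Fin n)) :
    Integrable (fun x => ⟪x, w⟫ ^ 2) ν := by
  refine ((hint 2).mul_const (‖w‖ ^ 2)).mono' (by fun_prop)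
    (Filter.Eventually.of_forall fun x => ?_)
  rw [norm_pow, Real.norm_eq_abs, ← mul_pow]
  gcongr
  exact abs_real_inner_le_norm x w

lemma integrable_levelWeight_mul {h : ℝ} (hh : 0 < h) (t : ℝ)
    (Y w : EuclideanSpace ℝ (Fin n)) :
    Integrable (fun x => levelWeight h t ⟪x, Y⟫ * ⟪x, w⟫ ^ 2) ν :=
  (integrable_inner_pow_two hint w).bdd_mul
    ((measurable_levelWeight h t).comp (by fun_prop)).aestronglyMeasurable (c := (h ^ 2)⁻¹)
    (Filter.Eventually.of_forall fun x => by
      have := levelWeight_bounds hh t ⟪x, Y⟫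
      change ‖levelWeight h t ⟪x, Y⟫‖ ≤ _
      rw [Real.norm_eq_abs, abs_of_nonneg this.1]; exact this.2)

lemma real_level_crossing_le {h t : ℝ} (hh : 0 < h) (Y w : EuclideanSpace ℝ (Fin n))
    {E : Set (EuclideanSpace ℝ (Fin n))}
    (hE : ∀ x ∈ E, h + |(⟪x, Y⟫ : ℝ) - t| ≤ |(⟪x, w⟫ : ℝ)|) (ht : 0 ≤ t) :
    ν.real E ≤ ∫ x, levelWeight h t ⟪x, Y⟫ * ⟪x, w⟫ ^ 2 ∂ν := by
  have hmk := mul_meas_ge_le_integral_of_nonneg (μ := ν)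
    (f := fun x => levelWeight h t ⟪x, Y⟫ * ⟪x, w⟫ ^ 2)
    (Filter.Eventually.of_forall fun x =>
      mul_nonneg (levelWeight_bounds hh t _).1 (sq_nonneg _))
    (integrable_levelWeight_mul hint hh t Y w) 1
  rw [one_mul] at hmk
  refine le_trans (measureReal_mono (fun x hx => ?_) (measure_ne_top _ _)) hmk
  have h1 := hE x hx
  simp only [Set.mem_ofPred_eq, levelWeight]
  have h3 : |(|(⟪x, Y⟫ : ℝ)| - t)| ≤ |(⟪x, Y⟫ : ℝ) - t| := by
    have := abs_abs_sub_abs_le (⟪x, Y⟫ : ℝ) t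
    rwa [abs_of_nonneg ht] at this
  rw [inv_mul_eq_div, le_div_iff₀ (by positivity), one_mul, ← sq_abs (⟪x, w⟫ : ℝ),
    ← sq_abs (|(⟪x, Y⟫ : ℝ)| - t)]
  have h4 := abs_nonneg (|(⟪x, Y⟫ : ℝ)| - t)
  nlinarith

lemma marginalTail_add_le_integral {h t : ℝ} (hh : 0 < h) (ht : 0 ≤ t)
    (Y Z : EuclideanSpace ℝ (Fin n)) :
    marginalTail ν Z (t + h) ≤ marginalTail ν Y t +
      ∫ x, levelWeight h t ⟪x, Y⟫ * ⟪x, Z - Y⟫ ^ 2 ∂ν := by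
  have h2 : marginalTail ν Z (t + h) ≤
      ν.real ({x | t ≤ ⟪x, Y⟫} ∪ {x | (⟪x, Y⟫ : ℝ) < t ∧ t + h ≤ ⟪x, Z⟫}) := by
    apply measureReal_mono _ (measure_ne_top _ _)
    intro x hx
    simp only [Set.mem_ofPred_eq, Set.mem_union] at hx ⊢
    rcases le_or_gt t ⟪x, Y⟫ with h | h
    · exact Or.inl h
    · exact Or.inr ⟨h, hx⟩
  refine h2.trans ((measureReal_union_le _ _).trans (add_le_add le_rfl
    (real_level_crossing_le hint hh Y (Z - Y) ?_ ht)))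
  rintro x ⟨h3, h4⟩
  rw [inner_sub_right, abs_of_neg (by linarith), abs_of_nonneg (by linarith)]
  linarith

lemma marginalTail_le_sub_integral {h t : ℝ} (hh : 0 < h) (ht : 0 ≤ t)
    (Y Z : EuclideanSpace ℝ (Fin n)) :
    marginalTail ν Y t ≤ marginalTail ν Z (t - h) +
      ∫ x, levelWeight h t ⟪x, Y⟫ * ⟪x, Z - Y⟫ ^ 2 ∂ν := by
  have h2 : marginalTail ν Y t ≤
      ν.real ({x | t - h ≤ ⟪x, Z⟫} ∪ {x | t ≤ ⟪x, Y⟫ ∧ (⟪x, Z⟫ : ℝ) < t - h}) := by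
    apply measureReal_mono _ (measure_ne_top _ _)
    intro x hx
    simp only [Set.mem_ofPred_eq, Set.mem_union] at hx ⊢
    rcases le_or_gt (t - h) ⟪x, Z⟫ with h | h
    · exact Or.inl h
    · exact Or.inr ⟨hx, h⟩
  refine h2.trans ((measureReal_union_le _ _).trans (add_le_add le_rfl
    (real_level_crossing_le hint hh Y (Z - Y) ?_ ht)))
  rintro x ⟨h3, h4⟩
  rw [inner_sub_right, abs_of_nonneg (by linarith), abs_of_neg (by linarith)]
  linarith

end step

/-- Squared Hilbert–Schmidt norm of the centred weighted second-moment matrix. -/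
noncomputable def hsDeviation (ν : Measure (EuclideanSpace ℝ (Fin n))) (g : ℝ → ℝ)
    (Y : EuclideanSpace ℝ (Fin n)) : ℝ :=
  ∑ i, ∑ j, (∫ x, (x i * x j) * centred g x Y ∂ν) ^ 2

section quad
variable [IsFiniteMeasure ν] (hint : ∀ j : ℕ, Integrable (fun x => ‖x‖ ^ j) ν)
  {g : ℝ → ℝ} {m : ℝ}

omit [IsFiniteMeasure ν] in
include hint in
lemma integrable_coord_mul (i j : Fin n) : Integrable (fun x => x i * x j) ν := by
  refine (hint 2).mono' (by fun_prop) (Filter.Eventually.of_forall fun x => ?_)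
  rw [norm_mul, sq]
  exact mul_le_mul (PiLp.norm_apply_le x i) (PiLp.norm_apply_le x j)
    (norm_nonneg _) (norm_nonneg _)

lemma inner_eq_sum (x w : EuclideanSpace ℝ (Fin n)) : (⟪x, w⟫ : ℝ) = ∑ i, x i * w i := by
  simp [PiLp.inner_apply, mul_comm]

lemma inner_sq_eq_sum (x w : EuclideanSpace ℝ (Fin n)) :
    (⟪x, w⟫ : ℝ) ^ 2 = ∑ i, ∑ j, (w i * w j) * (x i * x j) := by
  rw [inner_eq_sum, sq, Finset.sum_mul_sum]
  exact Finset.sum_congr rfl fun i _ => Finset.sum_congr rfl fun j _ => by ring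

omit [IsFiniteMeasure ν] in
lemma integrable_mul_centred (hg : Measurable g) (hm : ∀ s, 0 ≤ g s ∧ g s ≤ m)
    {c : EuclideanSpace ℝ (Fin n) → ℝ} (hc : Integrable c ν) (Y : EuclideanSpace ℝ (Fin n)) :
    Integrable (fun x => c x * centred g x Y) ν := by
  refine (hc.bdd_mul (f := fun x => centred g x Y) (c := m) ?_
    (Filter.Eventually.of_forall fun x => ?_)).congr
    (Filter.Eventually.of_forall fun x => mul_comm _ _)
  · exact ((measurable_centred hg).comp (measurable_id.prodMk measurable_const)).aestronglyMeasurable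
  · rw [Real.norm_eq_abs]; exact abs_centred_le hg hm x Y

include hint in
lemma integral_centred_quad_le (hg : Measurable g) (hm : ∀ s, 0 ≤ g s ∧ g s ≤ m)
    (Y w : EuclideanSpace ℝ (Fin n)) :
    ∫ x, ⟪x, w⟫ ^ 2 * centred g x Y ∂ν ≤ ‖w‖ ^ 2 * √(hsDeviation ν g Y) := by
  have h1 : ∫ x, ⟪x, w⟫ ^ 2 * centred g x Y ∂ν =
      ∑ p : Fin n × Fin n, (w p.1 * w p.2) * ∫ x, (x p.1 * x p.2) * centred g x Y ∂ν := by
    simp_rw [← integral_const_mul]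
    rw [← integral_finsetSum]
    · congr 1; ext x
      rw [inner_sq_eq_sum, ← Finset.univ_product_univ, Finset.sum_product, Finset.sum_mul]
      refine Finset.sum_congr rfl fun i _ => ?_
      rw [Finset.sum_mul]
      exact Finset.sum_congr rfl fun j _ => by ring
    · intro p _
      exact (integrable_mul_centred hg hm (integrable_coord_mul hint p.1 p.2) Y).const_mul _
  rw [h1]
  refine (Real.sum_mul_le_sqrt_mul_sqrt _ _ _).trans (le_of_eq ?_)
  have h2 : ∑ p : Fin n × Fin n, (w p.1 * w p.2) ^ 2 = (‖w‖ ^ 2) ^ 2 := by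
    rw [EuclideanSpace.real_norm_sq_eq, sq (∑ i, w i ^ 2), Finset.sum_mul_sum,
      ← Finset.univ_product_univ, Finset.sum_product]
    exact Finset.sum_congr rfl fun i _ => Finset.sum_congr rfl fun j _ => by ring
  rw [h2, Real.sqrt_sq (by positivity), hsDeviation, ← Finset.univ_product_univ,
    Finset.sum_product]

lemma integral_inner_le_radialWeight (hg : Measurable g) (hm : ∀ s, 0 ≤ g s ∧ g s ≤ m)
    (x : EuclideanSpace ℝ (Fin n)) : ∫ Y, g ⟪x, Y⟫ ∂(sGauss n) ≤ radialWeight g x := by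
  rw [integral_inner_sGauss hg, radialWeight]
  refine integral_mono ?_ (integrable_mul_gaussWeight hg hm _) fun A => ?_
  · exact integrable_gaussDensity.bdd_mul (hg.comp (by fun_prop)).aestronglyMeasurable (c := m)
      (Filter.Eventually.of_forall fun Y => by
        rw [Real.norm_eq_abs, abs_of_nonneg (hm _).1]; exact (hm _).2)
  · refine mul_le_mul_of_nonneg_left ?_ (hm _).1
    have := (gaussDensity_pos A).le
    rw [gaussWeight]; nlinarith [sq_nonneg A, mul_nonneg (sq_nonneg A) this]

include hint in
lemma integral_quad_le (hg : Measurable g) (hm : ∀ s, 0 ≤ g s ∧ g s ≤ m) {W : ℝ}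
    (hW : ∀ θ, ‖θ‖ = 1 → ∫ x, ⟪x, θ⟫ ^ 2 * radialWeight g x ∂ν ≤ W)
    (Y w : EuclideanSpace ℝ (Fin n)) :
    ∫ x, g ⟪x, Y⟫ * ⟪x, w⟫ ^ 2 ∂ν ≤ ‖w‖ ^ 2 * (√(hsDeviation ν g Y) + W) := by
  rcases eq_or_ne w 0 with rfl | hw
  · simp
  have hw0 : 0 < ‖w‖ := norm_pos_iff.2 hw
  have i1 := integrable_mul_centred hg hm (integrable_inner_pow_two hint w) Y
  have i2 := integrable_mul_radialWeight hg hm (integrable_inner_pow_two hint w)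
  have hle : ∀ x : EuclideanSpace ℝ (Fin n), g ⟪x, Y⟫ * ⟪x, w⟫ ^ 2 ≤
      ⟪x, w⟫ ^ 2 * centred g x Y + ⟪x, w⟫ ^ 2 * radialWeight g x := by
    intro x
    rw [centred]
    nlinarith [mul_le_mul_of_nonneg_left (integral_inner_le_radialWeight hg hm x)
      (sq_nonneg (⟪x, w⟫ : ℝ))]
  have h1 := integral_mono_of_nonneg (μ := ν)
    (f := fun x => g ⟪x, Y⟫ * ⟪x, w⟫ ^ 2) (Filter.Eventually.of_forall fun x =>
      mul_nonneg (hm _).1 (sq_nonneg _)) (i1.add i2) (Filter.Eventually.of_forall hle)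
  rw [integral_add' i1 i2] at h1
  have h2 := integral_centred_quad_le hint hg hm Y w
  have h3 := hW (‖w‖⁻¹ • w) (by
    rw [norm_smul, norm_inv, norm_norm, inv_mul_cancel₀ hw0.ne'])
  have h4 : ∫ x, ⟪x, w⟫ ^ 2 * radialWeight g x ∂ν =
      ‖w‖ ^ 2 * ∫ x, ⟪x, ‖w‖⁻¹ • w⟫ ^ 2 * radialWeight g x ∂ν := by
    rw [← integral_const_mul]
    congr 1; ext x
    rw [real_inner_smul_right]; field_simp
  rw [h4] at h1
  have h5 := mul_le_mul_of_nonneg_left h3 (sq_nonneg ‖w‖)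
  rw [mul_add]; linarith

lemma measurable_hsDeviation (hg : Measurable g) : Measurable (hsDeviation ν g) := by
  unfold hsDeviation
  refine Finset.measurable_sum _ fun i _ => Finset.measurable_sum _ fun j _ => ?_
  have : Measurable fun p : EuclideanSpace ℝ (Fin n) × EuclideanSpace ℝ (Fin n) =>
      (p.2 i * p.2 j) * centred g p.2 p.1 :=
    Measurable.mul (by fun_prop)
      ((measurable_centred hg).comp (measurable_snd.prodMk measurable_fst))
  exact (this.stronglyMeasurable.integral_prod_right).measurable.pow_const 2

omit [IsFiniteMeasure ν] in
lemma hsDeviation_nonneg (Y : EuclideanSpace ℝ (Fin n)) : 0 ≤ hsDeviation ν g Y :=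
  Finset.sum_nonneg fun _ _ => Finset.sum_nonneg fun _ _ => sq_nonneg _

lemma integrable_sq_integral_centred (hg : Measurable g) (hm : ∀ s, 0 ≤ g s ∧ g s ≤ m)
    {c : EuclideanSpace ℝ (Fin n) → ℝ} (hcm : Measurable c) (hc : Integrable c ν) :
    Integrable (fun Y => (∫ x, c x * centred g x Y ∂ν) ^ 2) (sGauss n) := by
  have hmeas : Measurable fun p : EuclideanSpace ℝ (Fin n) × EuclideanSpace ℝ (Fin n) =>
      c p.2 * centred g p.2 p.1 :=
    (hcm.comp measurable_snd).mul ((measurable_centred hg).comp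
      (measurable_snd.prodMk measurable_fst))
  refine Integrable.of_bound
    ((hmeas.stronglyMeasurable.integral_prod_right).measurable.pow_const 2).aestronglyMeasurable
    ((∫ x, ‖c x‖ * m ∂ν) ^ 2) (Filter.Eventually.of_forall fun Y => ?_)
  rw [norm_pow]
  gcongr
  refine norm_integral_le_of_norm_le (hc.norm.mul_const m)
    (Filter.Eventually.of_forall fun x => ?_)
  rw [norm_mul]
  gcongr
  rw [Real.norm_eq_abs]
  exact abs_centred_le hg hm x Y

omit [IsFiniteMeasure ν] in
lemma integrable_mul_integral_centred (hg : Measurable g) (hm : ∀ s, 0 ≤ g s ∧ g s ≤ m)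
    {c : EuclideanSpace ℝ (Fin n) → ℝ} (hc : Integrable c ν) :
    Integrable (fun p : EuclideanSpace ℝ (Fin n) × EuclideanSpace ℝ (Fin n) => c p.1 * c p.2 *
      (∫ Y, centred g p.1 Y * centred g p.2 Y ∂(sGauss n))) (ν.prod ν) := by
  have hm0 : 0 ≤ m := (hm 0).1.trans (hm 0).2
  have hH := measurable_centred (n := n) hg
  have h3 : Measurable fun q : (EuclideanSpace ℝ (Fin n) × EuclideanSpace ℝ (Fin n)) ×
      EuclideanSpace ℝ (Fin n) => centred g q.1.1 q.2 * centred g q.1.2 q.2 :=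
    (hH.comp ((measurable_fst.comp measurable_fst).prodMk measurable_snd)).mul
      (hH.comp ((measurable_snd.comp measurable_fst).prodMk measurable_snd))
  have hmeas : Measurable fun p : EuclideanSpace ℝ (Fin n) × EuclideanSpace ℝ (Fin n) =>
      ∫ Y, centred g p.1 Y * centred g p.2 Y ∂(sGauss n) :=
    (h3.stronglyMeasurable.integral_prod_right').measurable
  refine ((hc.mul_prod hc).bdd_mul hmeas.aestronglyMeasurable (c := m * m)
    (Filter.Eventually.of_forall fun p => ?_)).congr
    (Filter.Eventually.of_forall fun p => mul_comm _ _)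
  have := norm_integral_le_of_norm_le_const (μ := sGauss n) (C := m * m)
    (f := fun Y => centred g p.1 Y * centred g p.2 Y)
    (Filter.Eventually.of_forall fun Y => by
      rw [Real.norm_eq_abs, abs_mul]
      exact mul_le_mul (abs_centred_le hg hm _ _) (abs_centred_le hg hm _ _)
        (abs_nonneg _) hm0)
  simpa using this

include hint in
lemma integral_hsDeviation (hg : Measurable g) (hm : ∀ s, 0 ≤ g s ∧ g s ≤ m) :
    Integrable (hsDeviation ν g) (sGauss n) ∧ ∫ Y, hsDeviation ν g Y ∂(sGauss n) =
      ∫ p, ⟪p.1, p.2⟫ ^ 2 * (∫ Y, centred g p.1 Y * centred g p.2 Y ∂(sGauss n))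
        ∂(ν.prod ν) := by
  have hI : ∀ i j : Fin n, Integrable (fun Y => (∫ x, (x i * x j) * centred g x Y ∂ν) ^ 2)
      (sGauss n) := fun i j =>
    integrable_sq_integral_centred hg hm (by fun_prop) (integrable_coord_mul hint i j)
  have hJ : ∀ i j : Fin n, Integrable (fun p : EuclideanSpace ℝ (Fin n) ×
      EuclideanSpace ℝ (Fin n) => (p.1 i * p.1 j) * (p.2 i * p.2 j) *
      (∫ Y, centred g p.1 Y * centred g p.2 Y ∂(sGauss n))) (ν.prod ν) := fun i j =>
    integrable_mul_integral_centred hg hm (integrable_coord_mul hint i j)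
  unfold hsDeviation
  refine ⟨integrable_finsetSum _ fun i _ => integrable_finsetSum _ fun j _ => hI i j, ?_⟩
  rw [integral_finsetSum _ fun i _ => integrable_finsetSum _ fun j _ => hI i j]
  simp_rw [integral_finsetSum _ fun j _ => hI _ j,
    integral_sq_integral ν (sGauss n) (integrable_coord_mul hint _ _) (measurable_centred hg)
      (fun x y => abs_centred_le hg hm x y)]
  simp_rw [← integral_finsetSum _ fun j _ => hJ _ j]
  rw [← integral_finsetSum _ fun i _ => integrable_finsetSum _ fun j _ => hJ i j]
  congr 1; ext p
  rw [inner_sq_eq_sum, Finset.sum_mul]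
  refine Finset.sum_congr rfl fun i _ => ?_
  rw [Finset.sum_mul]
  exact Finset.sum_congr rfl fun j _ => by ring

end quad

lemma half_sub_le_gaussTail {t : ℝ} (ht : 0 ≤ t) : 1 / 2 - 2 / 5 * t ≤ gaussTail t := by
  have h1 := gaussTail_sub 0 t
  have h2 : ‖∫ x in (0 : ℝ)..t, gaussDensity x‖ ≤ 2 / 5 * |t - 0| :=
    intervalIntegral.norm_integral_le_of_norm_le_const fun x _ => by
      rw [Real.norm_eq_abs, abs_of_pos (gaussDensity_pos x)]; exact gaussDensity_le x
  rw [sub_zero, abs_of_nonneg ht] at h2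
  have h3 := le_abs_self (∫ x in (0 : ℝ)..t, gaussDensity x)
  rw [Real.norm_eq_abs] at h2
  rw [gaussTail_zero] at h1
  linarith

lemma gaussDensity_eq_mul_exp (s : ℝ) :
    gaussDensity s = gaussDensity (0.1 * s) * rexp (-0.495 * s ^ 2) := by
  unfold gaussDensity
  rw [div_mul_eq_mul_div, ← Real.exp_add]
  congr 2; ring

/-- The coefficient making `s ↦ Φᶜ(s/10) - λ Φᶜ(s)` critical at `s = 1`. -/
noncomputable def gapCoeff : ℝ := 0.1 * rexp 0.495

lemma gapCoeff_bounds : 0 < gapCoeff ∧ gapCoeff ≤ 0.175 := by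
  unfold gapCoeff
  refine ⟨by positivity, ?_⟩
  have h1 : rexp (1 : ℝ) < 2.7182818286 := Real.exp_one_lt_d9
  have h2 : rexp 0.495 ≤ rexp (1 / 2) := Real.exp_le_exp.2 (by norm_num)
  have h3 : rexp (1 / 2) * rexp (1 / 2) = rexp 1 := by rw [← Real.exp_add]; norm_num
  have h4 : rexp (1 / 2) ≤ 1.7 := by
    by_contra! h
    nlinarith
  linarith

/-- Test function of the inverse radius, with strict maximum at `1`. -/
noncomputable def gapFun (s : ℝ) : ℝ := gaussTail (0.1 * s) - gapCoeff * gaussTail s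

lemma hasDerivAt_gapFun (s : ℝ) :
    HasDerivAt gapFun (0.1 * gaussDensity (0.1 * s) * (rexp (0.495 * (1 - s ^ 2)) - 1)) s := by
  have h1 : HasDerivAt (fun s : ℝ => 0.1 * s) 0.1 s := by
    simpa using (hasDerivAt_id s).const_mul (0.1 : ℝ)
  have h2 := ((hasDerivAt_gaussTail (0.1 * s)).comp s h1).sub
    ((hasDerivAt_gaussTail s).const_mul gapCoeff)
  refine h2.congr_deriv ?_
  rw [gaussDensity_eq_mul_exp s, gapCoeff,
    show 0.495 * (1 - s ^ 2) = 0.495 + -0.495 * s ^ 2 by ring, Real.exp_add]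
  ring

lemma gaussDensity_five : 0.0000003 ≤ gaussDensity 5 := by
  unfold gaussDensity
  have h1 : rexp (1 : ℝ) < 2.7182818286 := Real.exp_one_lt_d9
  have h2 : (rexp 1) ^ 13 = rexp 13 := by rw [← Real.exp_nat_mul]; norm_num
  have h3 : rexp 13 ≤ 10 ^ 6 := by
    rw [← h2]
    calc (rexp 1) ^ 13 ≤ (2.7182818286 : ℝ) ^ 13 := by gcongr
      _ ≤ _ := by norm_num
  have h4 : 0.000001 ≤ rexp (-5 ^ 2 / 2) := by
    calc (0.000001 : ℝ) = (10 ^ 6)⁻¹ := by norm_num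
      _ ≤ (rexp 13)⁻¹ := by gcongr
      _ = rexp (-13) := (Real.exp_neg _).symm
      _ ≤ _ := Real.exp_le_exp.2 (by norm_num)
  have h5 := sqrt_two_pi_bounds
  calc (0.0000003 : ℝ) ≤ (2.51)⁻¹ * 0.000001 := by norm_num
    _ ≤ (√(2 * π))⁻¹ * rexp (-5 ^ 2 / 2) := by gcongr; exact h5.2
    _ = _ := inv_mul_eq_div _ _

lemma gapFun_one_sub_ge {s : ℝ} (hs : 0 ≤ s) (hs' : s ≤ 50) :
    0.00000000001 * (1 - s) ^ 2 ≤ gapFun 1 - gapFun s := by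
  have hd : ∀ x, HasDerivAt (fun s => gapFun s + 0.00000000001 * (1 - s) ^ 2)
      (0.1 * gaussDensity (0.1 * x) * (rexp (0.495 * (1 - x ^ 2)) - 1) - 0.00000000002 * (1 - x)) x := by
    intro x
    have h1 : HasDerivAt (fun s : ℝ => (0.00000000001 : ℝ) * (1 - s) ^ 2) (-(0.00000000002 * (1 - x))) x := by
      refine ((((hasDerivAt_id x).const_sub 1).pow 2).const_mul (0.00000000001 : ℝ)).congr_deriv ?_
      simp; ring
    exact ((hasDerivAt_gapFun x).add h1).congr_deriv (by ring)
  have hphi : ∀ x, 0 ≤ x → x ≤ 50 → 0.0000003 ≤ gaussDensity (0.1 * x) := fun x h0 h1 =>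
    gaussDensity_five.trans (gaussDensity_antitoneOn (Set.mem_Ici.2 (by positivity))
      (Set.mem_Ici.2 (by norm_num)) (by linarith))
  suffices h : gapFun s + 0.00000000001 * (1 - s) ^ 2 ≤ gapFun 1 + 0.00000000001 * (1 - 1) ^ 2 by
    linarith [show (0.00000000001 : ℝ) * (1 - 1) ^ 2 = 0 by norm_num]
  rcases le_total s 1 with h | h
  · refine monotoneOn_of_deriv_nonneg (D := Set.Icc 0 1)
      (f := fun s => gapFun s + 0.00000000001 * (1 - s) ^ 2) (convex_Icc 0 1)
      (fun x _ => (hd x).continuousAt.continuousWithinAt)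
      (fun x _ => (hd x).differentiableAt.differentiableWithinAt) (fun x hx => ?_)
      ⟨hs, h⟩ ⟨zero_le_one, le_rfl⟩ h
    rw [interior_Icc] at hx
    rw [(hd x).deriv]
    have h1 := hphi x hx.1.le (by linarith [hx.2])
    have h2 := Real.add_one_le_exp (0.495 * (1 - x ^ 2))
    have h3 : 0.495 * (1 - x) ≤ rexp (0.495 * (1 - x ^ 2)) - 1 := by nlinarith [hx.1, hx.2]
    have h4 : 0 ≤ 0.495 * (1 - x) := by linarith [hx.2]
    nlinarith [mul_le_mul h1 h3 h4 (by linarith)]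
  · refine antitoneOn_of_deriv_nonpos (D := Set.Icc 1 50)
      (f := fun s => gapFun s + 0.00000000001 * (1 - s) ^ 2) (convex_Icc 1 50)
      (fun x _ => (hd x).continuousAt.continuousWithinAt)
      (fun x _ => (hd x).differentiableAt.differentiableWithinAt) (fun x hx => ?_)
      ⟨le_rfl, by norm_num⟩ ⟨h, hs'⟩ h
    rw [interior_Icc] at hx
    rw [(hd x).deriv]
    have h1 := hphi x (by linarith [hx.1]) hx.2.le
    have h2 : rexp (0.495 * (1 - x ^ 2)) * (1 + 0.495 * (x ^ 2 - 1)) ≤ 1 := by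
      rw [show 0.495 * (1 - x ^ 2) = -(0.495 * (x ^ 2 - 1)) by ring, Real.exp_neg,
        inv_mul_le_iff₀ (Real.exp_pos _), mul_one]
      linarith [Real.add_one_le_exp (0.495 * (x ^ 2 - 1))]
    have hx1 := hx.1
    have hx2 := hx.2
    have h3 : 0.0007 * (x - 1) ≤ 1 - rexp (0.495 * (1 - x ^ 2)) := by
      have h5 : 1 + 0.495 * (x ^ 2 - 1) ≤ 1240 := by nlinarith
      have h6 : 0.99 * (x - 1) ≤ 0.495 * (x ^ 2 - 1) := by nlinarith
      have h7 : 0 ≤ rexp (0.495 * (1 - x ^ 2)) := (Real.exp_pos _).le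
      by_contra! h8
      have h9 : 0 ≤ (x ^ 2 - 1) := by nlinarith
      nlinarith
    have h4 : 0 ≤ 0.0007 * (x - 1) := by linarith
    nlinarith [mul_le_mul h1 h3 h4 (by linarith)]

lemma gapFun_one_sub_ge_of_large {s : ℝ} (hs : 50 ≤ s) : 3 / 10 ≤ gapFun 1 - gapFun s := by
  have h1 := half_sub_le_gaussTail (t := 0.1) (by norm_num)
  have h2 := gaussTail_le_half (t := 1) (by norm_num)
  have h3 := gapCoeff_bounds
  have h4 : gaussTail (0.1 * s) ≤ gaussTail 5 := gaussTail_anti (by linarith)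
  have h5 := gaussTail_le_exp (t := 5) (by norm_num)
  have h6 : rexp (-5 ^ 2 / 2) ≤ 1 / 50 := by
    rw [show (-5 ^ 2 / 2 : ℝ) = -(12.5) by norm_num, Real.exp_neg, ← one_div]
    apply one_div_le_one_div_of_le (by norm_num)
    have := Real.quadratic_le_exp_of_nonneg (x := (12.5 : ℝ)) (by norm_num)
    linarith
  have h7 := gaussTail_pos s
  have h8 := gaussTail_pos 1
  have h9 : 0.46 ≤ gaussTail 0.1 := by linarith
  unfold gapFun
  rw [mul_one]
  have h10 : gapCoeff * gaussTail 1 ≤ 0.175 * (1 / 2) :=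
    mul_le_mul h3.2 h2 h8.le (by norm_num)
  have h11 := mul_pos h3.1 h7
  linarith

lemma measurable_scaledTail (t : ℝ) : Measurable fun r => scaledTail r t := by
  unfold scaledTail
  exact Measurable.ite (measurableSet_singleton 0) measurable_const
    (gaussTail_anti.measurable.comp (by fun_prop))

lemma scaledTail_le_one (r t : ℝ) : scaledTail r t ≤ 1 := by
  unfold scaledTail; split_ifs
  · exact zero_le_one
  · exact (gaussTail_lt_one _).le

variable {n : ℕ} {μ : Measure (EuclideanSpace ℝ (Fin n))}

lemma integrable_scaledTail [IsFiniteMeasure μ] (t : ℝ) :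
    Integrable (fun x => scaledTail (‖x‖ / √n) t) μ :=
  Integrable.of_bound ((measurable_scaledTail t).comp (by fun_prop)).aestronglyMeasurable 1
    (Filter.Eventually.of_forall fun x => by
      change ‖scaledTail (‖x‖ / √n) t‖ ≤ 1
      rw [Real.norm_eq_abs, abs_of_nonneg (scaledTail_nonneg _ _)]
      exact scaledTail_le_one _ _)

/-- The deficit of the test function at radius `r`. -/
noncomputable def gapDeficit (r : ℝ) : ℝ :=
  gapFun 1 - (scaledTail r 0.1 - gapCoeff * scaledTail r 1)

lemma gapDeficit_of_pos {r : ℝ} (hr : 0 < r) : gapDeficit r = gapFun 1 - gapFun r⁻¹ := by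
  rw [gapDeficit, scaledTail, scaledTail, if_neg hr.ne', if_neg hr.ne', gapFun, gapFun,
    one_div, div_eq_mul_inv]

lemma gapDeficit_small {r : ℝ} (hr : 0 ≤ r) (hr' : r < 1 / 50) : 3 / 10 ≤ gapDeficit r := by
  rcases hr.eq_or_lt with rfl | h
  · have := gapFun_one_sub_ge_of_large (s := 50) le_rfl
    have h1 := half_sub_le_gaussTail (t := 0.1) (by norm_num)
    have h2 := gaussTail_le_half (t := 1) (by norm_num)
    have h3 := gapCoeff_bounds
    have h8 := gaussTail_pos 1
    simp only [gapDeficit, scaledTail, if_true, gapFun, mul_one]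
    have h9 : 0.46 ≤ gaussTail 0.1 := by linarith
    nlinarith
  · rw [gapDeficit_of_pos h]
    apply gapFun_one_sub_ge_of_large
    rw [le_inv_comm₀ (by norm_num) h]
    linarith

lemma gapDeficit_large {r η : ℝ} (hr : 1 / 50 ≤ r) (hη : 0 < η) (hη1 : η ≤ 1)
    (h : η ≤ |r - 1|) : 0.00000000001 * (η ^ 2 / 4) ≤ gapDeficit r := by
  have hr0 : 0 < r := by linarith
  rw [gapDeficit_of_pos hr0]
  refine le_trans ?_ (gapFun_one_sub_ge (s := r⁻¹) (by positivity) ?_)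
  · have h1 : η / 2 ≤ |1 - r⁻¹| := by
      have h2 : |1 - r⁻¹| = |r - 1| / r := by
        rw [← abs_of_pos hr0, ← abs_div, abs_of_pos hr0]; congr 1; field_simp
      rw [h2]
      rw [le_div_iff₀ hr0]
      rcases le_total r 2 with h3 | h3
      · nlinarith
      · rw [abs_of_nonneg (by linarith)]; nlinarith
    rw [← sq_abs (1 - r⁻¹)]
    nlinarith
  · rw [inv_le_comm₀ hr0 (by norm_num)]; linarith

lemma gapDeficit_nonneg {r : ℝ} (hr : 0 ≤ r) : 0 ≤ gapDeficit r := by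
  rcases lt_or_ge r (1 / 50) with h | h
  · linarith [gapDeficit_small hr h]
  · have hr0 : 0 < r := by linarith
    rw [gapDeficit_of_pos hr0]
    refine le_trans ?_ (gapFun_one_sub_ge (s := r⁻¹) (by positivity) ?_)
    · positivity
    · rw [inv_le_comm₀ hr0 (by norm_num)]; linarith

section rigidity
variable [IsProbabilityMeasure μ] {ε : ℝ}
  (h1 : |∫ x, scaledTail (‖x‖ / √n) 0.1 ∂μ - gaussTail 0.1| ≤ 2 * ε * gaussTail 0.1)
  (h2 : |∫ x, scaledTail (‖x‖ / √n) 1 ∂μ - gaussTail 1| ≤ 2 * ε * gaussTail 1)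

lemma integrable_gapDeficit : Integrable (fun x => gapDeficit (‖x‖ / √n)) μ :=
  (integrable_const _).sub ((integrable_scaledTail _).sub ((integrable_scaledTail _).const_mul _))

include h1 h2

lemma integral_gapDeficit_le (hε : 0 ≤ ε) : ∫ x, gapDeficit (‖x‖ / √n) ∂μ ≤ 6 / 5 * ε := by
  have e : ∫ x, gapDeficit (‖x‖ / √n) ∂μ = gapFun 1 -
      (∫ x, scaledTail (‖x‖ / √n) 0.1 ∂μ - gapCoeff * ∫ x, scaledTail (‖x‖ / √n) 1 ∂μ) := by
    have i1 : Integrable (fun x => scaledTail (‖x‖ / √n) 0.1 -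
        gapCoeff * scaledTail (‖x‖ / √n) 1) μ :=
      (integrable_scaledTail _).sub ((integrable_scaledTail _).const_mul _)
    unfold gapDeficit
    rw [integral_sub (integrable_const _) i1, integral_sub (integrable_scaledTail _)
      ((integrable_scaledTail _).const_mul _), integral_const_mul]
    simp
  rw [e, gapFun, mul_one]
  have h3 := gapCoeff_bounds
  have h4 := gaussTail_le_half (t := 1) (by norm_num)
  have h5 := gaussTail_le_half (t := 0.1) (by norm_num)
  rw [abs_le] at h1 h2
  have h6 : gapCoeff * (∫ x, scaledTail (‖x‖ / √n) 1 ∂μ - gaussTail 1) ≤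
      0.175 * (2 * ε * gaussTail 1) :=
    (mul_le_mul_of_nonneg_left h2.2 h3.1.le).trans (mul_le_mul_of_nonneg_right h3.2
      (by have := gaussTail_pos 1; positivity))
  nlinarith [h1.1]

lemma real_small_radius_le (hε : 0 ≤ ε) : μ.real {x | ‖x‖ / √n < 1 / 50} ≤ 4 * ε := by
  have h := mul_meas_ge_le_integral_of_nonneg (μ := μ)
    (f := fun x => gapDeficit (‖x‖ / √n))
    (Filter.Eventually.of_forall fun x => gapDeficit_nonneg (by positivity))
    integrable_gapDeficit (3 / 10)
  have h3 := integral_gapDeficit_le h1 h2 hε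
  have h4 : μ.real {x | ‖x‖ / √n < 1 / 50} ≤ μ.real {x | 3 / 10 ≤ gapDeficit (‖x‖ / √n)} :=
    measureReal_mono (fun x hx => gapDeficit_small (by positivity) hx) (measure_ne_top _ _)
  linarith

lemma real_off_band_le (hε : 0 ≤ ε) {η : ℝ} (hη : 0 < η) (hη1 : η ≤ 1) :
    μ.real {x | 1 / 50 ≤ ‖x‖ / √n ∧ η ≤ |‖x‖ / √n - 1|} ≤ 10 ^ 12 * ε / η ^ 2 := by
  have h := mul_meas_ge_le_integral_of_nonneg (μ := μ)
    (f := fun x => gapDeficit (‖x‖ / √n))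
    (Filter.Eventually.of_forall fun x => gapDeficit_nonneg (by positivity))
    integrable_gapDeficit (0.00000000001 * (η ^ 2 / 4))
  have h3 := integral_gapDeficit_le h1 h2 hε
  have h4 : μ.real {x | 1 / 50 ≤ ‖x‖ / √n ∧ η ≤ |‖x‖ / √n - 1|} ≤
      μ.real {x | 0.00000000001 * (η ^ 2 / 4) ≤ gapDeficit (‖x‖ / √n)} :=
    measureReal_mono (fun x hx => gapDeficit_large hx.1 hη hη1 hx.2) (measure_ne_top _ _)
  rw [le_div_iff₀ (by positivity)]
  nlinarith [mul_le_mul_of_nonneg_left h4 (by positivity : (0 : ℝ) ≤ 0.00000000001 * (η ^ 2 / 4))]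

end rigidity

section moments

lemma measure_lt_abs_inner_le {n : ℕ} {μ : Measure (EuclideanSpace ℝ (Fin n))}
    [IsProbabilityMeasure μ] {C₀ c₀ : ℝ} (hμ : HasPsiOneMarginals μ C₀ c₀)
    {θ : EuclideanSpace ℝ (Fin n)} (hθ : ‖θ‖ = 1) {t : ℝ} (ht : 0 ≤ t) :
    μ {x | t < |(⟪x, θ⟫ : ℝ)|} ≤ ENNReal.ofReal (2 * C₀ * rexp (-c₀ * t)) := by
  have h1 := hμ θ hθ t ht
  have h2 := hμ (-θ) (by rwa [norm_neg]) t ht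
  rw [← ENNReal.ofReal_toReal (measure_ne_top μ _)]
  apply ENNReal.ofReal_le_ofReal
  have h3 : (μ {x | t < |(⟪x, θ⟫ : ℝ)|}).toReal ≤
      μ.real ({x | t < ⟪x, θ⟫} ∪ {x | t < ⟪x, -θ⟫}) := by
    refine measureReal_mono (fun x hx => ?_) (measure_ne_top _ _)
    simpa [lt_abs, inner_neg_right] using hx
  have h4 := measureReal_union_le (μ := μ) {x | t < ⟪x, θ⟫} {x | t < ⟪x, -θ⟫}
  have h5 : μ.real {x | t < ⟪x, θ⟫} ≤ C₀ * rexp (-c₀ * t) := h1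
  have h6 : μ.real {x | t < ⟪x, -θ⟫} ≤ C₀ * rexp (-c₀ * t) := h2
  linarith

lemma exists_moment_bound {C₀ c₀ : ℝ} (hC : 0 < C₀) (hc : 0 < c₀) (k : ℕ) :
    ∃ M : ℝ, 1 ≤ M ∧ ∀ {n : ℕ} (μ : Measure (EuclideanSpace ℝ (Fin n))), IsProbabilityMeasure μ →
      HasPsiOneMarginals μ C₀ c₀ → ∀ θ, ‖θ‖ = 1 →
      Integrable (fun x => ⟪x, θ⟫ ^ (2 * k)) μ ∧ ∫ x, ⟪x, θ⟫ ^ (2 * k) ∂μ ≤ M := by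
  rcases Nat.eq_zero_or_pos k with rfl | hk
  · refine ⟨1, le_rfl, fun μ _ _ θ _ => ?_⟩
    simp
  obtain ⟨p, hp⟩ : ∃ p : ℝ, p = ((2 * k : ℕ) : ℝ) := ⟨_, rfl⟩
  have hp0 : 0 < p := by rw [hp]; positivity
  obtain ⟨K, hK⟩ : ∃ K, K = p * (2 * C₀ * ((1 / c₀) ^ p * Gamma p)) := ⟨_, rfl⟩
  have hK0 : 0 ≤ K := by have := Gamma_pos_of_pos hp0; rw [hK]; positivity
  have hint0 : IntegrableOn (fun t : ℝ => t ^ (p - 1) * rexp (-(c₀ * t))) (Set.Ioi 0) := by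
    have := integrableOn_rpow_mul_exp_neg_mul_rpow (p := 1) (s := p - 1) (b := c₀)
      (by linarith) one_pos hc
    simpa using this
  refine ⟨K + 1, by linarith, fun {n} μ _ hμ θ hθ => ?_⟩
  have hmeas : Measurable fun x : EuclideanSpace ℝ (Fin n) => |(⟪x, θ⟫ : ℝ)| := by fun_prop
  have e0 : ∀ x : EuclideanSpace ℝ (Fin n), |(⟪x, θ⟫ : ℝ)| ^ p = ⟪x, θ⟫ ^ (2 * k) := by
    intro x
    rw [hp, Real.rpow_natCast, Even.pow_abs ⟨k, two_mul k⟩]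
  have h1 := lintegral_rpow_eq_lintegral_meas_lt_mul μ
    (Filter.Eventually.of_forall fun x : EuclideanSpace ℝ (Fin n) => abs_nonneg (⟪x, θ⟫ : ℝ))
    hmeas.aemeasurable hp0
  have h2 : ∫⁻ t in Set.Ioi (0 : ℝ), μ {x | t < |(⟪x, θ⟫ : ℝ)|} * ENNReal.ofReal (t ^ (p - 1)) ≤
      ENNReal.ofReal (2 * C₀ * ((1 / c₀) ^ p * Gamma p)) := by
    rw [← integral_rpow_mul_exp_neg_mul_Ioi hp0 hc, ← integral_const_mul,
      ofReal_integral_eq_lintegral_ofReal (hint0.const_mul _)]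
    · refine setLIntegral_mono' measurableSet_Ioi fun t ht => ?_
      have ht' : (0 : ℝ) < t := ht
      refine (mul_le_mul_left (measure_lt_abs_inner_le hμ hθ ht'.le) _).trans (le_of_eq ?_)
      rw [← ENNReal.ofReal_mul (by positivity)]
      congr 1
      rw [neg_mul]; ring
    · refine (ae_restrict_mem measurableSet_Ioi).mono fun t ht => ?_
      have ht' : (0 : ℝ) < t := ht
      change 0 ≤ 2 * C₀ * (t ^ (p - 1) * rexp (-(c₀ * t)))
      positivity
  have h3 : ∫⁻ x, ENNReal.ofReal (⟪x, θ⟫ ^ (2 * k)) ∂μ ≤ ENNReal.ofReal K := by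
    simp_rw [← e0]
    rw [h1, hK, ENNReal.ofReal_mul hp0.le]
    gcongr
  have hnn : ∀ x : EuclideanSpace ℝ (Fin n), (0 : ℝ) ≤ ⟪x, θ⟫ ^ (2 * k) := fun x =>
    Even.pow_nonneg ⟨k, two_mul k⟩ _
  have hm : Measurable fun x : EuclideanSpace ℝ (Fin n) => (⟪x, θ⟫ : ℝ) ^ (2 * k) := by fun_prop
  refine ⟨⟨hm.aestronglyMeasurable, ?_⟩, ?_⟩
  · rw [hasFiniteIntegral_iff_ofReal (Filter.Eventually.of_forall hnn)]
    exact h3.trans_lt ENNReal.ofReal_lt_top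
  · rw [integral_eq_lintegral_of_nonneg_ae (Filter.Eventually.of_forall hnn)
      hm.aestronglyMeasurable]
    have := ENNReal.toReal_mono ENNReal.ofReal_ne_top h3
    rw [ENNReal.toReal_ofReal hK0] at this
    linarith

variable {n : ℕ} {μ : Measure (EuclideanSpace ℝ (Fin n))}

lemma inner_single_eq (x : EuclideanSpace ℝ (Fin n)) (i : Fin n) :
    (⟪x, EuclideanSpace.single i (1 : ℝ)⟫ : ℝ) = x i := by
  simp [EuclideanSpace.inner_single_right]

lemma norm_sq_eq_sum_inner (x : EuclideanSpace ℝ (Fin n)) :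
    ‖x‖ ^ 2 = ∑ i, (⟪x, EuclideanSpace.single i (1 : ℝ)⟫ : ℝ) ^ 2 := by
  rw [EuclideanSpace.real_norm_sq_eq]
  simp_rw [inner_single_eq]

lemma norm_single_one (i : Fin n) : ‖EuclideanSpace.single i (1 : ℝ)‖ = 1 := by simp

lemma integrable_norm_pow [IsFiniteMeasure μ]
    (h : ∀ (k : ℕ) θ, ‖θ‖ = 1 → Integrable (fun x => ⟪x, θ⟫ ^ (2 * k)) μ) (j : ℕ) :
    Integrable (fun x => ‖x‖ ^ j) μ := by
  have hI : Integrable (fun x => (n : ℝ) ^ j *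
      ∑ i, (⟪x, EuclideanSpace.single i (1 : ℝ)⟫ : ℝ) ^ (2 * (j + 1))) μ :=
    (integrable_finsetSum _ fun i _ => h (j + 1) _ (norm_single_one i)).const_mul _
  refine ((integrable_const (1 : ℝ)).add hI).mono' (by fun_prop) (Filter.Eventually.of_forall fun x => ?_)
  rw [norm_pow, norm_norm]
  change _ ≤ 1 + (n : ℝ) ^ j *
      ∑ i, (⟪x, EuclideanSpace.single i (1 : ℝ)⟫ : ℝ) ^ (2 * (j + 1))
  have h1 : (‖x‖ ^ 2) ^ (j + 1) ≤ (n : ℝ) ^ j *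
      ∑ i, (⟪x, EuclideanSpace.single i (1 : ℝ)⟫ : ℝ) ^ (2 * (j + 1)) := by
    rw [norm_sq_eq_sum_inner]
    rcases Nat.eq_zero_or_pos n with rfl | hn
    · simp
    have := pow_sum_div_card_le_sum_pow (s := Finset.univ)
      (f := fun i : Fin n => (⟪x, EuclideanSpace.single i (1 : ℝ)⟫ : ℝ) ^ 2)
      (fun i _ => sq_nonneg _) j
    rw [Finset.card_univ, Fintype.card_fin, div_le_iff₀ (by positivity)] at this
    simp_rw [pow_mul]
    linarith
  rcases le_total ‖x‖ 1 with h2 | h2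
  · have : ‖x‖ ^ j ≤ 1 := pow_le_one₀ (norm_nonneg _) h2
    have h3 : (0 : ℝ) ≤ (‖x‖ ^ 2) ^ (j + 1) := by positivity
    linarith
  · have : ‖x‖ ^ j ≤ (‖x‖ ^ 2) ^ (j + 1) := by
      rw [← pow_mul]; exact pow_le_pow_right₀ h2 (by omega)
    linarith

end moments

section weighted
variable {n : ℕ} {μ : Measure (EuclideanSpace ℝ (Fin n))} [IsFiniteMeasure μ]

/-- Splitting a weighted moment according to a good set `S \ O` and a rare set `O`. -/
lemma setIntegral_mul_le_split {S O : Set (EuclideanSpace ℝ (Fin n))} (hS : MeasurableSet S)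
    (hO : MeasurableSet O) {y G : EuclideanSpace ℝ (Fin n) → ℝ} {Gb Gs M l : ℝ}
    (hy : ∀ x, 0 ≤ y x) (i1 : Integrable y μ) (i2 : Integrable (fun x => y x ^ 2) μ)
    (m1 : ∫ x, y x ∂μ ≤ M) (m2 : ∫ x, y x ^ 2 ∂μ ≤ M) (hG : ∀ x, 0 ≤ G x)
    (hb : ∀ x ∈ S, x ∉ O → G x ≤ Gb) (hs : ∀ x ∈ S, G x ≤ Gs) (hGb : 0 ≤ Gb) (hGs : 0 ≤ Gs)
    (hl : 0 < l) (hP : μ.real O ≤ l ^ 2) :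
    ∫ x in S, y x * G x ∂μ ≤ Gb * M + Gs * ((M + 1) * l) := by
  have i3 : Integrable (fun x => O.indicator (fun _ => (1 : ℝ)) x) μ :=
    (integrable_const (1 : ℝ)).indicator hO
  have hI : Integrable (fun x => Gb * y x + Gs * (l * y x ^ 2 +
      l⁻¹ * O.indicator (fun _ => (1 : ℝ)) x)) μ :=
    (i1.const_mul _).add (((i2.const_mul _).add (i3.const_mul _)).const_mul _)
  have hR : ∀ x, 0 ≤ O.indicator (fun _ => (1 : ℝ)) x := fun x =>
    Set.indicator_nonneg (fun _ _ => zero_le_one) x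
  have hpt : ∀ x ∈ S, y x * G x ≤ Gb * y x + Gs * (l * y x ^ 2 +
      l⁻¹ * O.indicator (fun _ => (1 : ℝ)) x) := by
    intro x hx
    have hli : 0 < l⁻¹ := inv_pos.2 hl
    by_cases hxO : x ∈ O
    · rw [Set.indicator_of_mem hxO, mul_one]
      have h1 : y x ≤ l * y x ^ 2 + l⁻¹ := by
        have h2 : l * l⁻¹ = 1 := mul_inv_cancel₀ hl.ne'
        have h3 : 0 ≤ l * (y x - l⁻¹) ^ 2 := by positivity
        have h4 : l * (y x - l⁻¹) ^ 2 = l * y x ^ 2 - 2 * (l * l⁻¹) * y x + (l * l⁻¹) * l⁻¹ := by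
          ring
        rw [h4, h2] at h3
        have := hy x
        linarith
      calc y x * G x ≤ y x * Gs := mul_le_mul_of_nonneg_left (hs x hx) (hy x)
        _ = Gs * y x := mul_comm _ _
        _ ≤ Gs * (l * y x ^ 2 + l⁻¹) := mul_le_mul_of_nonneg_left h1 hGs
        _ ≤ _ := le_add_of_nonneg_left (mul_nonneg hGb (hy x))
    · rw [Set.indicator_of_notMem hxO, mul_zero, add_zero]
      calc y x * G x ≤ y x * Gb := mul_le_mul_of_nonneg_left (hb x hx hxO) (hy x)
        _ = Gb * y x := mul_comm _ _
        _ ≤ _ := le_add_of_nonneg_right (by positivity)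
  have h1 : ∫ x in S, y x * G x ∂μ ≤ ∫ x in S, (Gb * y x + Gs * (l * y x ^ 2 +
      l⁻¹ * O.indicator (fun _ => (1 : ℝ)) x)) ∂μ :=
    integral_mono_of_nonneg (Filter.Eventually.of_forall fun x => mul_nonneg (hy x) (hG x))
      hI.integrableOn ((ae_restrict_mem hS).mono hpt)
  have h2 : ∫ x in S, (Gb * y x + Gs * (l * y x ^ 2 +
      l⁻¹ * O.indicator (fun _ => (1 : ℝ)) x)) ∂μ ≤ ∫ x, (Gb * y x + Gs * (l * y x ^ 2 +
      l⁻¹ * O.indicator (fun _ => (1 : ℝ)) x)) ∂μ := by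
    refine setIntegral_le_integral hI (Filter.Eventually.of_forall fun x => ?_)
    have := hy x
    have := hR x
    change 0 ≤ Gb * y x + Gs * (l * y x ^ 2 + l⁻¹ * O.indicator (fun _ => (1 : ℝ)) x)
    positivity
  have h3 : ∫ x, (Gb * y x + Gs * (l * y x ^ 2 + l⁻¹ * O.indicator (fun _ => (1 : ℝ)) x)) ∂μ =
      Gb * ∫ x, y x ∂μ + Gs * (l * ∫ x, y x ^ 2 ∂μ + l⁻¹ * μ.real O) := by
    have j1 : Integrable (fun x => l * y x ^ 2 + l⁻¹ * O.indicator (fun _ => (1 : ℝ)) x) μ :=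
      (i2.const_mul _).add (i3.const_mul _)
    rw [integral_add (i1.const_mul _) (j1.const_mul _), integral_const_mul, integral_const_mul,
      integral_add (i2.const_mul _) (i3.const_mul _), integral_const_mul, integral_const_mul,
      integral_indicator_const _ hO, smul_eq_mul, mul_one]
  have h4 : l⁻¹ * μ.real O ≤ l := by
    rw [inv_mul_le_iff₀ hl]; nlinarith
  have h5 : Gs * (l * ∫ x, y x ^ 2 ∂μ + l⁻¹ * μ.real O) ≤ Gs * ((M + 1) * l) := by
    apply mul_le_mul_of_nonneg_left _ hGs
    nlinarith
  have h6 := mul_le_mul_of_nonneg_left m1 hGb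
  linarith

end weighted

lemma integral_gaussWeight_le : ∫ A, gaussWeight A ≤ 6 := by
  have h1 : Integrable fun A : ℝ => 4 / √(2 * π) * rexp (-(1 / 4) * A ^ 2) :=
    (integrable_exp_neg_mul_sq (by norm_num : (0 : ℝ) < 1 / 4)).const_mul _
  have h2 : ∫ A : ℝ, 4 / √(2 * π) * rexp (-(1 / 4) * A ^ 2) ≤ 6 := by
    rw [integral_const_mul, integral_gaussian, div_div_eq_mul_div, div_one]
    have h3 := sqrt_two_pi_bounds.1
    have h4 : √(π * 4) = √2 * √(2 * π) := by
      rw [← Real.sqrt_mul (by norm_num)]; ring_nf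
    rw [h4]
    have h5 : √2 ≤ 1.5 := by
      rw [Real.sqrt_le_left (by norm_num)]; norm_num
    have h6 : 0 < √(2 * π) := by linarith
    calc 4 / √(2 * π) * (√2 * √(2 * π)) = 4 * √2 := by field_simp
      _ ≤ 6 := by linarith
  refine le_trans (integral_mono integrable_gaussWeight h1 fun A => ?_) h2
  have h3 : 1 + A ^ 2 ≤ 4 * rexp (A ^ 2 / 4) := by
    have := Real.add_one_le_exp (A ^ 2 / 4)
    nlinarith [sq_nonneg A]
  have h4 : rexp (A ^ 2 / 4) * rexp (-A ^ 2 / 2) = rexp (-(1 / 4) * A ^ 2) := by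
    rw [← Real.exp_add]; congr 1; ring
  change (1 + A ^ 2) * (rexp (-A ^ 2 / 2) / √(2 * π)) ≤ _
  rw [← h4, mul_div_assoc', div_mul_eq_mul_div]
  refine div_le_div_of_nonneg_right ?_ (Real.sqrt_nonneg _)
  calc (1 + A ^ 2) * rexp (-A ^ 2 / 2) ≤ 4 * rexp (A ^ 2 / 4) * rexp (-A ^ 2 / 2) := by gcongr
    _ = _ := by ring

lemma gaussWeight_neg (A : ℝ) : gaussWeight (-A) = gaussWeight A := by
  simp [gaussWeight, gaussDensity_neg]

lemma gaussWeight_le_translate {τ A : ℝ} (hτ : 0 ≤ τ) (hA : τ ≤ A) :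
    gaussWeight A ≤ 2 * (1 + τ ^ 2) * rexp (-τ ^ 2 / 2) * gaussWeight (A - τ) := by
  have h1 : rexp (-A ^ 2 / 2) ≤ rexp (-τ ^ 2 / 2) * rexp (-(A - τ) ^ 2 / 2) := by
    rw [← Real.exp_add]
    apply Real.exp_le_exp.2
    nlinarith [mul_nonneg hτ (sub_nonneg.2 hA)]
  have h2 : 1 + A ^ 2 ≤ 2 * (1 + τ ^ 2) * (1 + (A - τ) ^ 2) := by
    nlinarith [sq_nonneg (A - 2 * τ), mul_nonneg (sq_nonneg τ) (sq_nonneg (A - τ))]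
  have h3 := sqrt_two_pi_bounds.1
  unfold gaussWeight gaussDensity
  rw [mul_div_assoc', mul_div_assoc', mul_div_assoc']
  refine div_le_div_of_nonneg_right ?_ (Real.sqrt_nonneg _)
  calc (1 + A ^ 2) * rexp (-A ^ 2 / 2) ≤
      (2 * (1 + τ ^ 2) * (1 + (A - τ) ^ 2)) * (rexp (-τ ^ 2 / 2) * rexp (-(A - τ) ^ 2 / 2)) := by
        gcongr
    _ = _ := by ring

lemma integral_evenTail_le {r t : ℝ} (hr : 0 < r) (ht : 0 ≤ t) :
    ∫ A, evenTail t (r * A) * gaussWeight A ≤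
      12 * (1 + (t / r) ^ 2) * rexp (-(t / r) ^ 2 / 2) := by
  obtain ⟨τ, hτ⟩ : ∃ τ, τ = t / r := ⟨_, rfl⟩
  have hτ0 : 0 ≤ τ := by rw [hτ]; positivity
  rw [← hτ]
  have i1 : Integrable fun A => gaussWeight (A - τ) := integrable_gaussWeight.comp_sub_right τ
  have i2 : Integrable fun A => gaussWeight (A + τ) := integrable_gaussWeight.comp_add_right τ
  have h1 : ∫ A, evenTail t (r * A) * gaussWeight A ≤
      ∫ A, (1 + τ ^ 2) * rexp (-τ ^ 2 / 2) * (gaussWeight (A - τ) + gaussWeight (A + τ)) := by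
    refine integral_mono_of_nonneg (Filter.Eventually.of_forall fun A =>
      mul_nonneg (evenTail_bounds t _).1 (gaussWeight_nonneg A)) ((i1.add i2).const_mul _)
      (Filter.Eventually.of_forall fun A => ?_)
    change evenTail t (r * A) * gaussWeight A ≤ _
    have p1 := gaussWeight_nonneg (A - τ)
    have p2 := gaussWeight_nonneg (A + τ)
    have p3 : 0 ≤ (1 + τ ^ 2) * rexp (-τ ^ 2 / 2) := by positivity
    unfold evenTail
    split_ifs with h
    · have h2 : τ ≤ |A| := by
        rw [hτ, div_le_iff₀ hr]
        rwa [abs_mul, abs_of_pos hr, mul_comm] at h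
      rcases le_abs.1 h2 with h3 | h3
      · have := gaussWeight_le_translate hτ0 h3
        change _ ≤ (1 + τ ^ 2) * rexp (-τ ^ 2 / 2) * (gaussWeight (A - τ) + gaussWeight (A + τ))
        nlinarith [mul_nonneg p3 p2]
      · have := gaussWeight_le_translate hτ0 h3
        rw [gaussWeight_neg, show -A - τ = -(A + τ) by ring, gaussWeight_neg] at this
        change _ ≤ (1 + τ ^ 2) * rexp (-τ ^ 2 / 2) * (gaussWeight (A - τ) + gaussWeight (A + τ))
        nlinarith [mul_nonneg p3 p1]
    · rw [zero_mul]; positivity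
  rw [integral_const_mul, integral_add i1 i2, integral_sub_right_eq_self (fun A => gaussWeight A),
    integral_add_right_eq_self (fun A => gaussWeight A)] at h1
  refine h1.trans ?_
  have h2 := integral_gaussWeight_le
  have p3 : 0 ≤ (1 + τ ^ 2) * rexp (-τ ^ 2 / 2) := by positivity
  nlinarith

lemma integral_evenTail_le_three (r t : ℝ) : ∫ A, evenTail t (r * A) * gaussWeight A ≤ 3 := by
  have h1 : ∫ A, evenTail t (r * A) * gaussWeight A ≤ ∫ A, 1 / 2 * gaussWeight A :=
    integral_mono_of_nonneg (Filter.Eventually.of_forall fun A =>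
      mul_nonneg (evenTail_bounds t _).1 (gaussWeight_nonneg A))
      (integrable_gaussWeight.const_mul _)
      (Filter.Eventually.of_forall fun A =>
        mul_le_mul_of_nonneg_right (evenTail_bounds t _).2 (gaussWeight_nonneg A))
  rw [integral_const_mul] at h1
  linarith [integral_gaussWeight_le]

lemma exp_neg_sq_half_le {t : ℝ} (ht : 0 ≤ t) :
    rexp (-t ^ 2 / 2) ≤ 7.53 * (1 + t) * gaussTail t := by
  have h1 := gaussDensity_le_gaussTail ht
  have h2 := sqrt_two_pi_bounds
  unfold gaussDensity at h1
  rw [div_le_iff₀ (by linarith)] at h1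
  refine h1.trans ?_
  have := gaussTail_pos t
  have h3 : 0 ≤ 3 * (1 + t) * gaussTail t := by positivity
  nlinarith [mul_le_mul_of_nonneg_left h2.2 h3]

section band
variable {T r t : ℝ} (hT : 1 ≤ T) (ht : 0 ≤ t) (ht2 : t ≤ 2 * T)
  (hr : |r - 1| ≤ 1 / (16 * T ^ 2))
include hT hr

lemma band_bounds : 15 / 16 ≤ r ∧ r ≤ 17 / 16 := by
  have h1 : 1 / (16 * T ^ 2) ≤ 1 / 16 := by
    apply one_div_le_one_div_of_le (by norm_num); nlinarith
  have := abs_le.1 (hr.trans h1)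
  constructor <;> linarith [this.1, this.2]

include ht ht2

lemma integral_evenTail_band_le :
    ∫ A, evenTail t (r * A) * gaussWeight A ≤ 240 * ((1 + t) ^ 3 * gaussTail t) := by
  obtain ⟨hr1, hr2⟩ := band_bounds hT hr
  refine (integral_evenTail_le (by linarith) ht).trans ?_
  have hr3 : r ≤ 1 + 1 / (16 * T ^ 2) := by linarith [(abs_le.1 hr).2]
  have h1 : 1 + (t / r) ^ 2 ≤ 2 * (1 + t) ^ 2 := by
    have : t / r ≤ 16 / 15 * t := by
      rw [div_le_iff₀ (by linarith)]; nlinarith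
    have h0 : 0 ≤ t / r := by positivity
    nlinarith
  have h2 : t ^ 2 - 1 / 2 ≤ (t / r) ^ 2 := by
    rw [div_pow, le_div_iff₀ (by positivity)]
    have h3 : t ^ 2 * (1 / (16 * T ^ 2)) ≤ 1 / 4 := by
      rw [mul_one_div, div_le_iff₀ (by positivity)]; nlinarith
    obtain ⟨η, hη⟩ : ∃ η, η = 1 / (16 * T ^ 2) := ⟨_, rfl⟩
    rw [← hη] at h3 hr3
    rcases le_total (t ^ 2) (1 / 2) with h4 | h4
    · nlinarith [sq_nonneg t, sq_nonneg r]
    have hη0 : 0 ≤ η := by rw [hη]; positivity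
    have hη1 : η ≤ 1 / 16 := by
      rw [hη]; apply one_div_le_one_div_of_le (by norm_num); nlinarith
    have h5 : r ^ 2 ≤ 1 + 2 * η + η ^ 2 := by nlinarith
    have h6 : (t ^ 2 - 1 / 2) * r ^ 2 ≤ (t ^ 2 - 1 / 2) * (1 + 2 * η + η ^ 2) :=
      mul_le_mul_of_nonneg_left h5 (by linarith)
    nlinarith [mul_le_mul_of_nonneg_right h3 hη0, mul_nonneg hη0 hη0]
  have h3 : rexp (-(t / r) ^ 2 / 2) ≤ 1.3 * rexp (-t ^ 2 / 2) := by
    have h4 : rexp (1 / 4) ≤ 1.3 := by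
      have e1 : rexp (1 / 4) ^ 4 = rexp 1 := by rw [← Real.exp_nat_mul]; norm_num
      have e2 : rexp (1 : ℝ) < 2.7182818286 := Real.exp_one_lt_d9
      by_contra! h
      have : (1.3 : ℝ) ^ 4 ≤ rexp (1 / 4) ^ 4 := by gcongr
      norm_num at this
      linarith
    calc rexp (-(t / r) ^ 2 / 2) ≤ rexp (1 / 4 + -t ^ 2 / 2) := by
          apply Real.exp_le_exp.2; linarith
      _ = rexp (1 / 4) * rexp (-t ^ 2 / 2) := Real.exp_add _ _
      _ ≤ _ := by gcongr
  have h4 := exp_neg_sq_half_le ht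
  have h5 := gaussTail_pos t
  calc 12 * (1 + (t / r) ^ 2) * rexp (-(t / r) ^ 2 / 2)
      ≤ 12 * (2 * (1 + t) ^ 2) * (1.3 * (7.53 * (1 + t) * gaussTail t)) := by
        gcongr; exact h3.trans (by gcongr)
    _ = (12 * 2 * 1.3 * 7.53) * ((1 + t) ^ 3 * gaussTail t) := by ring
    _ ≤ _ := by gcongr; norm_num

lemma gaussWeight_le_of_near {A : ℝ} (hA : |(|r * A| - t)| ≤ 1 / T) :
    gaussWeight A ≤ 100 * ((1 + t) ^ 3 * gaussTail t) := by
  obtain ⟨hr1, hr2⟩ := band_bounds hT hr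
  have hr3 : r ≤ 1 + 1 / (16 * T ^ 2) := by linarith [(abs_le.1 hr).2]
  have hT1 : 1 / T ≤ 1 := by rw [div_le_one (by linarith)]; exact hT
  rw [abs_mul, abs_of_pos (by linarith : 0 < r)] at hA
  obtain ⟨a, ha⟩ : ∃ a, a = |A| := ⟨_, rfl⟩
  have ha0 : 0 ≤ a := by rw [ha]; positivity
  have haA : A ^ 2 = a ^ 2 := by rw [ha, sq_abs]
  rw [← ha] at hA
  obtain ⟨hA1, hA2⟩ := abs_le.1 hA
  have h1 : 1 + A ^ 2 ≤ 3 * (1 + t) ^ 2 := by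
    have : a ≤ 16 / 15 * (1 + t) := by nlinarith
    rw [haA]; nlinarith
  have h2 : t ^ 2 - 4.75 ≤ A ^ 2 := by
    rw [haA]
    rcases le_total t (1 / T) with h | h
    · nlinarith [sq_nonneg a]
    have h3 : t / T ≤ 2 := by rw [div_le_iff₀ (by linarith)]; linarith
    have h4 : t ^ 2 - 4 ≤ r ^ 2 * a ^ 2 := by
      have h5 : t - 1 / T ≤ r * a := by linarith
      have h6 : (t - 1 / T) ^ 2 ≤ (r * a) ^ 2 := by
        apply pow_le_pow_left₀ (by linarith) h5
      have h7 : (t - 1 / T) ^ 2 = t ^ 2 - 2 * (t / T) + (1 / T) ^ 2 := by ring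
      have h8 := sq_nonneg (1 / T)
      rw [mul_pow] at h6
      linarith
    by_contra! h5
    have h6 : t ^ 2 * (1 / (16 * T ^ 2)) ≤ 1 / 4 := by
      rw [mul_one_div, div_le_iff₀ (by positivity)]; nlinarith
    obtain ⟨η, hη⟩ : ∃ η, η = 1 / (16 * T ^ 2) := ⟨_, rfl⟩
    rw [← hη] at h6 hr3
    have hη0 : 0 ≤ η := by rw [hη]; positivity
    have hη1 : η ≤ 1 / 16 := by
      rw [hη]; apply one_div_le_one_div_of_le (by norm_num); nlinarith
    have h7 : r ^ 2 ≤ 1 + 3 * η := by nlinarith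
    have h8 : r ^ 2 * a ^ 2 ≤ (1 + 3 * η) * a ^ 2 := by gcongr
    have h9 : η * a ^ 2 ≤ η * t ^ 2 := by
      apply mul_le_mul_of_nonneg_left _ hη0; linarith
    nlinarith
  have h3 : rexp (-A ^ 2 / 2) ≤ 11 * rexp (-t ^ 2 / 2) := by
    have h4 : rexp 2.375 ≤ 11 := by
      have e1 : rexp 2.375 ^ 8 = rexp 1 ^ 19 := by
        rw [← Real.exp_nat_mul, ← Real.exp_nat_mul]; norm_num
      have e2 : rexp (1 : ℝ) < 2.7182818286 := Real.exp_one_lt_d9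
      by_contra! h
      have h5 : (11 : ℝ) ^ 8 ≤ rexp 2.375 ^ 8 := by gcongr
      have h6 : rexp 1 ^ 19 ≤ (2.7182818286 : ℝ) ^ 19 := by gcongr
      rw [e1] at h5
      norm_num at h5 h6
      linarith
    calc rexp (-A ^ 2 / 2) ≤ rexp (2.375 + -t ^ 2 / 2) := by
          apply Real.exp_le_exp.2; linarith
      _ = rexp 2.375 * rexp (-t ^ 2 / 2) := Real.exp_add _ _
      _ ≤ _ := by gcongr
  have h4 : gaussDensity A ≤ 11 * gaussDensity t := by
    unfold gaussDensity
    rw [mul_div_assoc']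
    gcongr
  have h5 := gaussDensity_le_gaussTail ht
  have h6 := gaussTail_pos t
  have h7 := gaussDensity_pos A
  calc gaussWeight A = (1 + A ^ 2) * gaussDensity A := rfl
    _ ≤ (3 * (1 + t) ^ 2) * (11 * (3 * (1 + t) * gaussTail t)) := by
        gcongr; exact h4.trans (by gcongr)
    _ = 99 * ((1 + t) ^ 3 * gaussTail t) := by ring
    _ ≤ _ := by gcongr; norm_num

end band

lemma integrable_levelKernel {h r : ℝ} (hh : 0 < h) (hr : 0 < r) (c : ℝ) :
    Integrable (fun A : ℝ => (h ^ 2 + (r * A - c) ^ 2)⁻¹) ∧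
      ∫ A : ℝ, (h ^ 2 + (r * A - c) ^ 2)⁻¹ = π / (h * r) := by
  have e : (fun A : ℝ => (h ^ 2 + (r * A - c) ^ 2)⁻¹) = fun A =>
      (h ^ 2)⁻¹ * (fun B : ℝ => (1 + (B - c / h) ^ 2)⁻¹) (r / h * A) := by
    ext A
    rw [← mul_inv]
    congr 1
    field_simp
  have hrh : r / h ≠ 0 := by positivity
  rw [e]
  refine ⟨((integrable_inv_one_add_sq.comp_sub_right (c / h)).comp_mul_left' hrh).const_mul _, ?_⟩
  rw [integral_const_mul, Measure.integral_comp_mul_left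
      (fun B : ℝ => (1 + (B - c / h) ^ 2)⁻¹),
    integral_sub_right_eq_self (fun B : ℝ => (1 + B ^ 2)⁻¹), integral_univ_inv_one_add_sq,
    smul_eq_mul, abs_of_pos (by positivity)]
  field_simp

lemma levelWeight_le_add {h : ℝ} (hh : 0 < h) (t s : ℝ) :
    levelWeight h t s ≤ (h ^ 2 + (s - t) ^ 2)⁻¹ + (h ^ 2 + (s - -t) ^ 2)⁻¹ := by
  unfold levelWeight
  rcases abs_cases s with ⟨h1, _⟩ | ⟨h1, _⟩
  · rw [h1]; exact le_add_of_nonneg_right (by positivity)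
  · rw [h1, show (-s - t) ^ 2 = (s - -t) ^ 2 by ring]
    exact le_add_of_nonneg_left (by positivity)

lemma integrable_levelWeight_comp {h r : ℝ} (hh : 0 < h) (hr : 0 < r) (t : ℝ) :
    Integrable (fun A : ℝ => levelWeight h t (r * A)) ∧
      ∫ A : ℝ, levelWeight h t (r * A) ≤ 6.3 / (h * r) := by
  obtain ⟨i1, e1⟩ := integrable_levelKernel hh hr t
  obtain ⟨i2, e2⟩ := integrable_levelKernel hh hr (-t)
  have i3 : Integrable (fun A : ℝ => levelWeight h t (r * A)) := by
    refine (i1.add i2).mono' ((measurable_levelWeight h t).comp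
      (by fun_prop)).aestronglyMeasurable (Filter.Eventually.of_forall fun A => ?_)
    change ‖levelWeight h t (r * A)‖ ≤ _
    rw [Real.norm_eq_abs, abs_of_nonneg (levelWeight_bounds hh t _).1]
    exact levelWeight_le_add hh t _
  refine ⟨i3, ?_⟩
  have h1 := integral_mono i3 (i1.add i2) fun A => levelWeight_le_add hh t (r * A)
  rw [integral_add' i1 i2, e1, e2] at h1
  refine h1.trans ?_
  rw [← add_div]
  gcongr
  linarith [Real.pi_lt_d2]

lemma integral_levelWeight_le {h r : ℝ} (hh : 0 < h) (hr : 1 / 50 ≤ r) (t : ℝ) :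
    ∫ A, levelWeight h t (r * A) * gaussWeight A ≤ 320 / h := by
  obtain ⟨i1, e1⟩ := integrable_levelWeight_comp hh (by linarith : 0 < r) t
  have h1 : ∫ A, levelWeight h t (r * A) * gaussWeight A ≤ ∫ A, levelWeight h t (r * A) :=
    integral_mono_of_nonneg (Filter.Eventually.of_forall fun A =>
      mul_nonneg (levelWeight_bounds hh t _).1 (gaussWeight_nonneg A)) i1
      (Filter.Eventually.of_forall fun A =>
        mul_le_of_le_one_right (levelWeight_bounds hh t _).1 (gaussWeight_le_one A))
  refine (h1.trans e1).trans ?_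
  rw [div_le_div_iff₀ (by positivity) hh]
  nlinarith

lemma integral_levelWeight_band_le {T r t h : ℝ} (hT : 1 ≤ T) (ht : 0 ≤ t) (ht2 : t ≤ 2 * T)
    (hr : |r - 1| ≤ 1 / (16 * T ^ 2)) (hh : 0 < h) :
    ∫ A, levelWeight h t (r * A) * gaussWeight A ≤
      700 * ((1 + t) ^ 3 * gaussTail t) / h + 6 * T ^ 2 := by
  obtain ⟨hr1, hr2⟩ := band_bounds hT hr
  obtain ⟨i1, e1⟩ := integrable_levelWeight_comp hh (by linarith : 0 < r) t
  obtain ⟨B, hB⟩ : ∃ B, B = (1 + t) ^ 3 * gaussTail t := ⟨_, rfl⟩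
  have hB0 : 0 ≤ B := by have := gaussTail_pos t; rw [hB]; positivity
  have h1 : ∫ A, levelWeight h t (r * A) * gaussWeight A ≤
      ∫ A, (100 * B * levelWeight h t (r * A) + T ^ 2 * gaussWeight A) := by
    refine integral_mono_of_nonneg (Filter.Eventually.of_forall fun A =>
      mul_nonneg (levelWeight_bounds hh t _).1 (gaussWeight_nonneg A))
      ((i1.const_mul _).add (integrable_gaussWeight.const_mul _))
      (Filter.Eventually.of_forall fun A => ?_)
    change levelWeight h t (r * A) * gaussWeight A ≤
      100 * B * levelWeight h t (r * A) + T ^ 2 * gaussWeight A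
    have p1 := (levelWeight_bounds hh t (r * A)).1
    have p2 := gaussWeight_nonneg A
    rcases le_or_gt |(|r * A| - t)| (1 / T) with h2 | h2
    · have := gaussWeight_le_of_near hT ht ht2 hr h2
      rw [← hB] at this
      nlinarith [mul_le_mul_of_nonneg_left this p1, mul_nonneg (sq_nonneg T) p2]
    · have h3 : levelWeight h t (r * A) ≤ T ^ 2 := by
        unfold levelWeight
        rw [inv_le_comm₀ (by positivity) (by positivity)]
        have h4 : (1 / T) ^ 2 ≤ |(|r * A| - t)| ^ 2 :=
          pow_le_pow_left₀ (by positivity) h2.le 2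
        rw [sq_abs, one_div, inv_pow] at h4
        nlinarith [sq_nonneg h]
      nlinarith [mul_le_mul_of_nonneg_right h3 p2, mul_nonneg hB0 p1]
  rw [integral_add (i1.const_mul _) (integrable_gaussWeight.const_mul _), integral_const_mul,
    integral_const_mul] at h1
  rw [← hB]
  have h2 : 6.3 / (h * r) ≤ 7 / h := by
    rw [div_le_div_iff₀ (by positivity) hh]; nlinarith
  have h3 : 100 * B * ∫ A, levelWeight h t (r * A) ≤ 100 * B * (7 / h) :=
    mul_le_mul_of_nonneg_left (e1.trans h2) (by positivity)
  have h4 : T ^ 2 * ∫ A, gaussWeight A ≤ T ^ 2 * 6 :=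
    mul_le_mul_of_nonneg_left integral_gaussWeight_le (sq_nonneg T)
  have h5 : 100 * B * (7 / h) = 700 * B / h := by ring
  linarith

section bulk
variable {n : ℕ}

/-- Points whose norm is not much smaller than `√n`. -/
def bulk (n : ℕ) : Set (EuclideanSpace ℝ (Fin n)) := {x | 1 / 50 ≤ ‖x‖ / √n}

lemma measurableSet_bulk : MeasurableSet (bulk n) :=
  measurableSet_le measurable_const (by fun_prop)

lemma sq_norm_ge_of_mem_bulk (hn : 0 < n) {x : EuclideanSpace ℝ (Fin n)} (hx : x ∈ bulk n) :
    (n : ℝ) / 2500 ≤ ‖x‖ ^ 2 := by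
  have h0 : (0 : ℝ) < n := by exact_mod_cast hn
  have h1 : 0 < √(n : ℝ) := Real.sqrt_pos.2 h0
  have hx' : 1 / 50 ≤ ‖x‖ / √n := hx
  rw [le_div_iff₀ h1] at hx'
  have h2 := Real.sq_sqrt h0.le
  nlinarith [norm_nonneg x]

lemma isEven_restrict {μ : Measure (EuclideanSpace ℝ (Fin n))} (hμ : Measure.IsEven μ)
    {S : Set (EuclideanSpace ℝ (Fin n))} (hS : MeasurableSet S) (hneg : ∀ x, -x ∈ S ↔ x ∈ S) :
    Measure.IsEven (μ.restrict S) := by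
  have h1 : S = (fun x : EuclideanSpace ℝ (Fin n) => -x) ⁻¹' S := by
    ext x; exact (hneg x).symm
  unfold Measure.IsEven at *
  conv_lhs => rw [h1]
  rw [← Measure.restrict_map measurable_neg hS, hμ]

lemma neg_mem_bulk (x : EuclideanSpace ℝ (Fin n)) : -x ∈ bulk n ↔ x ∈ bulk n := by
  simp [bulk]

/-- The bulk points lying away from the sphere of radius `√n`. -/
def offBand (n : ℕ) (η : ℝ) : Set (EuclideanSpace ℝ (Fin n)) :=
  {x | 1 / 50 ≤ ‖x‖ / √n ∧ η ≤ |‖x‖ / √n - 1|}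

lemma measurableSet_offBand (η : ℝ) : MeasurableSet (offBand n η) :=
  (measurableSet_le (f := fun _ => 1 / 50) (g := fun x => ‖x‖ / √n) measurable_const
    (by fun_prop)).inter (measurableSet_le (f := fun _ => η) (g := fun x => |‖x‖ / √n - 1|)
    measurable_const (by fun_prop))

variable {μ : Measure (EuclideanSpace ℝ (Fin n))} [IsProbabilityMeasure μ]
  (hint : ∀ (k : ℕ) (θ : EuclideanSpace ℝ (Fin n)), ‖θ‖ = 1 →
    Integrable (fun x => (⟪x, θ⟫ : ℝ) ^ (2 * k)) μ)
  {M : ℝ} (hM : ∀ k ≤ 5, ∀ θ : EuclideanSpace ℝ (Fin n), ‖θ‖ = 1 →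
    ∫ x, (⟪x, θ⟫ : ℝ) ^ (2 * k) ∂μ ≤ M)

include hint

lemma integrable_norm_pow_bulk (j : ℕ) :
    Integrable (fun x => ‖x‖ ^ j) (μ.restrict (bulk n)) :=
  (integrable_norm_pow hint j).restrict

include hM

lemma setIntegral_inner_pow_mul_radialWeight_le {g : ℝ → ℝ} {m : ℝ} (hm : ∀ s, 0 ≤ g s ∧ g s ≤ m)
    {η Gb Gs l : ℝ} (hGb : 0 ≤ Gb) (hGs : 0 ≤ Gs) (hl : 0 < l)
    (hO : μ.real (offBand n η) ≤ l ^ 2)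
    (hb : ∀ r, |r - 1| ≤ η → ∫ A, g (r * A) * gaussWeight A ≤ Gb)
    (hs : ∀ r, 1 / 50 ≤ r → ∫ A, g (r * A) * gaussWeight A ≤ Gs)
    {k : ℕ} (hk : k ≤ 2) {θ : EuclideanSpace ℝ (Fin n)} (hθ : ‖θ‖ = 1) :
    ∫ x, (⟪x, θ⟫ : ℝ) ^ (2 * k) * radialWeight g x ∂(μ.restrict (bulk n)) ≤
      Gb * M + Gs * ((M + 1) * l) := by
  have h2 : (fun x : EuclideanSpace ℝ (Fin n) => ((⟪x, θ⟫ : ℝ) ^ (2 * k)) ^ 2) =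
      fun x => (⟪x, θ⟫ : ℝ) ^ (2 * (2 * k)) := by
    ext x; rw [← pow_mul]; congr 1; ring
  refine setIntegral_mul_le_split (O := offBand n η) measurableSet_bulk (measurableSet_offBand η)
    (fun x => (even_two_mul k).pow_nonneg _) (hint k θ hθ) ?_ (hM k (by omega) θ hθ) ?_
    (radialWeight_nonneg hm) ?_ ?_ hGb hGs hl hO
  · rw [h2]; exact hint (2 * k) θ hθ
  · rw [h2]; exact hM (2 * k) (by omega) θ hθ
  · intro x hx hxO
    refine hb _ ?_
    by_contra h
    exact hxO ⟨hx, (not_le.1 h).le⟩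
  · exact fun x hx => hs _ hx

omit [IsProbabilityMeasure μ] in
lemma setIntegral_inner_pow_le {k : ℕ} (hk : k ≤ 5) {θ : EuclideanSpace ℝ (Fin n)}
    (hθ : ‖θ‖ = 1) : ∫ x, (⟪x, θ⟫ : ℝ) ^ (2 * k) ∂(μ.restrict (bulk n)) ≤ M :=
  (setIntegral_le_integral (hint k θ hθ)
    (ae_of_all _ fun _ => (even_two_mul k).pow_nonneg _)).trans (hM k hk θ hθ)

variable (hn : 0 < n) {g : ℝ → ℝ} (hg : Measurable g) (hge : ∀ s, g (-s) = g s)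
  {m : ℝ} (hm : ∀ s, 0 ≤ g s ∧ g s ≤ m) {W : ℝ} (hM0 : 0 ≤ M)
  (hW : ∀ k ≤ 2, ∀ θ : EuclideanSpace ℝ (Fin n), ‖θ‖ = 1 →
    ∫ x, (⟪x, θ⟫ : ℝ) ^ (2 * k) * radialWeight g x ∂(μ.restrict (bulk n)) ≤ W)
include hn hg hge hm hM0 hW

lemma integral_prod_centred_zero_le :
    ∫ p : EuclideanSpace ℝ (Fin n) × EuclideanSpace ℝ (Fin n),
      (∫ Y, centred g p.1 Y * centred g p.2 Y ∂sGauss n)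
        ∂((μ.restrict (bulk n)).prod (μ.restrict (bulk n))) ≤
      7500 / n * W ^ 2 + 10 ^ 11 * 2500 ^ 4 * m ^ 2 * M / n ^ 4 := by
  have hn' : (0 : ℝ) < n := by exact_mod_cast hn
  have hθ : ‖(EuclideanSpace.single (⟨0, hn⟩ : Fin n) (1 : ℝ))‖ = 1 := norm_single_one _
  have hW0 : ∫ x, radialWeight g x ∂(μ.restrict (bulk n)) ≤ W := by
    simpa using hW 0 (by norm_num) _ hθ
  have hWn : 0 ≤ W := (integral_nonneg fun x => radialWeight_nonneg hm x).trans hW0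
  have key := integral_centred_mul_le (ν := μ.restrict (bulk n)) (ρ := n / 2500) (C := M) (W := W)
    (W' := W) (N := 1) hg hge hm (by positivity)
    ((ae_restrict_iff' measurableSet_bulk).2 (ae_of_all _ fun x hx => sq_norm_ge_of_mem_bulk hn hx))
    0 (integrable_norm_pow_bulk hint)
    (fun θ h => setIntegral_inner_pow_le hint hM (k := 4) (by norm_num) h)
    (fun θ h => hW 1 (by norm_num) θ h) (by simpa using hW0)
    (by
      simp only [mul_zero, pow_zero, integral_const, smul_eq_mul, mul_one]
      rw [measureReal_restrict_apply_univ]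
      exact measureReal_le_one) hWn hM0
  simp only [mul_zero, pow_zero, one_mul] at key
  refine key.trans (le_of_eq ?_)
  field_simp
  ring

lemma integral_prod_centred_one_le :
    ∫ p : EuclideanSpace ℝ (Fin n) × EuclideanSpace ℝ (Fin n),
      (⟪p.1, p.2⟫ : ℝ) ^ 2 * (∫ Y, centred g p.1 Y * centred g p.2 Y ∂sGauss n)
        ∂((μ.restrict (bulk n)).prod (μ.restrict (bulk n))) ≤
      7500 * W ^ 2 + 10 ^ 11 * 2500 ^ 4 * m ^ 2 * M ^ 2 / n ^ 3 := by
  have hn' : (0 : ℝ) < n := by exact_mod_cast hn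
  have hθ : ‖(EuclideanSpace.single (⟨0, hn⟩ : Fin n) (1 : ℝ))‖ = 1 := norm_single_one _
  have hW0 : ∫ x, radialWeight g x ∂(μ.restrict (bulk n)) ≤ W := by
    simpa using hW 0 (by norm_num) _ hθ
  have hWn : 0 ≤ W := (integral_nonneg fun x => radialWeight_nonneg hm x).trans hW0
  have hi := integrable_norm_pow_bulk hint
  have i2 : ∀ i : Fin n, Integrable (fun x : EuclideanSpace ℝ (Fin n) =>
      (⟪x, EuclideanSpace.single i (1 : ℝ)⟫ : ℝ) ^ 2) (μ.restrict (bulk n)) := fun i =>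
    (hint 1 _ (norm_single_one i)).restrict
  have hW' : ∫ x, ‖x‖ ^ (2 * 1) * radialWeight g x ∂(μ.restrict (bulk n)) ≤ n * W := by
    have e : (fun x : EuclideanSpace ℝ (Fin n) => ‖x‖ ^ (2 * 1) * radialWeight g x) =
        fun x => ∑ i, (⟪x, EuclideanSpace.single i (1 : ℝ)⟫ : ℝ) ^ 2 * radialWeight g x := by
      ext x; rw [mul_one, norm_sq_eq_sum_inner, Finset.sum_mul]
    rw [e, integral_finsetSum _ fun i _ => integrable_mul_radialWeight hg hm (i2 i)]
    calc _ ≤ ∑ _i : Fin n, W := Finset.sum_le_sum fun i _ =>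
          hW 1 (by norm_num) _ (norm_single_one i)
      _ = n * W := by simp
  have hN : ∫ x, ‖x‖ ^ (2 * 1) ∂(μ.restrict (bulk n)) ≤ n * M := by
    have e : (fun x : EuclideanSpace ℝ (Fin n) => ‖x‖ ^ (2 * 1)) =
        fun x => ∑ i, (⟪x, EuclideanSpace.single i (1 : ℝ)⟫ : ℝ) ^ 2 := by
      ext x; rw [mul_one, norm_sq_eq_sum_inner]
    rw [e, integral_finsetSum _ fun i _ => i2 i]
    calc _ ≤ ∑ _i : Fin n, M := Finset.sum_le_sum fun i _ =>
          setIntegral_inner_pow_le hint hM (k := 1) (by norm_num) (norm_single_one i)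
      _ = n * M := by simp
  have key := integral_centred_mul_le (ν := μ.restrict (bulk n)) (ρ := n / 2500) (C := M) (W := W)
    (W' := n * W) (N := n * M) hg hge hm (by positivity)
    ((ae_restrict_iff' measurableSet_bulk).2 (ae_of_all _ fun x hx => sq_norm_ge_of_mem_bulk hn hx))
    1 hi
    (fun θ h => setIntegral_inner_pow_le hint hM (k := 5) (by norm_num) h)
    (fun θ h => hW 2 (by norm_num) θ h) hW' hN hWn hM0
  refine key.trans (le_of_eq ?_)
  field_simp
  ring

end bulk

section levels
variable {n : ℕ} {μ : Measure (EuclideanSpace ℝ (Fin n))} [IsProbabilityMeasure μ]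
  (hint : ∀ (k : ℕ) (θ : EuclideanSpace ℝ (Fin n)), ‖θ‖ = 1 →
    Integrable (fun x => (⟪x, θ⟫ : ℝ) ^ (2 * k)) μ)
  {M : ℝ} (hM : ∀ k ≤ 5, ∀ θ : EuclideanSpace ℝ (Fin n), ‖θ‖ = 1 →
    ∫ x, (⟪x, θ⟫ : ℝ) ^ (2 * k) ∂μ ≤ M) (hM1 : 1 ≤ M)
  {T t : ℝ} (hT : 1 ≤ T) (ht : 0 < t) (ht2 : t ≤ 2 * T)
  (hO : μ.real (offBand n (1 / (16 * T ^ 2))) ≤ gaussTail (2 * T) ^ 2)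
  (hn : 0 < n)

/-- The size of the Gaussian tail at level `t`, with the polynomial factor occurring in the
variance estimates. -/
noncomputable def tailScale (t : ℝ) : ℝ := (1 + t) ^ 3 * gaussTail t

lemma gaussTail_two_mul_le_tailScale {T t : ℝ} (ht : 0 ≤ t) (ht2 : t ≤ 2 * T) :
    gaussTail (2 * T) ≤ tailScale t := by
  have h1 := gaussTail_anti ht2
  have h2 := gaussTail_pos t
  have h3 : 1 ≤ (1 + t) ^ 3 := one_le_pow₀ (by linarith)
  unfold tailScale
  nlinarith

include hint hM hM1 hT ht ht2 hO

lemma evenTail_weight_le {k : ℕ} (hk : k ≤ 2) {θ : EuclideanSpace ℝ (Fin n)} (hθ : ‖θ‖ = 1) :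
    ∫ x, (⟪x, θ⟫ : ℝ) ^ (2 * k) * radialWeight (evenTail t) x ∂(μ.restrict (bulk n)) ≤
      250 * M * tailScale t := by
  have h1 := gaussTail_two_mul_le_tailScale ht.le ht2
  have h2 := gaussTail_pos (2 * T)
  have key := setIntegral_inner_pow_mul_radialWeight_le hint hM (evenTail_bounds t)
    (Gb := 240 * tailScale t) (Gs := 3) (by linarith) (by norm_num) h2 hO
    (fun r hr => integral_evenTail_band_le hT ht.le ht2 hr)
    (fun r _ => integral_evenTail_le_three r t) hk hθ
  refine key.trans ?_
  nlinarith [mul_le_mul_of_nonneg_left h1 (by linarith : 0 ≤ M)]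

lemma levelWeight_weight_le {h : ℝ} (hh : 0 < h) {k : ℕ} (hk : k ≤ 2)
    {θ : EuclideanSpace ℝ (Fin n)} (hθ : ‖θ‖ = 1) :
    ∫ x, (⟪x, θ⟫ : ℝ) ^ (2 * k) * radialWeight (levelWeight h t) x ∂(μ.restrict (bulk n)) ≤
      1340 * M * tailScale t / h + 6 * T ^ 2 * M := by
  have h1 := gaussTail_two_mul_le_tailScale ht.le ht2
  have h2 := gaussTail_pos (2 * T)
  have key := setIntegral_inner_pow_mul_radialWeight_le hint hM (levelWeight_bounds hh t)
    (Gb := 700 * tailScale t / h + 6 * T ^ 2) (Gs := 320 / h)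
    (by have : 0 ≤ tailScale t := by linarith
        positivity) (by positivity) h2 hO
    (fun r hr => integral_levelWeight_band_le hT ht.le ht2 hr hh)
    (fun r hr => integral_levelWeight_le hh hr t) hk hθ
  refine key.trans ?_
  have h3 : (M + 1) * gaussTail (2 * T) ≤ 2 * M * tailScale t := by
    nlinarith [mul_le_mul_of_nonneg_left h1 (by linarith : 0 ≤ M)]
  calc _ ≤ (700 * tailScale t / h + 6 * T ^ 2) * M + 320 / h * (2 * M * tailScale t) := by gcongr
    _ = _ := by ring

include hn

lemma integral_hsDeviation_levelWeight_le {h : ℝ} (hh : 0 < h) :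
    ∫ Y, hsDeviation (μ.restrict (bulk n)) (levelWeight h t) Y ∂sGauss n ≤
      7500 * (1340 * M * tailScale t / h + 6 * T ^ 2 * M) ^ 2 +
        10 ^ 11 * 2500 ^ 4 * ((h ^ 2)⁻¹) ^ 2 * M ^ 2 / n ^ 3 := by
  rw [(integral_hsDeviation (integrable_norm_pow_bulk hint) (measurable_levelWeight h t)
    (levelWeight_bounds hh t)).2]
  exact integral_prod_centred_one_le hint hM hn (measurable_levelWeight h t) (levelWeight_neg h t)
    (levelWeight_bounds hh t) (by linarith)
    fun k hk θ hθ => levelWeight_weight_le hint hM hM1 hT ht ht2 hO hh hk hθ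

lemma integral_sq_marginalTail_sub_le (hμ : Measure.IsEven μ) :
    ∫ Y, (marginalTail (μ.restrict (bulk n)) Y t -
        ∫ Z, marginalTail (μ.restrict (bulk n)) Z t ∂sGauss n) ^ 2 ∂sGauss n ≤
      7500 / n * (250 * M * tailScale t) ^ 2 + 10 ^ 11 * 2500 ^ 4 * (1 / 2) ^ 2 * M / n ^ 4 := by
  have hν : Measure.IsEven (μ.restrict (bulk n)) :=
    isEven_restrict hμ measurableSet_bulk neg_mem_bulk
  have hg := measurable_evenTail t
  have hm := evenTail_bounds t
  have hsw : ∫ Z, marginalTail (μ.restrict (bulk n)) Z t ∂sGauss n =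
      ∫ x, (∫ Z, evenTail t ⟪x, Z⟫ ∂sGauss n) ∂(μ.restrict (bulk n)) := by
    rw [integral_congr_ae (ae_of_all _ fun Z => marginalTail_eq_evenTail hν Z ht)]
    refine integral_integral_swap ?_
    refine Integrable.of_bound (C := 1 / 2) ?_ (ae_of_all _ fun p => ?_)
    · have : Measurable fun p : EuclideanSpace ℝ (Fin n) × EuclideanSpace ℝ (Fin n) =>
          evenTail t (⟪p.2, p.1⟫ : ℝ) := hg.comp (by fun_prop)
      exact this.aestronglyMeasurable
    · have h1 := hm (⟪p.2, p.1⟫ : ℝ)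
      change ‖evenTail t (⟪p.2, p.1⟫ : ℝ)‖ ≤ 1 / 2
      rw [Real.norm_eq_abs, abs_of_nonneg h1.1]; exact h1.2
  have e : ∀ Y, marginalTail (μ.restrict (bulk n)) Y t -
        ∫ Z, marginalTail (μ.restrict (bulk n)) Z t ∂sGauss n =
      ∫ x, 1 * centred (evenTail t) x Y ∂(μ.restrict (bulk n)) := by
    intro Y
    rw [hsw, marginalTail_eq_evenTail hν Y ht, ← integral_sub]
    · simp only [one_mul]; rfl
    · refine Integrable.of_bound (C := 1 / 2) ?_ (ae_of_all _ fun x => ?_)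
      · exact (hg.comp (by fun_prop)).aestronglyMeasurable
      · have h1 := hm (⟪x, Y⟫ : ℝ)
        rw [Real.norm_eq_abs, abs_of_nonneg h1.1]; exact h1.2
    · refine Integrable.of_bound (C := 1 / 2) ?_ (ae_of_all _ fun x => ?_)
      · exact (measurable_integral_inner hg).aestronglyMeasurable
      · have h1 := integral_inner_bounds hg hm x
        rw [Real.norm_eq_abs, abs_of_nonneg h1.1]; exact h1.2
  simp only [e]
  rw [integral_sq_integral (μ.restrict (bulk n)) (sGauss n) (integrable_const (1 : ℝ))
    (H := centred (evenTail t)) (measurable_centred hg) (m := 1 / 2)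
    (fun x Y => abs_centred_le hg hm x Y)]
  simp only [one_mul]
  exact integral_prod_centred_zero_le hint hM hn hg (evenTail_neg t) hm (by linarith)
    fun k hk θ hθ => evenTail_weight_le hint hM hM1 hT ht ht2 hO hk hθ

end levels

lemma half_le_real_typical {Ω : Type*} [MeasurableSpace Ω] {P : Measure Ω} [IsProbabilityMeasure P]
    {f : Fin 3 → Ω → ℝ} {v : Fin 3 → ℝ} (hf0 : ∀ i x, 0 ≤ f i x) (hf : ∀ i, Measurable (f i))
    (hi : ∀ i, Integrable (f i) P) (hv : ∀ i, 0 < v i) (hle : ∀ i, ∫ x, f i x ∂P ≤ v i) :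
    MeasurableSet {x | ∀ i, f i x < 6 * v i} ∧ 1 / 2 ≤ P.real {x | ∀ i, f i x < 6 * v i} := by
  have hA : MeasurableSet {x | ∀ i, f i x < 6 * v i} := by
    rw [show {x | ∀ i, f i x < 6 * v i} = ⋂ i, {x | f i x < 6 * v i} by ext; simp]
    exact MeasurableSet.iInter fun i => measurableSet_lt (hf i) measurable_const
  refine ⟨hA, ?_⟩
  have h1 : P.real {x | ∀ i, f i x < 6 * v i}ᶜ ≤ ∑ i, P.real {x | 6 * v i ≤ f i x} := by
    refine (measureReal_mono (fun x hx => ?_) (measure_ne_top _ _)).trans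
      (measureReal_iUnion_fintype_le _)
    simp only [Set.mem_compl_iff, Set.mem_ofPred_eq, not_forall, not_lt] at hx
    simpa using hx
  have h2 : ∀ i, P.real {x | 6 * v i ≤ f i x} ≤ 1 / 6 := fun i => by
    have h := mul_meas_ge_le_integral_of_nonneg (ae_of_all P (hf0 i)) (hi i) (6 * v i)
    have h3 := h.trans (hle i)
    rw [mul_assoc] at h3
    nlinarith [hv i]
  have h3 := Finset.sum_le_sum fun i (_ : i ∈ Finset.univ) => h2 i
  simp only [Finset.sum_const, Finset.card_univ, Fintype.card_fin, nsmul_eq_mul] at h3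
  rw [probReal_compl_eq_one_sub hA] at h1
  norm_num at h3
  linarith

variable {n : ℕ} {μ : Measure (EuclideanSpace ℝ (Fin n))} [IsProbabilityMeasure μ]

lemma marginalTail_restrict_add_le {C₀ c₀ : ℝ} (hC : 0 < C₀) (hc : 0 < c₀)
    (hμ : HasPsiOneMarginals μ C₀ c₀) {S : Set (EuclideanSpace ℝ (Fin n))}
    {δ s : ℝ} (hδ : 0 < δ) (hs : 0 < s)
    {Y Z : EuclideanSpace ℝ (Fin n)} (hYZ : dist Z Y ≤ δ) (t : ℝ) :
    marginalTail (μ.restrict S) Z (t + s) ≤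
      marginalTail (μ.restrict S) Y t + C₀ * rexp (-(c₀ * (s / δ))) := by
  have h := psiOne_tail_le hC hc hμ hδ hs.le (θ := Z - Y) (by rwa [← dist_eq_norm])
  have h2 : marginalTail (μ.restrict S) Z (t + s) ≤
      (μ.restrict S).real ({x | t ≤ ⟪x, Y⟫} ∪ {x | s < ⟪x, Z - Y⟫}) := by
    apply measureReal_mono _ (measure_ne_top _ _)
    intro x hx
    simp only [Set.mem_ofPred_eq, Set.mem_union, inner_sub_right] at hx ⊢
    by_contra! hcon
    linarith
  have h3 : (μ.restrict S).real {x | s < ⟪x, Z - Y⟫} ≤ μ.real {x | s < ⟪x, Z - Y⟫} :=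
    ENNReal.toReal_mono (measure_ne_top _ _) (Measure.restrict_apply_le S _)
  exact h2.trans ((measureReal_union_le _ _).trans (by unfold marginalTail; linarith))

lemma marginalTail_eq_add_restrict {S : Set (EuclideanSpace ℝ (Fin n))} (hS : MeasurableSet S)
    (Z : EuclideanSpace ℝ (Fin n)) (t : ℝ) :
    marginalTail μ Z t = marginalTail (μ.restrict S) Z t + marginalTail (μ.restrict Sᶜ) Z t := by
  have hm : MeasurableSet {x : EuclideanSpace ℝ (Fin n) | t ≤ ⟪x, Z⟫} :=
    measurableSet_le measurable_const (by fun_prop)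
  unfold marginalTail
  rw [measureReal_restrict_apply hm, measureReal_restrict_apply hm]
  have := measureReal_inter_add_sdiff (μ := μ) (s := {x : EuclideanSpace ℝ (Fin n) | t ≤ ⟪x, Z⟫}) hS
  rw [← this, Set.sdiff_eq]

lemma scaledTail_le_of_lt {r t : ℝ} (hr : 0 ≤ r) (hr' : r < 1 / 50) (ht : 0 ≤ t) :
    scaledTail r t ≤ gaussTail (50 * t) := by
  unfold scaledTail
  split_ifs with h
  · exact (gaussTail_pos _).le
  · have h1 : 0 < r := lt_of_le_of_ne hr (Ne.symm h)
    apply gaussTail_anti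
    rw [le_div_iff₀ h1]
    nlinarith

lemma integral_marginalTail_compl_bulk_le (hn : 0 < n) {t : ℝ} (ht : 0 < t) {p : ℝ}
    (hp : μ.real (bulk n)ᶜ ≤ p) :
    ∫ Z, marginalTail (μ.restrict (bulk n)ᶜ) Z t ∂sGauss n ≤ p * gaussTail (50 * t) := by
  rw [integral_marginalTail_sGauss hn ht]
  have h1 : ∫ x in (bulk n)ᶜ, scaledTail (‖x‖ / √n) t ∂μ ≤
      ∫ x in (bulk n)ᶜ, gaussTail (50 * t) ∂μ := by
    refine setIntegral_mono_on (integrable_scaledTail t).integrableOn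
      (integrable_const _).integrableOn measurableSet_bulk.compl fun x hx => ?_
    exact scaledTail_le_of_lt (by positivity) (not_le.1 hx) ht.le
  refine h1.trans ?_
  rw [setIntegral_const, smul_eq_mul]
  exact mul_le_mul_of_nonneg_right hp (gaussTail_pos _).le

lemma gaussTail_twentyfive_mul_le {t : ℝ} (ht : 1 / 5 ≤ t) :
    gaussTail (25 * t) ≤ 1 / 1000 * gaussTail t := by
  have h := gaussTail_mul_le (K := 25) (t := t) (by norm_num) (by linarith)
  have h1 : rexp (-((25 : ℝ) ^ 2 - 1) * t ^ 2 / 2) ≤ rexp (-12) := by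
    apply Real.exp_le_exp.2; nlinarith
  have h2 : rexp (-12) ≤ 1 / 25000 := by
    rw [Real.exp_neg, ← one_div]
    apply one_div_le_one_div_of_le (by norm_num)
    have h3 := Real.exp_one_gt_d9
    have : rexp 12 = rexp 1 ^ 12 := by rw [← Real.exp_nat_mul]; norm_num
    rw [this]
    calc (25000 : ℝ) ≤ 2.7 ^ 12 := by norm_num
      _ ≤ rexp 1 ^ 12 := by gcongr; linarith
  refine h.trans ?_
  have h4 := gaussTail_pos t
  nlinarith

section core
variable {C₀ c₀ : ℝ} (hC : 0 < C₀) (hc : 0 < c₀) (hψ : HasPsiOneMarginals μ C₀ c₀)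
  (hμ : Measure.IsEven μ) (hn : 0 < n) {ε t h δ V W : ℝ} (hε : 0 < ε) (hε1 : ε ≤ 1 / 10)
  (ht : 0 < t) (hh : 0 < h) (hδ : 0 < δ)
  (hm : μ.real (bulk n)ᶜ ≤ 4 * ε)
  (hpsi : 1 / 5 ≤ t → C₀ * rexp (-(c₀ * (t / 2 / δ))) ≤ ε / 20 * gaussTail t)

include hC hc hψ hμ hε ht hh hδ hm hpsi in
lemma marginalTail_compl_bulk_le {Y Z : EuclideanSpace ℝ (Fin n)}
    (hY : marginalTail (μ.restrict (bulk n)ᶜ) Y (t / 2) ≤ 6 * (4 * ε * gaussTail (50 * (t / 2))))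
    (hYZ : dist Z Y ≤ δ) :
    marginalTail (μ.restrict (bulk n)ᶜ) Z (t + h) ≤ 4.8 * ε * gaussTail t := by
  rcases le_total t (1 / 5) with h5 | h5
  · have hev : Measure.IsEven (μ.restrict (bulk n)ᶜ) :=
      isEven_restrict hμ measurableSet_bulk.compl fun x => not_congr (neg_mem_bulk x)
    have h1 := marginalTail_restrict_le hev Z (t := t + h) (by linarith)
    rw [measureReal_restrict_apply_univ] at h1
    have h2 := half_sub_le_gaussTail ht.le
    nlinarith
  · have h1 := marginalTail_restrict_add_le (S := (bulk n)ᶜ) hC hc hψ hδ (half_pos ht) hYZ (t / 2)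
    have h2 := marginalTail_anti (μ := μ.restrict (bulk n)ᶜ) Z (s := t / 2 + t / 2) (t := t + h)
      (by linarith)
    have h3 := gaussTail_twentyfive_mul_le h5
    have h4 := hpsi h5
    rw [show 50 * (t / 2) = 25 * t by ring] at hY
    have h5 := gaussTail_pos t
    nlinarith

include hn ht hm hε in
lemma integral_marginalTail_compl_bulk_le' :
    ∫ Z, marginalTail (μ.restrict (bulk n)ᶜ) Z t ∂sGauss n ≤ 4.8 * ε * gaussTail t := by
  have h1 := integral_marginalTail_compl_bulk_le hn ht hm
  rcases le_total t (1 / 5) with h5 | h5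
  · have h2 := half_sub_le_gaussTail ht.le
    have h3 := gaussTail_le_half (t := 50 * t) (by linarith)
    nlinarith
  · have h3 := gaussTail_twentyfive_mul_le h5
    have h4 : gaussTail (50 * t) ≤ gaussTail (25 * t) := gaussTail_anti (by linarith)
    have h5 := gaussTail_pos t
    nlinarith

variable (hint : ∀ j : ℕ, Integrable (fun x => ‖x‖ ^ j) (μ.restrict (bulk n)))
  (ha : |∫ Z, marginalTail μ Z t ∂sGauss n - gaussTail t| ≤ 2 * ε * gaussTail t)
  (hV0 : ∫ Y, (marginalTail (μ.restrict (bulk n)) Y t -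
        ∫ Z, marginalTail (μ.restrict (bulk n)) Z t ∂sGauss n) ^ 2 ∂sGauss n ≤
      (ε / 20 * gaussTail t) ^ 2 / 6)
  (hV : 0 < V) (hV1 : ∫ Y, hsDeviation (μ.restrict (bulk n)) (levelWeight h t) Y ∂sGauss n ≤ V)
  (hW : ∀ θ : EuclideanSpace ℝ (Fin n), ‖θ‖ = 1 →
    ∫ x, (⟪x, θ⟫ : ℝ) ^ 2 * radialWeight (levelWeight h t) x ∂(μ.restrict (bulk n)) ≤ W)
  (hQ : δ ^ 2 * (√(6 * V) + W) ≤ ε / 20 * gaussTail t)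
  (hh2 : 3 * (1 + t + h) * h ≤ ε / 2)

omit [IsProbabilityMeasure μ] in
lemma integrable_sq_marginalTail_sub [IsFiniteMeasure μ] (a : ℝ) :
    Integrable (fun Y => (marginalTail μ Y t - a) ^ 2) (sGauss n) := by
  refine Integrable.of_bound (C := (μ.real Set.univ + |a|) ^ 2)
    (((measurable_marginalTail t).sub_const a).pow_const 2).aestronglyMeasurable
    (ae_of_all _ fun Y => ?_)
  rw [Real.norm_eq_abs, abs_pow]
  have h1 : marginalTail μ Y t ≤ μ.real Set.univ :=
    measureReal_mono (Set.subset_univ _) (measure_ne_top _ _)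
  have h2 := marginalTail_nonneg (μ := μ) Y t
  gcongr
  refine (abs_sub _ _).trans ?_
  rw [abs_of_nonneg h2]
  gcongr

include hn hε ht hh hm hint hV0 hV hV1 in
/-- Directions at which the bulk marginal tail, the weighted second moments and the tail of the
small-norm part are all close to their averages. -/
lemma exists_typical_set : ∃ A : Set (EuclideanSpace ℝ (Fin n)), MeasurableSet A ∧
    1 / 2 ≤ (sGauss n).real A ∧ ∀ Y ∈ A,
      |marginalTail (μ.restrict (bulk n)) Y t -
        ∫ Z, marginalTail (μ.restrict (bulk n)) Z t ∂sGauss n| ≤ ε / 20 * gaussTail t ∧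
      hsDeviation (μ.restrict (bulk n)) (levelWeight h t) Y ≤ 6 * V ∧
      marginalTail (μ.restrict (bulk n)ᶜ) Y (t / 2) ≤
        6 * (4 * ε * gaussTail (50 * (t / 2))) := by
  have hP := gaussTail_pos t
  have hP2 := gaussTail_pos (50 * (t / 2))
  obtain ⟨a, hae⟩ : ∃ a, a = ∫ Z, marginalTail (μ.restrict (bulk n)) Z t ∂sGauss n := ⟨_, rfl⟩
  rw [← hae] at hV0 ⊢
  have hb : 0 < ε / 20 * gaussTail t := by positivity
  obtain ⟨h1, h2⟩ := half_le_real_typical (P := sGauss n)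
    (f := ![fun Y => (marginalTail (μ.restrict (bulk n)) Y t - a) ^ 2,
      hsDeviation (μ.restrict (bulk n)) (levelWeight h t),
      fun Y => marginalTail (μ.restrict (bulk n)ᶜ) Y (t / 2)])
    (v := ![(ε / 20 * gaussTail t) ^ 2 / 6, V, 4 * ε * gaussTail (50 * (t / 2))])
    (by
      intro i x; fin_cases i
      · exact sq_nonneg _
      · exact hsDeviation_nonneg x
      · exact marginalTail_nonneg _ _)
    (by
      intro i; fin_cases i
      · exact ((measurable_marginalTail t).sub_const a).pow_const 2
      · exact measurable_hsDeviation (measurable_levelWeight h t)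
      · exact measurable_marginalTail _)
    (by
      intro i; fin_cases i
      · exact integrable_sq_marginalTail_sub a
      · exact (integral_hsDeviation hint (measurable_levelWeight h t)
          (levelWeight_bounds hh t)).1
      · exact integrable_marginalTail _)
    (by
      intro i; fin_cases i
      · change 0 < (ε / 20 * gaussTail t) ^ 2 / 6
        positivity
      · exact hV
      · change 0 < 4 * ε * gaussTail (50 * (t / 2))
        positivity)
    (by
      intro i; fin_cases i
      · exact hV0
      · exact hV1
      · exact integral_marginalTail_compl_bulk_le hn (half_pos ht) hm)
  refine ⟨_, h1, h2, fun Y hY => ⟨?_, (hY 1).le, (hY 2).le⟩⟩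
  have h3 : (marginalTail (μ.restrict (bulk n)) Y t - a) ^ 2 <
      6 * ((ε / 20 * gaussTail t) ^ 2 / 6) := hY 0
  exact abs_le_of_sq_le_sq (by linarith) hb.le

include hint hW hQ hε hh in
lemma integral_levelWeight_step_le {Y Z : EuclideanSpace ℝ (Fin n)}
    (hY : hsDeviation (μ.restrict (bulk n)) (levelWeight h t) Y ≤ 6 * V) (hYZ : dist Z Y ≤ δ) :
    ∫ x, levelWeight h t ⟪x, Y⟫ * ⟪x, Z - Y⟫ ^ 2 ∂(μ.restrict (bulk n)) ≤
      ε / 20 * gaussTail t := by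
  by_cases hneg : √(hsDeviation (μ.restrict (bulk n)) (levelWeight h t) Y) + W < 0
  · have h1 := integral_quad_le hint (measurable_levelWeight h t) (levelWeight_bounds hh t) hW Y
      (Z - Y)
    have h2 : ‖Z - Y‖ ^ 2 * (√(hsDeviation (μ.restrict (bulk n)) (levelWeight h t) Y) + W) ≤ 0 :=
      mul_nonpos_of_nonneg_of_nonpos (sq_nonneg _) hneg.le
    have h3 : 0 ≤ ε / 20 * gaussTail t := mul_nonneg (by linarith) (gaussTail_pos t).le
    linarith
  · have h1 := integral_quad_le hint (measurable_levelWeight h t) (levelWeight_bounds hh t) hW Y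
      (Z - Y)
    have h2 : ‖Z - Y‖ ^ 2 ≤ δ ^ 2 := by
      rw [← dist_eq_norm]; gcongr
    refine h1.trans (le_trans ?_ hQ)
    have h3 := Real.sqrt_le_sqrt hY
    exact mul_le_mul h2 (by linarith) (not_lt.1 hneg) (sq_nonneg _)

include hC hc hψ hμ hn hε hε1 ht hh hδ hm hpsi hint ha hV0 hV hV1 hW hQ hh2

lemma radial_upper :
    (sGauss n).real {Z | (1 + 8 * ε) * gaussTail (t + h) < marginalTail μ Z (t + h)} ≤
      2 * rexp (-(n * δ ^ 2) / 5) := by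
  obtain ⟨A, hA, hA2, hY⟩ := exists_typical_set hn hε ht hh hm hint hV0 hV hV1
  have key := sGauss_real_le_of_dist hn hA
    (measurableSet_lt_marginalTail (μ := μ) (t + h) ((1 + 8 * ε) * gaussTail (t + h))) hδ.le ?_
    (by norm_num) hA2
  · norm_num at key ⊢; exact key
  intro Y hYA Z hZ
  by_contra! hd
  rw [dist_comm] at hd
  obtain ⟨y1, y2, y3⟩ := hY Y hYA
  have s1 := marginalTail_compl_bulk_le hC hc hψ hμ hε ht hh hδ hm hpsi y3 hd.le
  have s2 := integral_levelWeight_step_le hε hh hint hW hQ y2 hd.le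
  have s3 := marginalTail_add_le_integral hint hh ht.le Y Z
  have s4 := marginalTail_eq_add_restrict (μ := μ) measurableSet_bulk Z (t + h)
  have s5 : ∫ Z, marginalTail (μ.restrict (bulk n)) Z t ∂sGauss n ≤
      ∫ Z, marginalTail μ Z t ∂sGauss n := by
    refine integral_mono (integrable_marginalTail t) (integrable_marginalTail t) fun Z => ?_
    have h1 := marginalTail_eq_add_restrict (μ := μ) measurableSet_bulk Z t
    have h2 := marginalTail_nonneg (μ := μ.restrict (bulk n)ᶜ) Z t
    change marginalTail (μ.restrict (bulk n)) Z t ≤ marginalTail μ Z t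
    linarith
  have hP := gaussTail_pos t
  have hP' := gaussTail_pos (t + h)
  have s6 : gaussTail t ≤ gaussTail (t + h) * (1 + 0.6 * ε) := by
    refine (gaussTail_le_exp_mul (s := t) (t := t + h) (by linarith) (by linarith)).trans ?_
    gcongr
    have h1 : 3 * (1 + (t + h)) * (t + h - t) ≤ ε / 2 := by
      rw [← add_assoc, add_sub_cancel_left]; exact hh2
    have h2 := Real.exp_le_exp.2 h1
    have h3 := Real.exp_bound_div_one_sub_of_interval (x := ε / 2) (by linarith) (by linarith)
    refine (h2.trans h3).trans ?_
    rw [div_le_iff₀ (by linarith)]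
    nlinarith
  rw [Set.mem_ofPred_eq] at hZ
  rw [abs_le] at y1 ha
  have s7 : marginalTail μ Z (t + h) ≤ (1 + 6.9 * ε) * gaussTail t := by linarith
  have s8 : (1 + 6.9 * ε) * gaussTail t ≤ (1 + 8 * ε) * gaussTail (t + h) := by
    calc _ ≤ (1 + 6.9 * ε) * (gaussTail (t + h) * (1 + 0.6 * ε)) := by gcongr
      _ = ((1 + 6.9 * ε) * (1 + 0.6 * ε)) * gaussTail (t + h) := by ring
      _ ≤ _ := by gcongr; nlinarith
  linarith

omit hC hc hψ hμ hpsi in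
lemma radial_lower :
    (sGauss n).real {Z | marginalTail μ Z (t - h) < (1 - 8 * ε) * gaussTail (t - h)} ≤
      2 * rexp (-(n * δ ^ 2) / 5) := by
  obtain ⟨A, hA, hA2, hY⟩ := exists_typical_set hn hε ht hh hm hint hV0 hV hV1
  have key := sGauss_real_le_of_dist hn hA
    (measurableSet_marginalTail_lt (μ := μ) (t - h) ((1 - 8 * ε) * gaussTail (t - h))) hδ.le ?_
    (by norm_num) hA2
  · norm_num at key ⊢; exact key
  intro Y hYA Z hZ
  by_contra! hd
  rw [dist_comm] at hd
  obtain ⟨y1, y2, -⟩ := hY Y hYA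
  have s1 := integral_marginalTail_compl_bulk_le' hn hε ht hm
  have s2 := integral_levelWeight_step_le hε hh hint hW hQ y2 hd.le
  have s3 := marginalTail_le_sub_integral hint hh ht.le Y Z
  have s4 := marginalTail_eq_add_restrict (μ := μ) measurableSet_bulk Z (t - h)
  have s4' := marginalTail_nonneg (μ := μ.restrict (bulk n)ᶜ) Z (t - h)
  have s5 : ∫ Z, marginalTail μ Z t ∂sGauss n =
      ∫ Z, marginalTail (μ.restrict (bulk n)) Z t ∂sGauss n +
        ∫ Z, marginalTail (μ.restrict (bulk n)ᶜ) Z t ∂sGauss n := by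
    rw [← integral_add (integrable_marginalTail t) (integrable_marginalTail t)]
    exact integral_congr_ae (ae_of_all _ fun Z =>
      marginalTail_eq_add_restrict (μ := μ) measurableSet_bulk Z t)
  have hP := gaussTail_pos t
  have hP' := gaussTail_pos (t - h)
  have s6 : (1 - ε / 2) * gaussTail (t - h) ≤ gaussTail t := by
    have h0 := gaussTail_le_exp_mul (s := t - h) (t := t) (by linarith) ht.le
    have h1 : 3 * (1 + t) * (t - (t - h)) ≤ ε / 2 := by nlinarith
    have h2 := h0.trans (mul_le_mul_of_nonneg_left (Real.exp_le_exp.2 h1) hP.le)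
    have h3 := Real.one_sub_le_exp_neg (ε / 2)
    have h4 : rexp (ε / 2) * rexp (-(ε / 2)) = 1 := by rw [← Real.exp_add]; simp
    calc (1 - ε / 2) * gaussTail (t - h) ≤
          rexp (-(ε / 2)) * (gaussTail t * rexp (ε / 2)) := by gcongr
      _ = gaussTail t * (rexp (ε / 2) * rexp (-(ε / 2))) := by ring
      _ = gaussTail t := by rw [h4, mul_one]
  rw [Set.mem_ofPred_eq] at hZ
  rw [abs_le] at y1 ha
  have s7 : (1 - 6.9 * ε) * gaussTail t ≤ marginalTail μ Z (t - h) := by linarith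
  have s8 : (1 - 8 * ε) * gaussTail (t - h) ≤ (1 - 6.9 * ε) * gaussTail t := by
    calc _ ≤ ((1 - 6.9 * ε) * (1 - ε / 2)) * gaussTail (t - h) := by gcongr; nlinarith
      _ = (1 - 6.9 * ε) * ((1 - ε / 2) * gaussTail (t - h)) := by ring
      _ ≤ _ := by
        apply mul_le_mul_of_nonneg_left s6; linarith
  linarith

end core

section numerics
variable {ε T : ℝ}

lemma le_exp_pow_ten (hε : 0 < ε) (hR : 40 * T ^ 2 ≤ log (1 / ε)) :
    ε ≤ rexp (-(2 * T) ^ 2) ^ 10 := by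
  rw [← Real.exp_nat_mul]
  calc ε = rexp (-log (1 / ε)) := by
        rw [one_div, Real.log_inv, neg_neg, Real.exp_log hε]
    _ ≤ _ := by
        apply Real.exp_le_exp.2
        push_cast
        linarith

lemma le_gaussTail_of_radial (hε : 0 < ε) (hR : 40 * T ^ 2 ≤ log (1 / ε)) (hT : 1 ≤ T)
    {t : ℝ} (ht2 : t ≤ 2 * T) : ε / 12 ≤ gaussTail t := by
  have h1 := le_exp_pow_ten hε hR
  have h2 := le_gaussTail (t := 2 * T) (by linarith)
  have h3 : rexp (-(2 * T) ^ 2) ^ 10 ≤ rexp (-(2 * T) ^ 2) :=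
    pow_le_of_le_one (Real.exp_pos _).le (Real.exp_le_one_iff.2 (by nlinarith)) (by norm_num)
  have h4 := gaussTail_anti ht2
  linarith

lemma off_band_bound_le (hε : 0 < ε) (hε0 : ε ≤ 1 / 10 ^ 40) (hR : 40 * T ^ 2 ≤ log (1 / ε))
    (hT : 1 ≤ T) : 10 ^ 12 * ε / (1 / (16 * T ^ 2)) ^ 2 ≤ gaussTail (2 * T) ^ 2 := by
  have h1 := le_exp_pow_ten hε hR
  have h2 := le_gaussTail (t := 2 * T) (by linarith)
  have h3 : T ^ 2 * rexp (-(2 * T) ^ 2) ≤ 1 := by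
    have h4 := Real.add_one_le_exp ((2 * T) ^ 2)
    rw [Real.exp_neg, ← div_eq_mul_inv, div_le_one (Real.exp_pos _)]
    nlinarith
  have h5 : rexp (-(2 * T) ^ 2) ≤ 1 := Real.exp_le_one_iff.2 (by nlinarith)
  have h6 := Real.exp_pos (-(2 * T) ^ 2)
  generalize rexp (-(2 * T) ^ 2) = e at *
  have hw0 : 0 < √ε := Real.sqrt_pos.2 hε
  have hw := Real.sq_sqrt hε.le
  have hw1 : √ε ≤ e ^ 5 := by
    rw [Real.sqrt_le_left (by positivity)]; rw [← pow_mul]; exact h1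
  have hw2 : √ε ≤ 1 / 10 ^ 20 := by
    rw [Real.sqrt_le_left (by norm_num)]; norm_num at *; exact hε0
  have e1 : 10 ^ 12 * ε / (1 / (16 * T ^ 2)) ^ 2 = 256000000000000 * T ^ 4 * (√ε * √ε) := by
    rw [← pow_two, hw]; field_simp; ring
  rw [e1]
  calc 256000000000000 * T ^ 4 * (√ε * √ε) ≤ 256000000000000 * T ^ 4 * ((1 / 10 ^ 20) * e ^ 5) := by
        gcongr
    _ = 0.00000256 * ((T ^ 2 * e) ^ 2 * e) * e ^ 2 := by ring
    _ ≤ 0.00000256 * (1 ^ 2 * 1) * e ^ 2 := by gcongr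
    _ ≤ (e / 12) ^ 2 := by nlinarith [sq_nonneg e]
    _ ≤ _ := by gcongr

variable {n : ℕ} {M D t : ℝ}

lemma tailScale_le (hT : 1 ≤ T) (ht : 0 < t) (ht2 : t ≤ 2 * T) :
    tailScale t ≤ 27 * T ^ 3 * gaussTail t := by
  unfold tailScale
  have h1 : (1 + t) ^ 3 ≤ (3 * T) ^ 3 := by gcongr; linarith
  have := gaussTail_pos t
  nlinarith

lemma tailScale_nonneg (ht : 0 < t) : 0 ≤ tailScale t :=
  mul_nonneg (by positivity) (gaussTail_pos t).le

variable (hn : 0 < n) (hε : 0 < ε) (hε0 : ε ≤ 1 / 10 ^ 40) (hT : 1 ≤ T)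
  (hM : 1 ≤ M) (hD : 1000 * M ≤ D) (hN : T ^ 6 * (10 ^ 20 * D ^ 2) ≤ n * ε ^ 2)
  (ht : 0 < t) (ht2 : t ≤ 2 * T) (hg : ε / 12 ≤ gaussTail t)

include hn hM hD hN hT

lemma pow_six_div_le : T ^ 6 / n ≤ ε ^ 2 / (10 ^ 26 * M ^ 2) := by
  have hn' : (0 : ℝ) < n := by exact_mod_cast hn
  rw [div_le_div_iff₀ hn' (by positivity)]
  have h1 : 10 ^ 6 * M ^ 2 ≤ D ^ 2 := by nlinarith
  have h2 : T ^ 6 * (10 ^ 20 * (10 ^ 6 * M ^ 2)) ≤ T ^ 6 * (10 ^ 20 * D ^ 2) := by gcongr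
  nlinarith

lemma one_div_le_sq : M * (1 / n) ≤ ε ^ 2 / 10 ^ 26 := by
  have hn' : (0 : ℝ) < n := by exact_mod_cast hn
  have h1 := pow_six_div_le hn hT hM hD hN
  have h2 : M * (1 / n) ≤ M ^ 2 * (T ^ 6 / n) := by
    rw [mul_one_div, mul_div_assoc']
    gcongr
    have : 1 ≤ T ^ 6 := one_le_pow₀ hT
    nlinarith
  refine h2.trans ((mul_le_mul_of_nonneg_left h1 (sq_nonneg _)).trans (le_of_eq ?_))
  field_simp

include hε hε0 ht ht2 hg

lemma variance_bound_le :
    7500 / n * (250 * M * tailScale t) ^ 2 + 10 ^ 11 * 2500 ^ 4 * (1 / 2) ^ 2 * M / n ^ 4 ≤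
      (ε / 20 * gaussTail t) ^ 2 / 6 := by
  have hn' : (0 : ℝ) < n := by exact_mod_cast hn
  have h1 := pow_six_div_le hn hT hM hD hN
  have h2 := one_div_le_sq hn hT hM hD hN
  have h3 := tailScale_le hT ht ht2
  have h4 := tailScale_nonneg ht
  have h5 := gaussTail_pos t
  generalize gaussTail t = g at *
  have a1 : 7500 / n * (250 * M * tailScale t) ^ 2 ≤ 0.000000000001 * (ε * g) ^ 2 := by
    calc 7500 / n * (250 * M * tailScale t) ^ 2
        ≤ 7500 / n * (250 * M * (27 * T ^ 3 * g)) ^ 2 := by gcongr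
      _ = (7500 * 250 ^ 2 * 27 ^ 2) * M ^ 2 * g ^ 2 * (T ^ 6 / n) := by field_simp
      _ ≤ (7500 * 250 ^ 2 * 27 ^ 2) * M ^ 2 * g ^ 2 * (ε ^ 2 / (10 ^ 26 * M ^ 2)) := by gcongr
      _ = (7500 * 250 ^ 2 * 27 ^ 2 / 10 ^ 26) * (ε * g) ^ 2 := by field_simp
      _ ≤ _ := by gcongr; norm_num
  have hq : (1 : ℝ) / n ≤ ε ^ 2 / 10 ^ 26 := by
    refine le_trans ?_ h2
    have : 0 ≤ (1 : ℝ) / n := by positivity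
    nlinarith
  have hq1 : (1 : ℝ) / n ≤ 1 := by
    refine hq.trans ?_
    rw [div_le_one (by norm_num)]; nlinarith
  have a2 : 10 ^ 11 * 2500 ^ 4 * (1 / 2) ^ 2 * M / (n : ℝ) ^ 4 ≤ 0.000000000001 * (ε * g) ^ 2 := by
    calc 10 ^ 11 * 2500 ^ 4 * (1 / 2) ^ 2 * M / (n : ℝ) ^ 4
        = (10 ^ 11 * 2500 ^ 4 * (1 / 2) ^ 2) * (M * (1 / n)) * (1 / n) * (1 / n) ^ 2 := by
          field_simp
      _ ≤ (10 ^ 11 * 2500 ^ 4 * (1 / 2) ^ 2) * (ε ^ 2 / 10 ^ 26) * (ε ^ 2 / 10 ^ 26) * 1 ^ 2 := by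
          gcongr
      _ = (10 ^ 11 * 2500 ^ 4 * (1 / 2) ^ 2 * 144 / 10 ^ 52) * (ε * (ε / 12)) ^ 2 := by ring
      _ ≤ 0.000000000001 * (ε * g) ^ 2 := by
          gcongr; norm_num
  have a3 : (ε / 20 * g) ^ 2 / 6 = 1 / 2400 * (ε * g) ^ 2 := by ring
  rw [a3]
  nlinarith [sq_nonneg (ε * g)]

omit hε hε0 ht ht2 hg hM hD hN hT in
lemma sqrt_deviation_le {h W V : ℝ} (hM : 1 ≤ M) (hh0 : 0 < h) (hW0 : 0 ≤ W)
    (hV : V = 7500 * W ^ 2 + 10 ^ 11 * 2500 ^ 4 * ((h ^ 2)⁻¹) ^ 2 * M ^ 2 / n ^ 3) :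
    √(6 * V) ≤ 220 * W + 10 ^ 13 * ((h ^ 2)⁻¹ * M / n) := by
  have hn' : (0 : ℝ) < n := by exact_mod_cast hn
  have hn1 : (1 : ℝ) ≤ n := by exact_mod_cast hn
  have hX0 : 0 ≤ (h ^ 2)⁻¹ * M / n := by positivity
  have s2 : ((h ^ 2)⁻¹) ^ 2 * M ^ 2 / n ^ 3 ≤ ((h ^ 2)⁻¹ * M / n) ^ 2 := by
    rw [div_pow, mul_pow]
    gcongr
    norm_num
  have s3 : V ≤ 7500 * W ^ 2 + 10 ^ 11 * 2500 ^ 4 * ((h ^ 2)⁻¹ * M / n) ^ 2 := by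
    rw [hV]
    have := mul_le_mul_of_nonneg_left s2 (show (0 : ℝ) ≤ 10 ^ 11 * 2500 ^ 4 by norm_num)
    calc _ = 7500 * W ^ 2 + 10 ^ 11 * 2500 ^ 4 * (((h ^ 2)⁻¹) ^ 2 * M ^ 2 / n ^ 3) := by ring
      _ ≤ _ := by linarith
  rw [Real.sqrt_le_left (by positivity)]
  clear hV s2
  generalize (h ^ 2)⁻¹ * M / n = X at *
  have := mul_nonneg hW0 hX0
  have h1 := sq_nonneg W
  have h2 := sq_nonneg X
  have e : (220 * W + 10 ^ 13 * X) ^ 2 = 48400 * W ^ 2 + 4400000000000000 * (W * X) + 10 ^ 26 * X ^ 2 := by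
    ring
  rw [e]
  linarith

omit ht ht2 hg hε0 in
lemma sq_step_mul_le {h δ : ℝ} (hh0 : 0 < h) (hδ : δ = h / (D * T ^ 2)) :
    δ ^ 2 * ((h ^ 2)⁻¹ * M / n) ≤ (1 / 10 ^ 26) * ε ^ 2 := by
  have hn' : (0 : ℝ) < n := by exact_mod_cast hn
  have h2 := one_div_le_sq hn hT hM hD hN
  have hD0 : 0 < D := by linarith
  have : δ ^ 2 * ((h ^ 2)⁻¹ * M / n) = (M * (1 / n)) / (D ^ 2 * T ^ 4) := by
    rw [hδ]; field_simp
  rw [this]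
  have hDT : 1 ≤ D ^ 2 * T ^ 4 :=
    one_le_mul_of_one_le_of_one_le (one_le_pow₀ (by linarith)) (one_le_pow₀ hT)
  refine (div_le_self (by positivity) hDT).trans (h2.trans (le_of_eq ?_))
  ring

omit hN hn hε0 hg in
lemma sq_step_mul_weight_le {h δ W : ℝ} (hh : h = ε / (1000 * T)) (hδ : δ = h / (D * T ^ 2))
    (hW : W = 1340 * M * tailScale t / h + 6 * T ^ 2 * M) :
    δ ^ 2 * W ≤ 0.000037 * (ε * gaussTail t) + 0.00000000001 * ε ^ 2 := by
  have h3 := tailScale_le hT ht ht2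
  have h5 := gaussTail_pos t
  have h4 := tailScale_nonneg ht
  have hD0 : 0 < D := by linarith
  have hMD : M / D ^ 2 ≤ 0.000001 := by
    rw [div_le_iff₀ (by positivity)]; nlinarith
  have hT2 : 1 ≤ T ^ 2 := one_le_pow₀ hT
  have hT4 : 1 ≤ T ^ 4 := one_le_pow₀ hT
  generalize gaussTail t = g at *
  generalize tailScale t = A at *
  have e : δ ^ 2 * W = 1.34 * ε * (M / D ^ 2) * (A / T ^ 5) +
      0.000006 * ε ^ 2 * (M / D ^ 2) * (1 / T ^ 4) := by
    rw [hW, hδ, hh]; field_simp; ring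
  rw [e]
  have b1 : A / T ^ 5 ≤ 27 * g := by
    rw [div_le_iff₀ (by positivity)]
    calc A ≤ 27 * T ^ 3 * g := h3
      _ ≤ 27 * T ^ 3 * g * T ^ 2 := le_mul_of_one_le_right (by positivity) hT2
      _ = _ := by ring
  have b2 : 1 / T ^ 4 ≤ 1 := div_le_one_of_le₀ hT4 (by positivity)
  have b3 := mul_pos hε h5
  have b4 := sq_nonneg ε
  calc _ ≤ 1.34 * ε * 0.000001 * (27 * g) + 0.000006 * ε ^ 2 * 0.000001 * 1 := by gcongr
    _ = 0.00003618 * (ε * g) + 0.000000000006 * ε ^ 2 := by ring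
    _ ≤ _ := by linarith

lemma step_bound_le {h δ W V : ℝ} (hh : h = ε / (1000 * T)) (hδ : δ = h / (D * T ^ 2))
    (hW : W = 1340 * M * tailScale t / h + 6 * T ^ 2 * M)
    (hV : V = 7500 * W ^ 2 + 10 ^ 11 * 2500 ^ 4 * ((h ^ 2)⁻¹) ^ 2 * M ^ 2 / n ^ 3) :
    δ ^ 2 * (√(6 * V) + W) ≤ ε / 20 * gaussTail t := by
  have hh0 : 0 < h := by rw [hh]; positivity
  have hW0 : 0 ≤ W := by
    have := tailScale_nonneg ht
    rw [hW]; positivity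
  have s1 := sqrt_deviation_le hn hM hh0 hW0 hV
  have s4 := sq_step_mul_le hn hε hT hM hD hN hh0 hδ
  have s5 := sq_step_mul_weight_le hε hT hM hD ht ht2 hh hδ hW
  have s6 := mul_le_mul_of_nonneg_left s1 (sq_nonneg δ)
  have h5 := mul_pos hε (gaussTail_pos t)
  have s7 : ε ^ 2 ≤ 12 * (ε * gaussTail t) := by nlinarith
  calc δ ^ 2 * (√(6 * V) + W) = δ ^ 2 * √(6 * V) + δ ^ 2 * W := by ring
    _ ≤ δ ^ 2 * (220 * W + 10 ^ 13 * ((h ^ 2)⁻¹ * M / n)) + δ ^ 2 * W := by gcongr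
    _ = 221 * (δ ^ 2 * W) + 10 ^ 13 * (δ ^ 2 * ((h ^ 2)⁻¹ * M / n)) := by ring
    _ ≤ 221 * (0.000037 * (ε * gaussTail t) + 0.00000000001 * ε ^ 2) + 10 ^ 13 * ((1 / 10 ^ 26) * ε ^ 2) := by
        gcongr
    _ ≤ ε / 20 * gaussTail t := by linarith

end numerics

section regimes
variable {n : ℕ} {μ : Measure (EuclideanSpace ℝ (Fin n))} [IsProbabilityMeasure μ]
  {C₀ c₀ : ℝ} (hC : 0 < C₀) (hc : 0 < c₀) (hψ : HasPsiOneMarginals μ C₀ c₀)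
  (hμ : Measure.IsEven μ) (hn : 0 < n) {ε T h δ M D : ℝ}
  (hε : 0 < ε) (hε0 : ε ≤ 1 / 10 ^ 40) (hT : 1 ≤ T)
  (hD2 : 50 + log (12 * (C₀ + 1)) ≤ c₀ * D)
  (hh : h = ε / (1000 * T)) (hδ : δ = h / (D * T ^ 2))
  (ha : ∀ t, 0 < t → t ≤ T + 8 * h →
    |∫ Z, marginalTail μ Z t ∂sGauss n - gaussTail t| ≤ 2 * ε * gaussTail t)

include hC in
lemma le_exp_scale {x : ℝ} (hx : 1 ≤ x) (hD2 : 50 + log (12 * (C₀ + 1)) ≤ c₀ * D) :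
    C₀ * rexp (-(c₀ * D * x)) ≤ rexp (-(50 * x)) / 12 := by
  have h1 : 0 ≤ log (12 * (C₀ + 1)) := Real.log_nonneg (by linarith)
  have h2 : 50 * x + log (12 * (C₀ + 1)) ≤ c₀ * D * x := by nlinarith
  have h3 : rexp (-(c₀ * D * x)) ≤ rexp (-(50 * x)) / (12 * (C₀ + 1)) := by
    have e : rexp (-(50 * x) - log (12 * (C₀ + 1))) = rexp (-(50 * x)) / (12 * (C₀ + 1)) := by
      rw [Real.exp_sub, Real.exp_log (by linarith)]
    rw [← e]
    exact Real.exp_le_exp.2 (by linarith)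
  refine (mul_le_mul_of_nonneg_left h3 hC.le).trans ?_
  rw [mul_div_assoc', div_le_div_iff₀ (by linarith) (by norm_num)]
  nlinarith [Real.exp_pos (-(50 * x))]

include hε hε0 hT hh in
lemma step_size_bounds : 0 < h ∧ h ≤ 1 / 10 ^ 40 ∧ h * T ≤ ε / 1000 := by
  have h0 : 0 < h := by rw [hh]; positivity
  have h1 : h * T = ε / 1000 := by rw [hh]; field_simp
  exact ⟨h0, by nlinarith, h1.le⟩

include hC hc hε hε0 hT hh hδ in
lemma psi_radial_le (hM : 1 ≤ M) (hD : 1000 * M ≤ D) (hD2 : 50 + log (12 * (C₀ + 1)) ≤ c₀ * D)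
    {t : ℝ} (ht : 1 / 5 ≤ t) (ht2 : t ≤ 2 * T) :
    C₀ * rexp (-(c₀ * (t / 2 / δ))) ≤ ε / 20 * gaussTail t := by
  have hD0 : 0 < D := by linarith
  have h1 : T ^ 2 + 1 / ε ≤ 100 * T ^ 3 / ε := by
    rw [le_div_iff₀ hε, add_mul, one_div, inv_mul_cancel₀ hε.ne']
    have : T ^ 2 ≤ T ^ 3 := pow_le_pow_right₀ hT (by norm_num)
    have h1T : 1 ≤ T ^ 2 := one_le_pow₀ hT
    nlinarith
  have h2 : c₀ * D * (T ^ 2 + 1 / ε) ≤ c₀ * (t / 2 / δ) := by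
    have e : t / 2 / δ = D * (5 * t * (100 * T ^ 3 / ε)) := by
      rw [hδ, hh]; field_simp; ring
    rw [e, mul_assoc]
    have h3 : 100 * T ^ 3 / ε ≤ 5 * t * (100 * T ^ 3 / ε) :=
      le_mul_of_one_le_left (by positivity) (by linarith)
    gcongr
    exact h1.trans h3
  have h3 := le_exp_scale (D := D) (c₀ := c₀) hC (x := T ^ 2 + 1 / ε)
    (by have := one_le_pow₀ (n := 2) hT
        have : 0 < 1 / ε := by positivity
        linarith) hD2
  have h4 : rexp (-(c₀ * (t / 2 / δ))) ≤ rexp (-(c₀ * D * (T ^ 2 + 1 / ε))) :=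
    Real.exp_le_exp.2 (by linarith)
  have h5 := le_gaussTail (t := 2 * T) (by linarith)
  have h6 := gaussTail_anti ht2
  have h7 : rexp (-(50 * (T ^ 2 + 1 / ε))) ≤ ε / 20 * rexp (-(2 * T) ^ 2) := by
    have e1 : rexp (-(50 * (T ^ 2 + 1 / ε))) ≤ rexp (-(20 / ε)) * rexp (-(2 * T) ^ 2) := by
      rw [← Real.exp_add]
      apply Real.exp_le_exp.2
      have : 50 * (1 / ε) = 50 / ε := by ring
      have h20 : 20 / ε ≤ 50 / ε := by gcongr; norm_num
      nlinarith [sq_nonneg T]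
    have e2 : rexp (-(20 / ε)) ≤ ε / 20 := by
      rw [Real.exp_neg, inv_le_comm₀ (Real.exp_pos _) (by positivity), inv_div]
      have := Real.add_one_le_exp (20 / ε)
      linarith
    exact e1.trans (by gcongr)
  calc C₀ * rexp (-(c₀ * (t / 2 / δ))) ≤ C₀ * rexp (-(c₀ * D * (T ^ 2 + 1 / ε))) := by gcongr
    _ ≤ rexp (-(50 * (T ^ 2 + 1 / ε))) / 12 := h3
    _ ≤ ε / 20 * (rexp (-(2 * T) ^ 2) / 12) := by linarith
    _ ≤ ε / 20 * gaussTail t := by gcongr; linarith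

end regimes

section regimes
variable {n : ℕ} {μ : Measure (EuclideanSpace ℝ (Fin n))} [IsProbabilityMeasure μ]
  {C₀ c₀ : ℝ} (hC : 0 < C₀) (hc : 0 < c₀) (hψ : HasPsiOneMarginals μ C₀ c₀)
  (hμ : Measure.IsEven μ) (hn : 0 < n) {ε T h δ M D : ℝ}
  (hε : 0 < ε) (hε0 : ε ≤ 1 / 10 ^ 40) (hT : 1 ≤ T) (hM : 1 ≤ M) (hD : 1000 * M ≤ D)
  (hD2 : 50 + log (12 * (C₀ + 1)) ≤ c₀ * D)
  (hh : h = ε / (1000 * T)) (hδ : δ = h / (D * T ^ 2))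
  (ha : ∀ t, 0 < t → t ≤ T + 8 * h →
    |∫ Z, marginalTail μ Z t ∂sGauss n - gaussTail t| ≤ 2 * ε * gaussTail t)

include hC hc hψ hμ hn hε hε0 hT hM hD hD2 hh hδ ha in
lemma radial_regime (hN : T ^ 6 * (10 ^ 20 * D ^ 2) ≤ n * ε ^ 2)
    (hR : 40 * T ^ 2 ≤ log (1 / ε))
    (hint : ∀ (k : ℕ) (θ : EuclideanSpace ℝ (Fin n)), ‖θ‖ = 1 →
      Integrable (fun x => ⟪x, θ⟫ ^ (2 * k)) μ)
    (hM2 : ∀ k ≤ 5, ∀ θ : EuclideanSpace ℝ (Fin n), ‖θ‖ = 1 → ∫ x, ⟪x, θ⟫ ^ (2 * k) ∂μ ≤ M)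
    {t : ℝ} (ht : 0 < t) (htT : t ≤ T + 7 * h) :
    (sGauss n).real {Z | (1 + 8 * ε) * gaussTail (t + h) < marginalTail μ Z (t + h)} ≤
        2 * rexp (-(n * δ ^ 2) / 5) ∧
      (sGauss n).real {Z | marginalTail μ Z (t - h) < (1 - 8 * ε) * gaussTail (t - h)} ≤
        2 * rexp (-(n * δ ^ 2) / 5) := by
  obtain ⟨hh0, hh1, hhT⟩ := step_size_bounds hε hε0 hT hh
  have hD0 : 0 < D := by linarith
  have hδ0 : 0 < δ := by rw [hδ]; positivity
  have ht2 : t ≤ 2 * T := by norm_num at hh1; linarith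
  have hε1 : ε ≤ 1 / 10 := hε0.trans (by norm_num)
  have a1 : |∫ x, scaledTail (‖x‖ / √n) 0.1 ∂μ - gaussTail 0.1| ≤ 2 * ε * gaussTail 0.1 := by
    rw [← integral_marginalTail_sGauss hn (by norm_num)]
    exact ha _ (by norm_num) (by norm_num; linarith)
  have a2 : |∫ x, scaledTail (‖x‖ / √n) 1 ∂μ - gaussTail 1| ≤ 2 * ε * gaussTail 1 := by
    rw [← integral_marginalTail_sGauss hn (by norm_num)]
    exact ha _ (by norm_num) (by linarith)
  have hm : μ.real (bulk n)ᶜ ≤ 4 * ε := by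
    refine le_trans (measureReal_mono (fun x hx => ?_) (measure_ne_top _ _))
      (real_small_radius_le a1 a2 hε.le)
    simpa [bulk] using hx
  have hT2 : 1 ≤ T ^ 2 := one_le_pow₀ hT
  have hO : μ.real (offBand n (1 / (16 * T ^ 2))) ≤ gaussTail (2 * T) ^ 2 :=
    (real_off_band_le a1 a2 hε.le (by positivity)
      (div_le_one_of_le₀ (by linarith) (by positivity))).trans (off_band_bound_le hε hε0 hR hT)
  have hg := le_gaussTail_of_radial hε hR hT ht2
  obtain ⟨W, hW⟩ : ∃ W, W = 1340 * M * tailScale t / h + 6 * T ^ 2 * M := ⟨_, rfl⟩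
  obtain ⟨V, hV⟩ : ∃ V, V = 7500 * W ^ 2 + 10 ^ 11 * 2500 ^ 4 * ((h ^ 2)⁻¹) ^ 2 * M ^ 2 / n ^ 3 :=
    ⟨_, rfl⟩
  have hn' : (0 : ℝ) < n := by exact_mod_cast hn
  have hV0 : 0 < V := by rw [hV]; positivity
  have hvar := (integral_sq_marginalTail_sub_le hint hM2 hM hT ht ht2 hO hn hμ).trans
    (variance_bound_le hn hε hε0 hT hM hD hN ht ht2 hg)
  have hhs := integral_hsDeviation_levelWeight_le hint hM2 hM hT ht ht2 hO hn hh0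
  rw [← hW, ← hV] at hhs
  have hWθ : ∀ θ : EuclideanSpace ℝ (Fin n), ‖θ‖ = 1 →
      ∫ x in bulk n, ⟪x, θ⟫ ^ 2 * radialWeight (levelWeight h t) x ∂μ ≤ W := fun θ hθ => by
    have := levelWeight_weight_le hint hM2 hM hT ht ht2 hO hh0 (k := 1) (by norm_num) hθ
    rwa [← hW] at this
  have hQ := step_bound_le hn hε hε0 hT hM hD hN ht ht2 hg hh hδ hW hV
  have hat := ha t ht (by linarith)
  have hh2 : 3 * (1 + t + h) * h ≤ ε / 2 := by
    have : 3 * (1 + t + h) * h ≤ 3 * (4 * T) * h := by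
      gcongr; norm_num at hh1; linarith
    nlinarith
  have hpow := fun j => integrable_norm_pow_bulk hint j
  exact ⟨radial_upper hC hc hψ hμ hn hε hε1 ht hh0 hδ0 hm
      (fun h5 => psi_radial_le hC hc hε hε0 hT hh hδ hM hD hD2 (by linarith) ht2)
      hpow hat hvar hV0 hhs hWθ hQ hh2,
    radial_lower hn hε hε1 ht hh0 hδ0 hm hpow hat hvar hV0 hhs hWθ hQ hh2⟩

include hC hc hψ hn hε hε0 hT hM hD hD2 hh hδ ha in
lemma crude_regime (hR : log (1 / ε) ≤ 40 * T ^ 2) (hE : rexp (-(n * δ ^ 2) / 5) ≤ ε / 400)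
    {t : ℝ} (ht : 0 < t) (htT : t ≤ T + 7 * h) :
    (sGauss n).real {Z | (1 + 8 * ε) * gaussTail (t + h) < marginalTail μ Z (t + h)} ≤
        10 / ε * rexp (-(n * δ ^ 2) / 5) ∧
      (sGauss n).real {Z | marginalTail μ Z (t - h) < (1 - 8 * ε) * gaussTail (t - h)} ≤
        10 / ε * rexp (-(n * δ ^ 2) / 5) := by
  obtain ⟨hh0, hh1, hhT⟩ := step_size_bounds hε hε0 hT hh
  have hD0 : 0 < D := by linarith
  have hδ0 : 0 < δ := by rw [hδ]; positivity
  have ht2 : t + h ≤ 2 * T := by norm_num at hh1; linarith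
  have hε1 : ε ≤ 1 / 10 := hε0.trans (by norm_num)
  have hT2 : 1 ≤ T ^ 2 := one_le_pow₀ hT
  obtain ⟨b, hb⟩ : ∃ b, b = C₀ * rexp (-(c₀ * (h / δ))) := ⟨_, rfl⟩
  have hb0 : 0 ≤ b := by rw [hb]; positivity
  have hbε : b ≤ ε * gaussTail (2 * T) := by
    have e : c₀ * (h / δ) = c₀ * D * T ^ 2 := by rw [hδ]; field_simp
    have h1 := le_exp_scale hC hT2 hD2
    rw [← e, ← hb] at h1
    have h2 := le_gaussTail (t := 2 * T) (by linarith)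
    have h3 : rexp (-(40 * T ^ 2)) ≤ ε := by
      calc rexp (-(40 * T ^ 2)) ≤ rexp (-log (1 / ε)) := Real.exp_le_exp.2 (by linarith)
        _ = ε := by rw [one_div, Real.log_inv, neg_neg, Real.exp_log hε]
    have h4 : rexp (-(50 * T ^ 2)) ≤ rexp (-(40 * T ^ 2)) * rexp (-(2 * T) ^ 2) := by
      rw [← Real.exp_add]; exact Real.exp_le_exp.2 (by nlinarith)
    calc b ≤ rexp (-(50 * T ^ 2)) / 12 := h1
      _ ≤ rexp (-(40 * T ^ 2)) * (rexp (-(2 * T) ^ 2) / 12) := by linarith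
      _ ≤ ε * gaussTail (2 * T) := by gcongr
  have hbt : ∀ s ≤ 2 * T, b ≤ ε * gaussTail s := fun s hs =>
    hbε.trans (mul_le_mul_of_nonneg_left (gaussTail_anti hs) hε.le)
  have hth : 3 * (1 + (t + h)) * h ≤ ε / 2 := by
    have : 3 * (1 + (t + h)) * h ≤ 3 * (3 * T) * h := by gcongr; linarith
    nlinarith
  have hat := ha t ht (by linarith)
  have hgt := gaussTail_pos t
  constructor
  · have hshift : gaussTail t ≤ (1 + ε) * gaussTail (t + h) := by
      refine (gaussTail_le_exp_mul (s := t) (t := t + h) (by linarith) (by linarith)).trans ?_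
      rw [mul_comm]
      refine mul_le_mul_of_nonneg_right ?_ (gaussTail_pos _).le
      have h5 : 3 * (1 + (t + h)) * (t + h - t) ≤ ε / 2 := by rw [add_sub_cancel_left]; exact hth
      have h6 := Real.exp_le_exp.2 h5
      have h7 := Real.abs_exp_sub_one_le (x := ε / 2) (by rw [abs_of_pos (by linarith)]; linarith)
      rw [abs_of_pos (show 0 < ε / 2 by linarith)] at h7
      linarith [le_abs_self (rexp (ε / 2) - 1)]
    refine (crude_upper hn (b := b) (s' := t) hε hε1 hδ0.le (fun Y Z hYZ => ?_) ?_ ?_ hshift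
      (hbt _ ht2)).trans ?_
    · rw [hb]; exact marginalTail_add_le hC hc hψ hδ0 hh0 hYZ t
    · have := (abs_le.1 hat).1
      nlinarith
    · have := (abs_le.1 hat).2
      linarith
    · gcongr; norm_num
  · refine crude_lower hn (b := b) hε hε1 hδ0.le hh0 ht (fun j Y Z hYZ => ?_)
      (fun s hs hst => ha s hs (by linarith)) (hbt _ (by linarith)) (by nlinarith) hE
    rcases Nat.eq_zero_or_pos j with rfl | hj
    · have : Z = Y := by
        rw [← dist_le_zero]; simpa using hYZ
      simp only [Nat.cast_zero, zero_mul, sub_zero, this]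
      linarith
    · have hj' : (0 : ℝ) < j := by exact_mod_cast hj
      have := marginalTail_add_le hC hc hψ (mul_pos hj' hδ0) (mul_pos hj' hh0) hYZ (t - j * h)
      rw [sub_add_cancel, mul_div_mul_left _ _ hj'.ne', ← hb] at this
      exact this

include hC hc hψ hμ hn hε hε0 hT hM hD hD2 hh hδ ha in
/-- At a fixed level both one-sided deviations of the Gaussian-direction tail are rare. -/
lemma real_deviation_le (hN : T ^ 6 * (10 ^ 20 * D ^ 2) ≤ n * ε ^ 2)
    (hint : ∀ (k : ℕ) (θ : EuclideanSpace ℝ (Fin n)), ‖θ‖ = 1 →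
      Integrable (fun x => ⟪x, θ⟫ ^ (2 * k)) μ)
    (hM2 : ∀ k ≤ 5, ∀ θ : EuclideanSpace ℝ (Fin n), ‖θ‖ = 1 → ∫ x, ⟪x, θ⟫ ^ (2 * k) ∂μ ≤ M)
    (hE : rexp (-(n * δ ^ 2) / 5) ≤ ε / 400) {t : ℝ} (ht : 0 < t) (htT : t ≤ T + 7 * h) :
    (sGauss n).real {Z | (1 + 8 * ε) * gaussTail (t + h) < marginalTail μ Z (t + h)} ≤
        10 / ε * rexp (-(n * δ ^ 2) / 5) ∧
      (sGauss n).real {Z | marginalTail μ Z (t - h) < (1 - 8 * ε) * gaussTail (t - h)} ≤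
        10 / ε * rexp (-(n * δ ^ 2) / 5) := by
  rcases le_total (40 * T ^ 2) (log (1 / ε)) with hR | hR
  · have h1 : 2 * rexp (-(n * δ ^ 2) / 5) ≤ 10 / ε * rexp (-(n * δ ^ 2) / 5) := by
      gcongr
      rw [le_div_iff₀ hε]
      norm_num at hε0
      linarith
    have h2 := radial_regime hC hc hψ hμ hn hε hε0 hT hM hD hD2 hh hδ ha hN hR hint hM2 ht htT
    exact ⟨h2.1.trans h1, h2.2.trans h1⟩
  · exact crude_regime hC hc hψ hn hε hε0 hT hM hD hD2 hh hδ ha hR hE ht htT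

end regimes

section transfer
variable {n : ℕ} {μ : Measure (EuclideanSpace ℝ (Fin n))} [IsProbabilityMeasure μ]

lemma convexOn_scaledTail {r : ℝ} (hr : 0 ≤ r) : ConvexOn ℝ (Set.Ici 0) (scaledTail r) := by
  rcases hr.eq_or_lt with rfl | hr
  · have : scaledTail 0 = fun _ => (0 : ℝ) := by ext t; simp [scaledTail]
    rw [this]
    exact convexOn_const _ (convex_Ici 0)
  · have : scaledTail r = fun t => gaussTail (t / r) := by ext t; simp [scaledTail, hr.ne']
    rw [this]
    refine ⟨convex_Ici 0, fun x hx y hy a b ha hb hab => ?_⟩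
    have h := convexOn_gaussTail.2 (x := x / r) (y := y / r) (div_nonneg hx hr.le)
      (div_nonneg hy hr.le) ha hb hab
    simp only [smul_eq_mul] at h ⊢
    rwa [mul_div_assoc', mul_div_assoc', ← add_div] at h

lemma integral_marginalTail_convex (hn : 0 < n) {x y a b : ℝ} (hx : 0 < x) (hy : 0 < y)
    (ha : 0 ≤ a) (hb : 0 ≤ b) (hab : a + b = 1) :
    ∫ Z, marginalTail μ Z (a * x + b * y) ∂sGauss n ≤
      a * ∫ Z, marginalTail μ Z x ∂sGauss n + b * ∫ Z, marginalTail μ Z y ∂sGauss n := by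
  have hxy : 0 < a * x + b * y := by
    rcases ha.eq_or_lt with rfl | ha
    · have : b = 1 := by linarith
      subst this; simpa using hy
    · have := mul_nonneg hb hy.le
      have := mul_pos ha hx
      linarith
  rw [integral_marginalTail_sGauss hn hx, integral_marginalTail_sGauss hn hy,
    integral_marginalTail_sGauss hn hxy, ← integral_const_mul, ← integral_const_mul,
    ← integral_add ((integrable_scaledTail _).const_mul _) ((integrable_scaledTail _).const_mul _)]
  refine integral_mono (integrable_scaledTail _)
    (((integrable_scaledTail _).const_mul _).add ((integrable_scaledTail _).const_mul _))
    fun z => ?_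
  exact (convexOn_scaledTail (by positivity)).2 hx.le hy.le ha hb hab

omit [IsProbabilityMeasure μ] in
lemma marginalTail_normalize {Z : EuclideanSpace ℝ (Fin n)} (hZ : 0 < ‖Z‖) (t : ℝ) :
    marginalTail μ (‖Z‖⁻¹ • Z) t = marginalTail μ Z (t * ‖Z‖) :=
  marginalTail_smul hZ Z t

variable {σ : Measure (EuclideanSpace ℝ (Fin n))} {κ p : ℝ}

lemma integral_marginalTail_sphere (hn : 0 < n) (hσ : IsUniformSphereMeasure σ) (t : ℝ) :
    ∫ η, marginalTail μ η t ∂σ = ∫ Z, marginalTail μ (‖Z‖⁻¹ • Z) t ∂sGauss n := by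
  rw [uniformSphere_eq_map_sGauss hn hσ]
  exact integral_map measurable_normalize.aemeasurable
    (measurable_marginalTail t).aestronglyMeasurable

lemma integral_le_add_real {f g : EuclideanSpace ℝ (Fin n) → ℝ} {ρ : Measure (EuclideanSpace ℝ (Fin n))}
    [IsProbabilityMeasure ρ] {B : Set (EuclideanSpace ℝ (Fin n))} (hB : MeasurableSet B)
    (hf : Integrable f ρ) (hg : Integrable g ρ) (hf1 : ∀ Z, f Z ≤ 1) (hg0 : ∀ Z, 0 ≤ g Z)
    (hfg : ∀ Z, Z ∉ B → f Z ≤ g Z) : ∫ Z, f Z ∂ρ ≤ ∫ Z, g Z ∂ρ + ρ.real B := by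
  have hi : Integrable (B.indicator (1 : EuclideanSpace ℝ (Fin n) → ℝ)) ρ :=
    (integrable_const (1 : ℝ)).indicator hB
  rw [← integral_indicator_one hB, ← integral_add hg hi]
  refine integral_mono hf (hg.add hi) fun Z => ?_
  by_cases hZ : Z ∈ B
  · have := hf1 Z
    have := hg0 Z
    simp only [Set.indicator_of_mem hZ, Pi.one_apply]
    linarith
  · simp only [Set.indicator_of_notMem hZ]
    linarith [hfg Z hZ]

omit [IsProbabilityMeasure μ] in
lemma measurableSet_norm_dev : MeasurableSet {Z : EuclideanSpace ℝ (Fin n) | κ ≤ |‖Z‖ - 1|} :=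
  measurableSet_le measurable_const (by fun_prop)

lemma normalize_bounds (hκ1 : κ < 1) {Z : EuclideanSpace ℝ (Fin n)}
    (hZ : Z ∉ {Z : EuclideanSpace ℝ (Fin n) | κ ≤ |‖Z‖ - 1|}) {t : ℝ} (ht : 0 ≤ t) :
    marginalTail μ Z (t * (1 + κ)) ≤ marginalTail μ (‖Z‖⁻¹ • Z) t ∧
      marginalTail μ (‖Z‖⁻¹ • Z) t ≤ marginalTail μ Z (t * (1 - κ)) := by
  rw [Set.mem_ofPred_eq, not_le, abs_lt] at hZ
  rw [marginalTail_normalize (by linarith)]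
  exact ⟨marginalTail_anti _ (by gcongr; linarith), marginalTail_anti _ (by gcongr; linarith)⟩

lemma integrable_marginalTail_normalize (t : ℝ) :
    Integrable (fun Z => marginalTail μ (‖Z‖⁻¹ • Z) t) (sGauss n) :=
  Integrable.of_bound
    ((measurable_marginalTail t).comp measurable_normalize).aestronglyMeasurable 1
    (Filter.Eventually.of_forall fun Z => by
      rw [Real.norm_of_nonneg (marginalTail_nonneg _ _)]
      exact marginalTail_le_one _ _)

lemma sphere_transfer (hn : 0 < n) (hσ : IsUniformSphereMeasure σ) (hκ1 : κ < 1)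
    (hp : (sGauss n).real {Z | κ ≤ |‖Z‖ - 1|} ≤ p) {t : ℝ} (ht : 0 ≤ t) :
    ∫ Z, marginalTail μ Z (t * (1 + κ)) ∂sGauss n ≤ ∫ η, marginalTail μ η t ∂σ + p ∧
      ∫ η, marginalTail μ η t ∂σ ≤ ∫ Z, marginalTail μ Z (t * (1 - κ)) ∂sGauss n + p := by
  rw [integral_marginalTail_sphere hn hσ]
  constructor
  · refine (integral_le_add_real measurableSet_norm_dev (integrable_marginalTail _)
      (integrable_marginalTail_normalize t) (fun Z => marginalTail_le_one _ _)
      (fun Z => marginalTail_nonneg _ _)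
      (fun Z hZ => (normalize_bounds hκ1 hZ ht).1)).trans (by linarith)
  · refine (integral_le_add_real measurableSet_norm_dev (integrable_marginalTail_normalize t)
      (integrable_marginalTail _) (fun Z => marginalTail_le_one _ _)
      (fun Z => marginalTail_nonneg _ _)
      (fun Z hZ => (normalize_bounds hκ1 hZ ht).2)).trans (by linarith)

omit [IsProbabilityMeasure μ] in
lemma exp_le_one_add {x c : ℝ} (hx : x ≤ c) (hc : 0 ≤ c) (hc1 : c ≤ 1 / 100) :
    rexp x ≤ 1 + 1.1 * c := by
  have h1 := Real.exp_le_exp.2 hx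
  have h2 := Real.abs_exp_sub_one_sub_id_le (x := c) (by rw [abs_of_nonneg hc]; linarith)
  have h3 := (abs_le.1 h2).2
  nlinarith

variable {ε T h : ℝ} (hε : 0 < ε) (hε0 : ε ≤ 1 / 10 ^ 40) (hT : 1 ≤ T)
  (hh : h = ε / (1000 * T)) (hκ : κ = h / (10 * T))

include hε hε0 hT hh in
lemma gaussTail_shift_le {s t : ℝ} (hst : s ≤ t) (ht : 0 ≤ t) (ht2 : t ≤ 2 * T)
    (hd : t - s ≤ 9 * h) : gaussTail s ≤ (1 + 0.1 * ε) * gaussTail t := by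
  obtain ⟨hh0, hh1, hhT⟩ := step_size_bounds hε hε0 hT hh
  refine (gaussTail_le_exp_mul hst ht).trans ?_
  rw [mul_comm]
  refine mul_le_mul_of_nonneg_right ?_ (gaussTail_pos _).le
  have h1 : 3 * (1 + t) * (t - s) ≤ 0.09 * ε := by
    calc 3 * (1 + t) * (t - s) ≤ 3 * (3 * T) * (9 * h) := by gcongr; linarith
      _ ≤ _ := by linarith
  norm_num at hε0
  refine (exp_le_one_add h1 (by linarith) (by linarith)).trans (by linarith)

variable (hn : 0 < n) (hσ : IsUniformSphereMeasure σ)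
  (hp : (sGauss n).real {Z | κ ≤ |‖Z‖ - 1|} ≤ p) (hp2 : p ≤ ε / 10 * gaussTail (2 * T))
  (hS : ∀ t ∈ Set.Icc 0 T, (1 - ε) * gaussTail t ≤ ∫ η, marginalTail μ η t ∂σ ∧
    ∫ η, marginalTail μ η t ∂σ ≤ (1 + ε) * gaussTail t)

include hε hε0 hT hh hκ hn hσ hp hp2 hS

lemma gaussian_average_upper {s : ℝ} (hs : 0 < s) (hsT : s ≤ T + 8 * h) :
    ∫ Z, marginalTail μ Z s ∂sGauss n ≤ (1 + 2 * ε) * gaussTail s := by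
  obtain ⟨hh0, hh1, hhT⟩ := step_size_bounds hε hε0 hT hh
  norm_num at hε0 hh1
  have hs2 : s ≤ 2 * T := by linarith
  have hκT : κ * T = h / 10 := by rw [hκ]; field_simp
  have hκ0 : 0 < κ := by rw [hκ]; positivity
  have hκ1 : κ < 1 := by nlinarith
  obtain ⟨t, ht⟩ : ∃ t, t = min s T / (1 + κ) := ⟨_, rfl⟩
  have hm0 : 0 < min s T := lt_min hs (by linarith)
  have ht0 : 0 < t := by rw [ht]; positivity
  have htm : t * (1 + κ) = min s T := by rw [ht]; field_simp
  have htT : t ≤ T := by have := min_le_right s T; nlinarith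
  have hts : t * (1 + κ) ≤ s := htm ▸ min_le_left s T
  have hts' : t ≤ s := by nlinarith
  have hd : s - t ≤ 9 * h := by
    have h1 : s - 8 * h ≤ min s T := le_min (by linarith) (by linarith)
    have h2 : t * κ ≤ h / 10 := by nlinarith
    nlinarith
  have h1 := (sphere_transfer (μ := μ) hn hσ hκ1 hp ht0.le).1
  have h2 := (hS t ⟨ht0.le, htT⟩).2
  have h3 : ∫ Z, marginalTail μ Z s ∂sGauss n ≤ ∫ Z, marginalTail μ Z (t * (1 + κ)) ∂sGauss n :=
    integral_mono (integrable_marginalTail _) (integrable_marginalTail _)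
      fun Z => marginalTail_anti Z hts
  have h4 := gaussTail_shift_le hε (by norm_num; linarith) hT hh hts' hs.le hs2 hd
  have h5 := gaussTail_anti hs2
  have h6 := gaussTail_pos s
  calc ∫ Z, marginalTail μ Z s ∂sGauss n ≤ (1 + ε) * gaussTail t + p := by linarith
    _ ≤ (1 + ε) * ((1 + 0.1 * ε) * gaussTail s) + ε / 10 * gaussTail s := by
        gcongr
        exact hp2.trans (by gcongr)
    _ = (1 + 1.2 * ε + 0.1 * ε ^ 2) * gaussTail s := by ring
    _ ≤ _ := by
        have : ε ^ 2 ≤ ε := pow_le_of_le_one hε.le (by linarith) (by norm_num)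
        exact mul_le_mul_of_nonneg_right (by linarith) h6.le

lemma gaussian_average_lower_of_le {s : ℝ} (hs : 0 < s) (hsT : s ≤ T * (1 - κ)) :
    (1 - 1.3 * ε) * gaussTail s ≤ ∫ Z, marginalTail μ Z s ∂sGauss n := by
  obtain ⟨hh0, hh1, hhT⟩ := step_size_bounds hε hε0 hT hh
  norm_num at hε0 hh1
  have hκT : κ * T = h / 10 := by rw [hκ]; field_simp
  have hκ0 : 0 < κ := by rw [hκ]; positivity
  have hκ1 : κ < 1 := by nlinarith
  obtain ⟨t, ht⟩ : ∃ t, t = s / (1 - κ) := ⟨_, rfl⟩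
  have hκ2 : 0 < 1 - κ := by linarith
  have ht0 : 0 < t := by rw [ht]; positivity
  have htm : t * (1 - κ) = s := by rw [ht]; field_simp
  have htT : t ≤ T := by rw [ht, div_le_iff₀ hκ2]; exact hsT
  have hst : s ≤ t := by nlinarith
  have hd : t - s ≤ 9 * h := by
    have h2 : t * κ ≤ h / 10 := by nlinarith
    nlinarith
  have h1 := (sphere_transfer (μ := μ) hn hσ hκ1 hp ht0.le).2
  rw [htm] at h1
  have h2 := (hS t ⟨ht0.le, htT⟩).1
  have h4 := gaussTail_shift_le hε (by norm_num; linarith) hT hh hst ht0.le (by linarith) hd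
  have h5 := gaussTail_anti (show s ≤ 2 * T by linarith)
  have h6 := gaussTail_pos s
  have h7 := gaussTail_pos t
  have h8 : (1 - 0.1 * ε) * gaussTail s ≤ gaussTail t := by
    have : (1 - 0.1 * ε) * gaussTail s ≤ (1 - 0.1 * ε) * ((1 + 0.1 * ε) * gaussTail t) := by
      gcongr; linarith
    nlinarith [mul_nonneg (sq_nonneg ε) h7.le]
  have h9 : ε / 10 * gaussTail (2 * T) ≤ ε / 10 * gaussTail s := by gcongr
  have h10 : (1 - ε) * ((1 - 0.1 * ε) * gaussTail s) ≤ (1 - ε) * gaussTail t := by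
    gcongr; linarith
  nlinarith [mul_nonneg (sq_nonneg ε) h6.le, mul_pos hε h6]

lemma gaussian_average_lower {s : ℝ} (hs : 0 < s) (hsT : s ≤ T + 8 * h) :
    (1 - 2 * ε) * gaussTail s ≤ ∫ Z, marginalTail μ Z s ∂sGauss n := by
  obtain ⟨hh0, hh1, hhT⟩ := step_size_bounds hε hε0 hT hh
  have hκT : κ * T = h / 10 := by rw [hκ]; field_simp
  rcases le_or_gt s (T * (1 - κ)) with hsv | hsv
  · refine le_trans ?_
      (gaussian_average_lower_of_le hε hε0 hT hh hκ hn hσ hp hp2 hS hs hsv)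
    have := mul_pos hε (gaussTail_pos s)
    linarith
  obtain ⟨v, hv⟩ : ∃ v, v = T * (1 - κ) := ⟨_, rfl⟩
  obtain ⟨w, hw⟩ : ∃ w, w = 1 / (10 * T) := ⟨_, rfl⟩
  have hvT : v = T - h / 10 := by rw [hv]; linarith
  rw [← hv] at hsv
  have hw0 : 0 < w := by rw [hw]; positivity
  have hwT : w * T = 1 / 10 := by rw [hw]; field_simp
  have hw1 : w ≤ 1 / 10 := by nlinarith
  norm_num at hε0 hh1
  have hε0' : ε ≤ 1 / 10 ^ 40 := by norm_num; exact hε0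
  have hu0 : 0 < v - w := by linarith
  have hd : 0 < s - v := by linarith
  have hl := gaussian_average_lower_of_le hε hε0' hT hh hκ hn hσ hp hp2 hS (s := v)
    (by linarith) hv.le
  have hup := gaussian_average_upper hε hε0' hT hh hκ hn hσ hp hp2 hS hu0 (by linarith)
  obtain ⟨lam, hlam⟩ : ∃ lam, lam = (s - v) / (s - v + w) := ⟨_, rfl⟩
  have hlam0 : 0 ≤ lam := by rw [hlam]; positivity
  have hlam1 : lam ≤ 0.081 * ε := by
    rw [hlam, div_le_iff₀ (by linarith)]
    have h1 : s - v ≤ 8.1 * h := by linarith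
    have h2 : h = 0.01 * ε * w := by rw [hh, hw]; field_simp; norm_num
    nlinarith [mul_pos hε hd]
  have hcv := integral_marginalTail_convex (μ := μ) hn hu0 hs hlam0
    (show 0 ≤ 1 - lam by linarith) (by ring)
  have hpt : lam * (v - w) + (1 - lam) * s = v := by rw [hlam]; field_simp; ring
  rw [hpt] at hcv
  have hgu : gaussTail (v - w) ≤ 2 * gaussTail v := by
    refine (gaussTail_le_exp_mul (s := v - w) (t := v) (by linarith) (by linarith)).trans ?_
    rw [mul_comm]
    refine mul_le_mul_of_nonneg_right ?_ (gaussTail_pos _).le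
    have h1 : 3 * (1 + v) * (v - (v - w)) ≤ 0.6 := by
      have : 3 * (1 + v) * (v - (v - w)) ≤ 3 * (2 * T) * w := by
        rw [sub_sub_cancel]; gcongr; linarith
      linarith
    refine (Real.exp_le_exp.2 h1).trans ?_
    have h2 := Real.exp_one_lt_d9
    have h3 : rexp 0.6 ^ 5 ≤ 2 ^ 5 := by
      rw [← Real.exp_nat_mul]
      calc rexp ((5 : ℕ) * 0.6) = rexp 1 ^ 3 := by rw [← Real.exp_nat_mul]; norm_num
        _ ≤ 2.7182818286 ^ 3 := by gcongr
        _ ≤ _ := by norm_num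
    exact le_of_pow_le_pow_left₀ (by norm_num) (by norm_num) h3
  have hgv : gaussTail s ≤ gaussTail v := gaussTail_anti hsv.le
  have hg0 := gaussTail_pos v
  have hgs := gaussTail_pos s
  have e1 : lam * ∫ Z, marginalTail μ Z (v - w) ∂sGauss n ≤ 0.25 * ε * gaussTail v := by
    calc lam * ∫ Z, marginalTail μ Z (v - w) ∂sGauss n
        ≤ 0.081 * ε * ((1 + 2 * ε) * (2 * gaussTail v)) := by
          gcongr
          · exact integral_nonneg fun Z => marginalTail_nonneg _ _
          · exact hup.trans (by gcongr)
      _ = (0.162 + 0.324 * ε) * (ε * gaussTail v) := by ring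
      _ ≤ 0.25 * (ε * gaussTail v) := by gcongr; linarith
      _ = _ := by ring
  have e2 : (1 - lam) * ∫ Z, marginalTail μ Z s ∂sGauss n ≤ ∫ Z, marginalTail μ Z s ∂sGauss n := by
    have : 0 ≤ ∫ Z, marginalTail μ Z s ∂sGauss n :=
      integral_nonneg fun Z => marginalTail_nonneg _ _
    nlinarith
  have e3 : (1 - 2 * ε) * gaussTail s ≤ (1 - 2 * ε) * gaussTail v := by gcongr; linarith
  nlinarith [mul_pos hε hg0]

lemma gaussian_average_close {s : ℝ} (hs : 0 < s) (hsT : s ≤ T + 8 * h) :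
    |∫ Z, marginalTail μ Z s ∂sGauss n - gaussTail s| ≤ 2 * ε * gaussTail s := by
  have h1 := gaussian_average_upper hε hε0 hT hh hκ hn hσ hp hp2 hS hs hsT
  have h2 := gaussian_average_lower hε hε0 hT hh hκ hn hσ hp hp2 hS hs hsT
  rw [abs_le]
  constructor <;> linarith

end transfer

section sphere
variable {n : ℕ} {μ σ : Measure (EuclideanSpace ℝ (Fin n))} [IsProbabilityMeasure μ]
  {κ p c s s' q : ℝ}

lemma sphere_real_le (hn : 0 < n) (hσ : IsUniformSphereMeasure σ)
    (hp : (sGauss n).real {Z | κ ≤ |‖Z‖ - 1|} ≤ p) {A B : Set (EuclideanSpace ℝ (Fin n))}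
    (hA : MeasurableSet A) (hB : (sGauss n).real B ≤ q)
    (hAB : ∀ Z, Z ∉ {Z : EuclideanSpace ℝ (Fin n) | κ ≤ |‖Z‖ - 1|} → ‖Z‖⁻¹ • Z ∈ A → Z ∈ B) :
    σ.real A ≤ p + q := by
  rw [uniformSphere_eq_map_sGauss hn hσ, measureReal_def,
    Measure.map_apply measurable_normalize hA, ← measureReal_def]
  refine (measureReal_mono (fun Z hZ => ?_) (measure_ne_top _ _)).trans
    ((measureReal_union_le {Z | κ ≤ |‖Z‖ - 1|} B).trans (add_le_add hp hB))
  by_cases h : Z ∈ {Z : EuclideanSpace ℝ (Fin n) | κ ≤ |‖Z‖ - 1|}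
  · exact Or.inl h
  · exact Or.inr (hAB Z h hZ)

lemma sphere_real_upper (hn : 0 < n) (hσ : IsUniformSphereMeasure σ) (hκ1 : κ < 1)
    (hp : (sGauss n).real {Z | κ ≤ |‖Z‖ - 1|} ≤ p) (hs : 0 ≤ s') (hss : s ≤ s' * (1 - κ))
    (hq : (sGauss n).real {Z | c < marginalTail μ Z s} ≤ q) :
    σ.real {ξ | c < marginalTail μ ξ s'} ≤ p + q :=
  sphere_real_le hn hσ hp (measurableSet_lt measurable_const (measurable_marginalTail _)) hq
    fun _ hZ hA => lt_of_lt_of_le hA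
      ((normalize_bounds hκ1 hZ hs).2.trans (marginalTail_anti _ hss))

lemma sphere_real_lower (hn : 0 < n) (hσ : IsUniformSphereMeasure σ) (hκ1 : κ < 1)
    (hp : (sGauss n).real {Z | κ ≤ |‖Z‖ - 1|} ≤ p) (hs : 0 ≤ s') (hss : s' * (1 + κ) ≤ s)
    (hq : (sGauss n).real {Z | marginalTail μ Z s < c} ≤ q) :
    σ.real {ξ | marginalTail μ ξ s' < c} ≤ p + q :=
  sphere_real_le hn hσ hp (measurableSet_lt (measurable_marginalTail _) measurable_const) hq
    fun _ hZ hA => lt_of_le_of_lt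
      ((marginalTail_anti _ hss).trans (normalize_bounds hκ1 hZ hs).1) hA

end sphere

section grid
variable {n : ℕ} {μ σ : Measure (EuclideanSpace ℝ (Fin n))} [IsProbabilityMeasure μ]
  {ε T h : ℝ} (hε : 0 < ε) (hε0 : ε ≤ 1 / 10 ^ 40) (hT : 1 ≤ T) (hh : h = ε / (1000 * T))

include hε hε0 hT hh

lemma marginalTail_lower_of_grid {ξ : EuclideanSpace ℝ (Fin n)} {N : ℕ} (hN : T / h ≤ N)
    (hlo : ∀ j < N + 1, (1 - 8 * ε) * gaussTail ((j + 1) * h) ≤ marginalTail μ ξ (j * h))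
    {t : ℝ} (ht : 0 ≤ t) (htT : t ≤ T) :
    (1 - 10 * ε) * gaussTail t ≤ marginalTail μ ξ t := by
  obtain ⟨hh0, hh1, hhT⟩ := step_size_bounds hε hε0 hT hh
  norm_num at hh1
  have h1 := Nat.le_ceil (t / h)
  have h2 := Nat.ceil_lt_add_one (show 0 ≤ t / h by positivity)
  have h3 : t / h ≤ T / h := by gcongr
  have hj : ⌈t / h⌉₊ < N + 1 := by
    have : (⌈t / h⌉₊ : ℝ) < (N + 1 : ℕ) := by push_cast; linarith
    exact_mod_cast this
  have h4 := hlo _ hj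
  generalize (⌈t / h⌉₊ : ℝ) = x at *
  rw [div_le_iff₀ hh0] at h1
  have h5 : x * h < t + h := by
    have := mul_lt_mul_of_pos_right h2 hh0
    rwa [add_mul, div_mul_cancel₀ _ hh0.ne', one_mul] at this
  have h6 := marginalTail_anti (μ := μ) ξ h1
  have h7 := gaussTail_shift_le hε hε0 hT hh (s := t) (t := (x + 1) * h) (by linarith)
    (by linarith) (by linarith) (by linarith)
  have h8 := gaussTail_pos t
  have h9 := gaussTail_pos ((x + 1) * h)
  generalize gaussTail ((x + 1) * h) = g at *
  generalize gaussTail t = g' at *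
  norm_num at hε0
  have h10 : (1 - 0.1 * ε) * g' ≤ g := by
    have : (1 - 0.1 * ε) * g' ≤ (1 - 0.1 * ε) * ((1 + 0.1 * ε) * g) := by
      gcongr; linarith
    nlinarith [mul_nonneg (sq_nonneg ε) h9.le]
  have h11 : (1 - 8 * ε) * ((1 - 0.1 * ε) * g') ≤ (1 - 8 * ε) * g := by
    gcongr; linarith
  nlinarith [mul_nonneg (sq_nonneg ε) h8.le, mul_pos hε h8]

lemma marginalTail_upper_of_grid (hμ : Measure.IsEven μ) {ξ : EuclideanSpace ℝ (Fin n)} {N : ℕ}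
    (hN : T / h ≤ N)
    (hlo : ∀ j < N + 1, (1 - 8 * ε) * gaussTail ((j + 1) * h) ≤ marginalTail μ ξ (j * h))
    (hup : ∀ j < N + 1, marginalTail μ ξ ((j + 3) * h) ≤ (1 + 8 * ε) * gaussTail ((j + 2) * h))
    {t : ℝ} (ht : 0 ≤ t) (htT : t ≤ T) :
    marginalTail μ ξ t ≤ (1 + 10 * ε) * gaussTail t := by
  obtain ⟨hh0, hh1, hhT⟩ := step_size_bounds hε hε0 hT hh
  have hhε : h ≤ ε / 1000 := by nlinarith
  norm_num at hh1
  rcases le_or_gt (3 * h) t with h3 | h3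
  · have h3' : 3 ≤ t / h := by rwa [le_div_iff₀ hh0]
    have hf : 3 ≤ ⌊t / h⌋₊ := Nat.le_floor (by exact_mod_cast h3')
    obtain ⟨j, hj⟩ := Nat.exists_eq_add_of_le' hf
    have h1 := Nat.floor_le (show 0 ≤ t / h by positivity)
    have h2 := Nat.lt_floor_add_one (t / h)
    rw [hj] at h1 h2
    push_cast at h1 h2
    have hTh : t / h ≤ T / h := by gcongr
    have hjN : j < N + 1 := by
      have : (j : ℝ) < (N + 1 : ℕ) := by push_cast; linarith
      exact_mod_cast this
    have h4 := hup j hjN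
    rw [le_div_iff₀ hh0] at h1
    rw [div_lt_iff₀ hh0] at h2
    have h5 := marginalTail_anti (μ := μ) ξ h1
    have h6 := gaussTail_shift_le hε hε0 hT hh (s := (j + 2) * h) (t := t) (by linarith)
      ht (by linarith) (by linarith)
    have h8 := gaussTail_pos t
    norm_num at hε0
    calc marginalTail μ ξ t ≤ (1 + 8 * ε) * ((1 + 0.1 * ε) * gaussTail t) :=
          h5.trans (h4.trans (by gcongr))
      _ = (1 + 8.1 * ε + 0.8 * ε ^ 2) * gaussTail t := by ring
      _ ≤ _ := by
          have : ε ^ 2 ≤ ε := pow_le_of_le_one hε.le (by linarith) (by norm_num)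
          exact mul_le_mul_of_nonneg_right (by linarith) h8.le
  · have hN1 : 1 < N + 1 := by
      have h5 : 0 < T / h := by positivity
      have : (1 : ℝ) < (N + 1 : ℕ) := by push_cast; linarith
      exact_mod_cast this
    have h1 := hlo 1 hN1
    rw [Nat.cast_one, one_mul] at h1
    have h2 := marginalTail_zero_le hμ ξ hh0
    have h4 := marginalTail_anti (μ := μ) ξ ht
    have h5 := half_sub_le_gaussTail (t := (1 + 1) * h) (by linarith)
    have h6 := half_sub_le_gaussTail ht
    have h7 : (1 - 8 * ε) * (1 / 2 - (1 + 1) * h) ≤ (1 - 8 * ε) * gaussTail ((1 + 1) * h) := by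
      norm_num at hε0
      gcongr
      · linarith
      · linarith
    have h8 : (1 + 10 * ε) * (1 / 2 - 3 * h) ≤ (1 + 10 * ε) * gaussTail t := by
      gcongr
      linarith
    have h9 : ε * h ≤ 1 * h := by
      norm_num at hε0
      gcongr
      linarith
    have h10 : marginalTail μ ξ t ≤ 1 - (1 - 8 * ε) * (1 / 2 - (1 + 1) * h) :=
      h4.trans (h2.trans (sub_le_sub_left (h7.trans h1) 1))
    refine h10.trans (le_trans ?_ h8)
    clear h1 h2 h4 h5 h6 h7 h8 h10 hlo hup
    nlinarith

end grid

section parameters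
variable {n : ℕ} {T ε ζ D L h δ κ : ℝ} (hn : 2 ≤ n) (hε : 0 < ε) (hε0 : ε ≤ 1 / 10 ^ 40)
  (hζ : 0 < ζ) (hζ1 : ζ < 1) (hT : 1 ≤ T) (hD : 1 ≤ D)
  (hL : L = log n + log (1 / ε) + log (1 / ζ))
  (hN : T ^ 6 * L * (10 ^ 20 * D ^ 2) ≤ n * ε ^ 2)
  (hh : h = ε / (1000 * T)) (hδ : δ = h / (D * T ^ 2)) (hκ : κ = h / (10 * T))

include hn hε hζ hL in
lemma exp_neg_log_sum : rexp (-L) = ε * ζ / n := by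
  have hn' : (0 : ℝ) < n := by exact_mod_cast (by omega : 0 < n)
  have h1 : -L = log ε + log ζ - log n := by
    rw [hL, one_div, one_div, Real.log_inv, Real.log_inv]; ring
  rw [h1, Real.exp_sub, Real.exp_add, Real.exp_log hε, Real.exp_log hζ, Real.exp_log hn']

include hn hε hε0 hζ hζ1 hL in
lemma one_le_log_sum : 1 ≤ L := by
  have h1 : 0 ≤ log n := Real.log_nonneg (by exact_mod_cast (by omega : 1 ≤ n))
  have h2 : 0 ≤ log (1 / ζ) := Real.log_nonneg (by rw [le_div_iff₀ hζ]; linarith)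
  have h3 : 1 ≤ log (1 / ε) := by
    rw [Real.le_log_iff_exp_le (by positivity), le_div_iff₀ hε]
    have := Real.exp_one_lt_d9
    norm_num at hε0
    nlinarith
  linarith

include hT hD hN hh hδ hε in
lemma nine_le_step : 20 * L ≤ n * δ ^ 2 := by
  have hT0 : 0 < T := by linarith
  have hD0 : 0 < D := by linarith
  have e : n * δ ^ 2 = n * ε ^ 2 / (10 ^ 6 * D ^ 2 * T ^ 6) := by
    rw [hδ, hh]; field_simp; norm_num
  rw [e, le_div_iff₀ (by positivity)]
  rcases le_or_gt L 0 with h | h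
  · exact (mul_nonpos_of_nonpos_of_nonneg (by linarith) (by positivity)).trans (by positivity)
  · refine le_trans ?_ hN
    have : 0 < L * (D ^ 2 * T ^ 6) := by positivity
    nlinarith

include hT hD hN hh hκ hε in
lemma radius_scale_le (hL1 : 1 ≤ L) : 80 * T ^ 2 + 80 * L ≤ n * κ ^ 2 := by
  have hT0 : 0 < T := by linarith
  have hT2 : 1 ≤ T ^ 2 := one_le_pow₀ hT
  have hD2 : 1 ≤ D ^ 2 := one_le_pow₀ hD
  have e : n * κ ^ 2 = n * ε ^ 2 / (10 ^ 8 * T ^ 4) := by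
    rw [hκ, hh]; field_simp; norm_num
  rw [e, le_div_iff₀ (by positivity)]
  refine le_trans ?_ hN
  have h1 : T ^ 2 + L ≤ 2 * (T ^ 2 * L) := by nlinarith
  have h2 : 0 < T ^ 6 * L := by positivity
  calc (80 * T ^ 2 + 80 * L) * (10 ^ 8 * T ^ 4) = 8000000000 * T ^ 4 * (T ^ 2 + L) := by ring
    _ ≤ 8000000000 * T ^ 4 * (2 * (T ^ 2 * L)) := by gcongr
    _ = T ^ 6 * L * (16000000000 * 1) := by ring
    _ ≤ T ^ 6 * L * (10 ^ 20 * D ^ 2) := by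
        gcongr
        norm_num

include hn hε hε0 hζ hζ1 hT hD hL hN hh hδ hκ

lemma failure_probability_bounds :
    8 ≤ κ * √n ∧ rexp (-(n * δ ^ 2) / 5) ≤ (ε * ζ / n) ^ 4 ∧
      2 * rexp (-(n * κ ^ 2) / 20) ≤ 2 * (ε * ζ / n) ^ 4 * rexp (-(2 * T) ^ 2) := by
  have hL1 := one_le_log_sum hn hε hε0 hζ hζ1 hL
  have h1 := nine_le_step hε hT hD hN hh hδ
  have h2 := radius_scale_le hε hT hD hN hh hκ hL1
  rw [← exp_neg_log_sum hn hε hζ hL]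
  have hκ0 : 0 < κ := by rw [hκ, hh]; positivity
  refine ⟨?_, ?_, ?_⟩
  · have hT2 : 1 ≤ T ^ 2 := one_le_pow₀ hT
    refine abs_le_of_sq_le_sq' ?_ (by positivity) |>.2
    rw [mul_pow, Real.sq_sqrt (Nat.cast_nonneg n)]
    linarith
  · rw [← Real.exp_nat_mul]
    apply Real.exp_le_exp.2
    push_cast
    linarith
  · rw [mul_assoc, ← Real.exp_nat_mul, ← Real.exp_add]
    gcongr
    push_cast
    linarith

end parameters

lemma pow_six_mul_le {c T n ε L : ℝ} (hT : 1 ≤ T) (hL : 0 < L) (hc : 0 < c) (hn : 0 < n)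
    (hε : 0 < ε) (h : T ≤ (c * n * ε ^ 2 / L) ^ ((1 : ℝ) / 6)) : T ^ 6 * L ≤ c * (n * ε ^ 2) := by
  have h0 : 0 ≤ c * n * ε ^ 2 / L := by positivity
  have h1 : T ^ 6 ≤ ((c * n * ε ^ 2 / L) ^ ((1 : ℝ) / 6)) ^ 6 := by gcongr
  rw [← Real.rpow_natCast ((c * n * ε ^ 2 / L) ^ ((1 : ℝ) / 6)) 6, ← Real.rpow_mul h0] at h1
  norm_num at h1
  rw [le_div_iff₀ hL] at h1
  linarith

lemma exists_moment_bound_le_five {C₀ c₀ : ℝ} (hC : 0 < C₀) (hc : 0 < c₀) :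
    ∃ M : ℝ, 1 ≤ M ∧ ∀ {n : ℕ} (μ : Measure (EuclideanSpace ℝ (Fin n))), IsProbabilityMeasure μ →
      HasPsiOneMarginals μ C₀ c₀ → ∀ k ≤ 5, ∀ θ : EuclideanSpace ℝ (Fin n), ‖θ‖ = 1 →
        ∫ x, ⟪x, θ⟫ ^ (2 * k) ∂μ ≤ M := by
  choose M hM1 hM using exists_moment_bound hC hc
  refine ⟨∑ k ∈ Finset.range 6, M k, ?_, fun μ hμ hψ k hk θ hθ => ?_⟩
  · exact (hM1 0).trans (Finset.single_le_sum (fun i _ => by linarith [hM1 i]) (by simp))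
  · exact (hM k μ hμ hψ θ hθ).2.trans (Finset.single_le_sum (f := M)
      (fun i _ => by linarith [hM1 i]) (Finset.mem_range.2 (by omega)))

section main
variable {n : ℕ} {μ σ : Measure (EuclideanSpace ℝ (Fin n))} [IsProbabilityMeasure μ]

/-- Union bound over the grid of levels `j * h`. -/
lemma sphere_real_deviation_le (hσ : IsProbabilityMeasure σ) (hμ : Measure.IsEven μ)
    {ε T h r : ℝ} (hε : 0 < ε)
    (hε0 : ε ≤ 1 / 10 ^ 40) (hT : 1 ≤ T) (hh : h = ε / (1000 * T)) {N : ℕ} (hN : T / h ≤ N)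
    (hlo : ∀ j < N + 1,
      σ.real {ξ | marginalTail μ ξ (j * h) < (1 - 8 * ε) * gaussTail ((j + 1) * h)} ≤ r)
    (hup : ∀ j < N + 1,
      σ.real {ξ | (1 + 8 * ε) * gaussTail ((j + 2) * h) < marginalTail μ ξ ((j + 3) * h)} ≤ r) :
    σ.real {ξ | ∃ t ∈ Set.Icc 0 T, 10 * ε < |marginalTail μ ξ t / gaussTail t - 1|} ≤
      2 * (N + 1) * r := by
  obtain ⟨A, hA⟩ : ∃ A : ℕ → Set (EuclideanSpace ℝ (Fin n)), ∀ j, A j =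
    {ξ | marginalTail μ ξ (j * h) < (1 - 8 * ε) * gaussTail ((j + 1) * h)} := ⟨_, fun _ => rfl⟩
  obtain ⟨B, hB⟩ : ∃ B : ℕ → Set (EuclideanSpace ℝ (Fin n)), ∀ j, B j =
    {ξ | (1 + 8 * ε) * gaussTail ((j + 2) * h) < marginalTail μ ξ ((j + 3) * h)} :=
    ⟨_, fun _ => rfl⟩
  simp only [← hA] at hlo
  simp only [← hB] at hup
  have hsub : {ξ | ∃ t ∈ Set.Icc 0 T, 10 * ε < |marginalTail μ ξ t / gaussTail t - 1|} ⊆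
      (⋃ j ∈ Finset.range (N + 1), A j) ∪ ⋃ j ∈ Finset.range (N + 1), B j := by
    intro ξ hξ
    by_contra hcon
    simp only [Set.mem_union, Set.mem_iUnion, Finset.mem_range, not_or, not_exists] at hcon
    obtain ⟨t, ⟨ht0, htT⟩, hbig⟩ := hξ
    have h1 : ∀ j < N + 1, (1 - 8 * ε) * gaussTail ((j + 1) * h) ≤ marginalTail μ ξ (j * h) :=
      fun j hj => by
        have := hcon.1 j hj
        rw [hA] at this
        exact not_lt.1 this
    have h2 : ∀ j < N + 1,
        marginalTail μ ξ ((j + 3) * h) ≤ (1 + 8 * ε) * gaussTail ((j + 2) * h) :=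
      fun j hj => by
        have := hcon.2 j hj
        rw [hB] at this
        exact not_lt.1 this
    have h3 := marginalTail_lower_of_grid hε hε0 hT hh hN h1 ht0 htT
    have h4 := marginalTail_upper_of_grid hε hε0 hT hh hμ hN h1 h2 ht0 htT
    have h5 := gaussTail_pos t
    rw [← le_div_iff₀ h5] at h3
    rw [← div_le_iff₀ h5] at h4
    exact absurd hbig (not_lt.2 (abs_le.2 ⟨by linarith, by linarith⟩))
  have hsum : ∀ F : ℕ → Set (EuclideanSpace ℝ (Fin n)), (∀ j < N + 1, σ.real (F j) ≤ r) →
      σ.real (⋃ j ∈ Finset.range (N + 1), F j) ≤ (N + 1) * r := fun F hF => by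
    refine (measureReal_biUnion_finset_le _ _).trans
      ((Finset.sum_le_card_nsmul _ _ r fun j hj => hF j (Finset.mem_range.1 hj)).trans ?_)
    simp
  calc _ ≤ σ.real ((⋃ j ∈ Finset.range (N + 1), A j) ∪ ⋃ j ∈ Finset.range (N + 1), B j) :=
        measureReal_mono hsub (measure_ne_top _ _)
    _ ≤ _ := measureReal_union_le _ _
    _ ≤ (N + 1) * r + (N + 1) * r := add_le_add (hsum A hlo) (hsum B hup)
    _ = _ := by ring

end main

section conclusion
variable {n : ℕ} {T ε ζ D h : ℝ} (hn : 2 ≤ n) (hε : 0 < ε) (hε0 : ε ≤ 1 / 10 ^ 40)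
  (hζ : 0 < ζ) (hζ1 : ζ < 1) (hT : 1 ≤ T)

include hn hε hε0 hζ hζ1 hT in
lemma union_bound_le (hT2 : T ^ 2 ≤ n) (hh : h = ε / (1000 * T)) {N p q : ℝ}
    (hN : N ≤ T / h + 1) (hp : p ≤ 2 * (ε * ζ / n) ^ 4) (hp0 : 0 ≤ p)
    (hq : q ≤ (ε * ζ / n) ^ 4) (hq0 : 0 ≤ q) :
    2 * (N + 1) * (p + 10 / ε * q) ≤ ζ := by
  have hn1 : (1 : ℝ) ≤ n := by exact_mod_cast (by omega : 1 ≤ n)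
  have hn' : (0 : ℝ) < n := by linarith
  norm_num at hε0
  have h1 : 1 ≤ 1 / ε := by rw [le_div_iff₀ hε]; linarith
  have h2 : T / h = 1000 * T ^ 2 / ε := by rw [hh]; field_simp
  have h3 : N + 1 ≤ 1002 * n / ε := by
    have : 1000 * T ^ 2 / ε ≤ 1000 * n / ε := by gcongr
    have h4 : 1 ≤ n / ε := by rw [le_div_iff₀ hε]; linarith
    calc N + 1 ≤ 1000 * n / ε + 2 * (n / ε) := by linarith
      _ = _ := by ring
  have h5 : p + 10 / ε * q ≤ 12 / ε * (ε * ζ / n) ^ 4 := by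
    have h6 : 0 ≤ (ε * ζ / n) ^ 4 := by positivity
    calc p + 10 / ε * q ≤ 1 / ε * (2 * (ε * ζ / n) ^ 4) + 10 / ε * (ε * ζ / n) ^ 4 := by
          gcongr
          exact hp.trans (le_mul_of_one_le_left (by positivity) h1)
      _ = _ := by ring
  have h7 : 0 ≤ p + 10 / ε * q := by positivity
  have hζ4 : ζ ^ 4 ≤ ζ := pow_le_of_le_one hζ.le hζ1.le (by norm_num)
  calc 2 * (N + 1) * (p + 10 / ε * q)
      ≤ 2 * (1002 * n / ε) * (12 / ε * (ε * ζ / n) ^ 4) := by gcongr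
    _ = 24048 * ε ^ 2 * ζ ^ 4 / n ^ 3 := by field_simp; norm_num
    _ ≤ 24048 * ε ^ 2 * ζ ^ 4 := div_le_self (by positivity) (one_le_pow₀ hn1)
    _ ≤ 1 * ζ := by
        gcongr
        nlinarith
    _ = ζ := one_mul ζ

variable {μ σ : Measure (EuclideanSpace ℝ (Fin n))} [IsProbabilityMeasure μ]
  {C₀ c₀ M : ℝ}

set_option maxHeartbeats 1000000 in
include hn hε hε0 hζ hζ1 hT in
theorem sphere_real_deviation_le_of_average (hC : 0 < C₀) (hc : 0 < c₀)
    (hψ : HasPsiOneMarginals μ C₀ c₀) (hμ : Measure.IsEven μ) (hσ : IsUniformSphereMeasure σ)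
    (hM : 1 ≤ M) (hM2 : ∀ k ≤ 5, ∀ θ : EuclideanSpace ℝ (Fin n), ‖θ‖ = 1 →
      ∫ x, ⟪x, θ⟫ ^ (2 * k) ∂μ ≤ M)
    (hD : 1000 * M ≤ D) (hD2 : 50 + log (12 * (C₀ + 1)) ≤ c₀ * D)
    (hN : T ^ 6 * (log n + log (1 / ε) + log (1 / ζ)) * (10 ^ 20 * D ^ 2) ≤ n * ε ^ 2)
    (hS : ∀ t ∈ Set.Icc 0 T, (1 - ε) * gaussTail t ≤ ∫ η, marginalTail μ η t ∂σ ∧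
      ∫ η, marginalTail μ η t ∂σ ≤ (1 + ε) * gaussTail t) :
    σ.real {ξ | ∃ t ∈ Set.Icc 0 T, 10 * ε < |marginalTail μ ξ t / gaussTail t - 1|} ≤ ζ := by
  have hn0 : 0 < n := by omega
  have hn1 : (1 : ℝ) ≤ n := by exact_mod_cast (by omega : 1 ≤ n)
  have hD1 : 1 ≤ D := by linarith
  obtain ⟨L, hL⟩ : ∃ L, L = log n + log (1 / ε) + log (1 / ζ) := ⟨_, rfl⟩
  obtain ⟨h, hh⟩ : ∃ h, h = ε / (1000 * T) := ⟨_, rfl⟩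
  obtain ⟨δ, hδ⟩ : ∃ δ, δ = h / (D * T ^ 2) := ⟨_, rfl⟩
  obtain ⟨κ, hκ⟩ : ∃ κ, κ = h / (10 * T) := ⟨_, rfl⟩
  rw [← hL] at hN
  have hL1 := one_le_log_sum hn hε hε0 hζ hζ1 hL
  obtain ⟨hκn, hE, hP⟩ := failure_probability_bounds hn hε hε0 hζ hζ1 hT hD1 hL hN hh hδ hκ
  obtain ⟨hh0, hh1, hhT⟩ := step_size_bounds hε hε0 hT hh
  have hN' : T ^ 6 * (10 ^ 20 * D ^ 2) ≤ n * ε ^ 2 := by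
    refine le_trans ?_ hN
    gcongr
    exact le_mul_of_one_le_right (by positivity) hL1
  have hT2 : T ^ 2 ≤ n := by
    have h1 : T ^ 2 ≤ T ^ 6 := pow_le_pow_right₀ hT (by norm_num)
    have h2 : 1 ≤ 10 ^ 20 * D ^ 2 := by
      have h5 : 1 ≤ D ^ 2 := one_le_pow₀ hD1
      linarith
    have h3 : T ^ 6 ≤ T ^ 6 * (10 ^ 20 * D ^ 2) := le_mul_of_one_le_right (by positivity) h2
    have h4 : n * ε ^ 2 ≤ n * 1 := by
      norm_num at hε0
      gcongr
      exact pow_le_one₀ hε.le (by linarith)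
    linarith
  have hκT : κ * T = h / 10 := by rw [hκ]; field_simp
  have hκ0 : 0 < κ := by rw [hκ]; positivity
  norm_num at hh1
  have hκ1 : κ < 1 := by
    rw [hκ, div_lt_one (by positivity)]
    linarith
  obtain ⟨p, hp⟩ : ∃ p, p = 2 * rexp (-(n * κ ^ 2) / 20) := ⟨_, rfl⟩
  obtain ⟨q, hq⟩ : ∃ q, q = rexp (-(n * δ ^ 2) / 5) := ⟨_, rfl⟩
  have hpγ : (sGauss n).real {Z | κ ≤ |‖Z‖ - 1|} ≤ p := hp ▸ sGauss_norm_tail hn0 hκn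
  rw [← hp] at hP
  rw [← hq] at hE
  have hx : (ε * ζ / n) ^ 4 ≤ ε ^ 4 := by
    gcongr
    exact (div_le_self (by positivity) hn1).trans (mul_le_of_le_one_right hε.le hζ1.le)
  have hε3 : ε ^ 4 ≤ ε / 400 := by
    norm_num at hε0
    have h1 : ε ^ 3 ≤ ε := pow_le_of_le_one hε.le (by linarith) (by norm_num)
    calc ε ^ 4 = ε * ε ^ 3 := by ring
      _ ≤ ε * (1 / 400) := by gcongr; linarith
      _ = _ := by ring
  have hE400 : rexp (-(n * δ ^ 2) / 5) ≤ ε / 400 := hq ▸ hE.trans (hx.trans hε3)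
  have hp2 : p ≤ ε / 10 * gaussTail (2 * T) := by
    have h1 := le_gaussTail (t := 2 * T) (by linarith)
    have h2 := Real.exp_pos (-(2 * T) ^ 2)
    calc p ≤ 2 * (ε * ζ / n) ^ 4 * rexp (-(2 * T) ^ 2) := hP
      _ ≤ 2 * (ε / 400) * rexp (-(2 * T) ^ 2) := by
          gcongr
          exact hx.trans hε3
      _ = ε * (1 / 200 * rexp (-(2 * T) ^ 2)) := by ring
      _ ≤ ε * (1 / 10 * gaussTail (2 * T)) := mul_le_mul_of_nonneg_left (by linarith) hε.le
      _ = _ := by ring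
  have hp4 : p ≤ 2 * (ε * ζ / n) ^ 4 := by
    refine hP.trans (mul_le_of_le_one_right (by positivity) (Real.exp_le_one_iff.2 ?_))
    rw [neg_nonpos]
    positivity
  have ha : ∀ t, 0 < t → t ≤ T + 8 * h →
      |∫ Z, marginalTail μ Z t ∂sGauss n - gaussTail t| ≤ 2 * ε * gaussTail t :=
    fun t => gaussian_average_close hε hε0 hT hh hκ hn0 hσ hpγ hp2 hS
  have hint : ∀ (k : ℕ) (θ : EuclideanSpace ℝ (Fin n)), ‖θ‖ = 1 →
      Integrable (fun x => ⟪x, θ⟫ ^ (2 * k)) μ := fun k θ hθ => by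
    obtain ⟨_, _, h1⟩ := exists_moment_bound hC hc k
    exact (h1 μ ‹_› hψ θ hθ).1
  have hdev := fun (t : ℝ) ht htT => real_deviation_le (t := t) hC hc hψ hμ hn0 hε hε0 hT hM hD hD2
    hh hδ ha hN' hint hM2 hE400 ht htT
  rw [← hq] at hdev
  obtain ⟨N, hNdef⟩ : ∃ N, N = ⌈T / h⌉₊ := ⟨_, rfl⟩
  have hN1 : T / h ≤ N := hNdef ▸ Nat.le_ceil (T / h)
  have hN2 : (N : ℝ) < T / h + 1 := hNdef ▸ Nat.ceil_lt_add_one (by positivity)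
  have hjT : ∀ j < N + 1, (j : ℝ) * h ≤ T + h := fun j hj => by
    have h1 : (j : ℝ) ≤ N := by exact_mod_cast Nat.lt_succ_iff.1 hj
    have h2 : (j : ℝ) * h ≤ (T / h + 1) * h := by gcongr; linarith
    rwa [add_mul, div_mul_cancel₀ _ hh0.ne', one_mul] at h2
  refine (sphere_real_deviation_le (N := N) (r := p + 10 / ε * q) hσ.prob hμ hε hε0 hT hh hN1
    (fun j hj => ?_) (fun j hj => ?_)).trans
    (union_bound_le hn hε hε0 hζ hζ1 hT hT2 hh hN2.le hp4 (by rw [hp]; positivity) hE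
      (by rw [hq]; positivity))
  · have hj2 := hjT j hj
    have hj0 : 0 ≤ (j : ℝ) * h := by positivity
    refine sphere_real_lower (s := (j + 1) * h) hn0 hσ hκ1 hpγ hj0 ?_ ?_
    · have : κ * (j * h) ≤ κ * (2 * T) :=
        mul_le_mul_of_nonneg_left (by linarith) hκ0.le
      linarith
    have h1 := (hdev ((j + 2) * h) (by positivity) (by linarith)).2
    rwa [show ((j : ℝ) + 2) * h - h = (j + 1) * h by ring] at h1
  · have hj2 := hjT j hj
    have hj0 : 0 ≤ (j : ℝ) * h := by positivity
    refine sphere_real_upper (s := (j + 2) * h) hn0 hσ hκ1 hpγ (by positivity) ?_ ?_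
    · have : κ * ((j + 3) * h) ≤ κ * (2 * T) :=
        mul_le_mul_of_nonneg_left (by linarith) hκ0.le
      linarith
    · have h1 := (hdev ((j + 1) * h) (by positivity) (by linarith)).1
      rwa [show ((j : ℝ) + 1) * h + h = (j + 2) * h by ring] at h1

end conclusion

end GaussMarginals

open GaussMarginals

theorem stmt11 (C₀ c₀ : ℝ) (hC₀ : 0 < C₀) (hc₀ : 0 < c₀) :
    ∃ ε₀ c₁ : ℝ, 0 < ε₀ ∧ 0 < c₁ ∧
      ∀ (n : ℕ), 2 ≤ n →
        ∀ (μ : Measure (EuclideanSpace ℝ (Fin n))), IsProbabilityMeasure μ →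
          Measure.IsEven μ → HasPsiOneMarginals μ C₀ c₀ →
          ∀ (σ : Measure (EuclideanSpace ℝ (Fin n))), IsUniformSphereMeasure σ →
            ∀ T ε ζ : ℝ, 0 < ε → ε < ε₀ → 0 < ζ → ζ < 1 →
              1 ≤ T →
              T ≤ (c₁ * n * ε ^ 2 /
                    (Real.log n + Real.log (1 / ε) + Real.log (1 / ζ))) ^ ((1:ℝ)/6) →
              (∀ t ∈ Set.Icc (0:ℝ) T,
                (1 - ε) * (1 - gaussCDF t) ≤ (∫ η, (1 - marginalCDF μ η t) ∂σ) ∧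
                (∫ η, (1 - marginalCDF μ η t) ∂σ) ≤ (1 + ε) * (1 - gaussCDF t)) →
              (σ {ξ | ∃ t ∈ Set.Icc (0:ℝ) T,
                  10 * ε < |(1 - marginalCDF μ ξ t) / (1 - gaussCDF t) - 1|}).toReal ≤ ζ := by
  obtain ⟨M, hM, hM2⟩ := exists_moment_bound_le_five hC₀ hc₀
  obtain ⟨D, hD, hD2⟩ : ∃ D : ℝ, 1000 * M ≤ D ∧ 50 + log (12 * (C₀ + 1)) ≤ c₀ * D := by
    refine ⟨max (1000 * M) ((50 + log (12 * (C₀ + 1))) / c₀), le_max_left _ _, ?_⟩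
    rw [mul_comm c₀, ← div_le_iff₀ hc₀]
    exact le_max_right _ _
  have hD0 : 0 < D := by linarith
  refine ⟨1 / 10 ^ 40, 1 / (10 ^ 20 * D ^ 2), by norm_num, by positivity, ?_⟩
  intro n hn μ hμP hμ hψ σ hσ T ε ζ hε hε0 hζ hζ1 hT hTle hS
  simp only [one_sub_gaussCDF, one_sub_marginalCDF] at hS ⊢
  have hn' : (0 : ℝ) < n := by exact_mod_cast (by omega : 0 < n)
  have hL1 := one_le_log_sum hn hε hε0.le hζ hζ1 rfl
  have hN := pow_six_mul_le hT (by linarith) (by positivity) hn' hε hTle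
  rw [div_mul_eq_mul_div, one_mul, le_div_iff₀ (by positivity)] at hN
  exact sphere_real_deviation_le_of_average hn hε hε0.le hζ hζ1 hT hC₀ hc₀ hψ hμ hσ hM
    (hM2 μ hμP hψ) hD hD2 hN hS
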